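/- Let S ⊂ ℤ be a finite nonempty set with S = −S and such that s+t ∉ S for all s,t ∈ ℕ∖S, and let m = max(S). Write F_S = F_S(x,u) and, for U ⊆ [m−1], F_S^U = F_S^U(x,u). Then F_S = 1 + Σ_{U⊆[m−1]} F_S^U, and: (a) if 0 ∈ S or U ≠ ∅, then F_S^U = Σ_{V⊆[m−1]} u·D_S^{U,V}(e^x − 1, F_S)·(1 + Σ_{W⊆[m−1]} C_S^{V,W}(F_S)·F_S^W); (b) if 0 ∉ S, then F_S^∅ = (1 − e^{−xu})·(1 + Σ_{V⊆[m−1]} C_S^{∅,V}(F_S)·F_S^V) + Σ_{V⊆[m−1]} u·(D_S^{∅,V}(e^x − 1, F_S) − 1_{V=∅}·(e^x − 1))·(1 + Σ_{W⊆[m−1]} C_S^{V,W}(F_S)·F_S^W), where 1_{V=∅} equals 1 if V = ∅ and 0 otherwise. -/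

import Mathlib

open scoped BigOperators Classical

namespace Braid

/-- The hyperplane `{x ∈ ℝ^n | x i - x j = s}`. -/
def hyp (n : ℕ) (i j : Fin n) (s : ℝ) : Set (Fin n → ℝ) := {x | x i - x j = s}

/-- The arrangement `A_S^n`, as a set of hyperplanes. -/
def arrS (S : Set ℤ) (n : ℕ) : Set (Set (Fin n → ℝ)) :=
  {H | ∃ i j : Fin n, ∃ s : ℤ, i < j ∧ s ∈ S ∧ H = hyp n i j (s : ℝ)}

/-- The `m`-Catalan arrangement `A_m^n = A_{[-m;m]}^n`. -/
def catArr (m n : ℕ) : Set (Set (Fin n → ℝ)) := arrS {s : ℤ | s.natAbs ≤ m} n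

/-- `(i,j,s) ∈ Tr_m^n`. -/
def TrIdx (m n : ℕ) (i j : Fin n) (s : ℕ) : Prop := s ≤ m ∧ i ≠ j ∧ (0 < s ∨ j < i)

/-- `(i,j,s) ∈ Tr_m^n(A)`. -/
def TrIdxA (m n : ℕ) (A : Set (Set (Fin n → ℝ))) (i j : Fin n) (s : ℕ) : Prop :=
  TrIdx m n i j s ∧ hyp n i j (s : ℝ) ∈ A

/-- A transitive arrangement `A ⊆ A_m^n`. -/
def IsTransitive (m n : ℕ) (A : Set (Set (Fin n → ℝ))) : Prop :=
  ∀ i j k : Fin n, i ≠ j → j ≠ k → i ≠ k → ∀ s t : ℕ,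
    TrIdx m n i j s → TrIdx m n j k t →
    hyp n i j (s : ℝ) ∉ A → hyp n j k (t : ℝ) ∉ A → hyp n i k ((s : ℝ) + (t : ℝ)) ∉ A

/-- A strongly transitive arrangement. -/
def IsStronglyTransitive (n : ℕ) (A : Set (Set (Fin n → ℝ))) : Prop :=
  ∀ i j k : Fin n, i ≠ j → j ≠ k → i ≠ k → ∀ s t : ℕ,
    hyp n i j (s : ℝ) ∉ A → hyp n j k (t : ℝ) ∉ A → hyp n i k ((s : ℝ) + (t : ℝ)) ∉ A

/-- An `(m,n)`-tree: a rooted `(m+1)`-ary tree with `n` nodes labeled by `Fin n`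
(leaves unlabeled), encoded by the root-to-node lists of child indices. -/
structure Tree (m n : ℕ) where
  path : Fin n → List ℕ
  entry_le : ∀ v : Fin n, ∀ s ∈ path v, s ≤ m
  inj : Function.Injective path
  parent_closed : ∀ v : Fin n, path v ≠ [] → ∃ w : Fin n, path w = (path v).dropLast

namespace Tree

variable {m n : ℕ}

/-- The drift of a node. -/
def drift (T : Tree m n) (v : Fin n) : ℕ := (T.path v).sum

/-- `i = s`-child`(j)`. -/
def IsChild (T : Tree m n) (i j : Fin n) (s : ℕ) : Prop := T.path i = T.path j ++ [s]

/-- The `s`-child slot of node `j` is occupied by a node (not a leaf). -/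
def SlotNode (T : Tree m n) (j : Fin n) (s : ℕ) : Prop := ∃ i, T.IsChild i j s

/-- `i = s`-cadet`(j)`. -/
def IsCadet (T : Tree m n) (i j : Fin n) (s : ℕ) : Prop :=
  T.IsChild i j s ∧ ∀ t : ℕ, s < t → t ≤ m → ¬ T.SlotNode j t

end Tree

/-- The order `≺_T` on vertices of a tree, expressed on root-to-vertex paths:
`v ≺_T w` iff `drift(v) < drift(w)`, or the drifts are equal and there is `c ≤ k`
(`k` the length of the path of `v`) with the first `c` entries of both paths equal and
(`c = k` or the entry of the path of `v` at position `c+1` is larger than that of `w`). -/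
def vlt (p q : List ℕ) : Prop :=
  p.sum < q.sum ∨
    (p.sum = q.sum ∧ ∃ c ≤ p.length, p.take c = q.take c ∧
      (c = p.length ∨ ∃ (h1 : c < p.length) (h2 : c < q.length), q.get ⟨c, h2⟩ < p.get ⟨c, h1⟩))

/-- `p ≽_T q`. -/
def vge (p q : List ℕ) : Prop := vlt q p ∨ p = q

/-- A valid marking: `μ` is the set of (lower endpoints of) marked edges; each marked
edge is a cadet edge, and marked `0`-cadet edges `{j, 0cadet(j)}` satisfy `j < 0cadet(j)`. -/
def IsMarking {m n : ℕ} (T : Tree m n) (μ : Set (Fin n)) : Prop :=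
  ∀ i ∈ μ, ∃ j s, T.IsCadet i j s ∧ (s = 0 → (j : ℕ) < (i : ℕ))

/-- The relation `i ∼_μ j`: all edges on the tree path between `i` and `j` are marked. -/
def simMu {m n : ℕ} (T : Tree m n) (μ : Set (Fin n)) : Fin n → Fin n → Prop :=
  Relation.ReflTransGen (fun a b =>
    (a ∈ μ ∧ ∃ s, T.IsChild a b s) ∨ (b ∈ μ ∧ ∃ s, T.IsChild b a s))

/-- The block containing node `i`. -/
def blockOf {m n : ℕ} (T : Tree m n) (μ : Set (Fin n)) (i : Fin n) : Set (Fin n) :=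
  {j | simMu T μ i j}

/-- The set of blocks of a marked tree. -/
def blocksOf {m n : ℕ} (T : Tree m n) (μ : Set (Fin n)) : Set (Set (Fin n)) :=
  {B | ∃ i, B = blockOf T μ i}

/-- The block `B` is `A`-connected. -/
def BlockConnected {m n : ℕ} (A : Set (Set (Fin n → ℝ))) (T : Tree m n)
    (B : Set (Fin n)) : Prop :=
  ∀ i ∈ B, ∀ j ∈ B, Relation.ReflTransGen
    (fun a b => a ∈ B ∧ b ∈ B ∧ hyp n a b ((T.drift a : ℝ) - (T.drift b : ℝ)) ∈ A) i j

/-- The marked tree `(T,μ)` is `A`-connected. -/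
def AConnected {m n : ℕ} (A : Set (Set (Fin n → ℝ))) (T : Tree m n)
    (μ : Set (Fin n)) : Prop :=
  ∀ B ∈ blocksOf T μ, BlockConnected A T B

/-- The `A`-cadet condition. -/
def CadetCond {m n : ℕ} (A : Set (Set (Fin n → ℝ))) (T : Tree m n)
    (μ : Set (Fin n)) : Prop :=
  ∀ i j s, T.IsCadet i j s → i ∉ μ →
    ((s = 0 ∧ (i : ℕ) < (j : ℕ)) ∨
      ∃ i' j', simMu T μ i i' ∧ simMu T μ j j' ∧
        hyp n i' j' ((T.drift i' : ℝ) - (T.drift j' : ℝ)) ∈ A)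

/-- The set `ŌT_m^n` of all marked `(m,n)`-trees. -/
def OTall (m n : ℕ) : Set (Tree m n × Set (Fin n)) := {p | IsMarking p.1 p.2}

/-- The set `ŌT_m^n(A)`. -/
def OTset (m n : ℕ) (A : Set (Set (Fin n → ℝ))) : Set (Tree m n × Set (Fin n)) :=
  {p | IsMarking p.1 p.2 ∧ AConnected A p.1 p.2 ∧ CadetCond A p.1 p.2}

/-- The set `T_m^n(A)` of (unmarked) trees. -/
def Tset (m n : ℕ) (A : Set (Set (Fin n → ℝ))) : Set (Tree m n) :=
  {T | ∀ i j s, TrIdx m n i j s → hyp n i j (s : ℝ) ∉ A → ¬ T.IsCadet i j s}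

/-- The region `Φ_A(T)`. -/
def Phi (m n : ℕ) (A : Set (Set (Fin n → ℝ))) (T : Tree m n) : Set (Fin n → ℝ) :=
  {x | ∀ i j : Fin n, ∀ s : ℕ, TrIdxA m n A i j s →
        (vlt (T.path i) (T.path j ++ [s]) → x i - x j < (s : ℝ)) ∧
        (vge (T.path i) (T.path j ++ [s]) → (s : ℝ) < x i - x j)}

/-- The polyhedron `Φ̄_A(T,μ)`. -/
def PhiBar (m n : ℕ) (A : Set (Set (Fin n → ℝ))) (T : Tree m n) (μ : Set (Fin n)) :
    Set (Fin n → ℝ) :=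
  {x | (∀ i ∈ μ, ∀ j s, T.IsChild i j s → x i - x j = (s : ℝ)) ∧
       ∀ i j : Fin n, ∀ s : ℕ, TrIdxA m n A i j s → ¬ simMu T μ i j →
         (vlt (T.path i) (T.path j ++ [s]) → x i - x j < (s : ℝ)) ∧
         (vge (T.path i) (T.path j ++ [s]) → (s : ℝ) < x i - x j)}

/-- `R` is a region of `A`: a connected component of the complement of the union of `A`. -/
def IsRegion (n : ℕ) (A : Set (Set (Fin n → ℝ))) (R : Set (Fin n → ℝ)) : Prop :=
  ∃ x ∈ (⋃₀ A)ᶜ, R = connectedComponentIn (⋃₀ A)ᶜ x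

/-- `σ` is the hyperplane `H` itself or one of the two open half-spaces bounded by `H`. -/
def IsSideOf (n : ℕ) (σ H : Set (Fin n → ℝ)) : Prop :=
  σ = H ∨ ∃ (i j : Fin n) (s : ℝ), H = hyp n i j s ∧
    (σ = {x | x i - x j < s} ∨ σ = {x | s < x i - x j})

/-- `F` is a face of the arrangement `A`. -/
def IsFace (n : ℕ) (A : Set (Set (Fin n → ℝ))) (F : Set (Fin n → ℝ)) : Prop :=
  F.Nonempty ∧ ∃ σ : Set (Fin n → ℝ) → Set (Fin n → ℝ),
    (∀ H ∈ A, IsSideOf n (σ H) H) ∧ F = ⋂ H ∈ A, σ H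

/-- The dimension of (the affine hull of) a subset of `ℝ^n`. -/
noncomputable def faceDim (n : ℕ) (F : Set (Fin n → ℝ)) : ℕ :=
  Module.finrank ℝ (affineSpan ℝ F).direction

/-- The number `c_{n,k}` of `k`-dimensional faces of `A_S^n`. -/
noncomputable def faceCount (S : Set ℤ) (n k : ℕ) : ℕ :=
  Nat.card {F : Set (Fin n → ℝ) // IsFace n (arrS S n) F ∧ faceDim n F = k}

/-- The face generating function `F_S(x,u) ∈ ℚ[u][[x]]`. -/
noncomputable def FGF (S : Set ℤ) : PowerSeries (Polynomial ℚ) :=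
  PowerSeries.mk fun n => Polynomial.C ((n.factorial : ℚ)⁻¹) *
    ∑ k ∈ Finset.range (n + 1), (faceCount S n k : ℚ) • Polynomial.X ^ k

/-- `e^x` in `ℚ[u][[x]]`. -/
noncomputable def Eexp : PowerSeries (Polynomial ℚ) :=
  PowerSeries.mk fun n => Polynomial.C ((n.factorial : ℚ)⁻¹)

/-- `e^{-x}` in `ℚ[u][[x]]`. -/
noncomputable def EexpNeg : PowerSeries (Polynomial ℚ) :=
  PowerSeries.mk fun n => Polynomial.C ((-1 : ℚ) ^ n * (n.factorial : ℚ)⁻¹)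

/-- The variable `u`, as a constant of `ℚ[u][[x]]`. -/
noncomputable def Useries : PowerSeries (Polynomial ℚ) :=
  PowerSeries.C Polynomial.X

/-- `e^{xu}` in `ℚ[u][[x]]`. -/
noncomputable def Eexu : PowerSeries (Polynomial ℚ) :=
  PowerSeries.mk fun n => ((n.factorial : ℚ)⁻¹) • Polynomial.X ^ n

/-- `e^{-xu}` in `ℚ[u][[x]]`. -/
noncomputable def EexuNeg : PowerSeries (Polynomial ℚ) :=
  PowerSeries.mk fun n => ((-1 : ℚ) ^ n * (n.factorial : ℚ)⁻¹) • Polynomial.X ^ n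
/-- `D` is an `S`-shadow (Finset version). -/
def IsShadowF (S : Set ℤ) (D : Finset ℕ) : Prop :=
  0 ∈ D ∧ ∀ i ∈ D, ∀ j ∈ D,
    Relation.ReflTransGen
      (fun a b => a ∈ D ∧ b ∈ D ∧ (((a : ℤ) - (b : ℤ)) ∈ S ∨ ((b : ℤ) - (a : ℤ)) ∈ S)) i j

/-- `start(D) = D ∩ [m-1]`. -/
def startF (m : ℕ) (D : Finset ℕ) : Finset ℕ := D ∩ Finset.Icc 1 (m - 1)

/-- `end(D) = (max(D) - D) ∩ [m-1]`. -/
def endF (m : ℕ) (D : Finset ℕ) : Finset ℕ :=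
  (D.image fun d => D.sup id - d) ∩ Finset.Icc 1 (m - 1)

/-- The set `𝒟_S^{U,V}` of `S`-shadows with `start(D) = U`, `end(D) = V`. -/
def shadowUV (S : Set ℤ) (m : ℕ) (U V : Finset ℕ) : Set (Finset ℕ) :=
  {D | IsShadowF S D ∧ startF m D = U ∧ endF m D = V}

/-- The series `D_S^{U,V}(e^x - 1, F_S) = Σ_{D ∈ 𝒟_S^{U,V}} (e^x-1)^{|D|} F_S^{max D}`,
defined coefficientwise in `x` (for each `n` only finitely many `D` contribute). -/
noncomputable def Dval (S : Set ℤ) (m : ℕ) (U V : Finset ℕ) : PowerSeries (Polynomial ℚ) :=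
  PowerSeries.mk fun n => ∑ᶠ D ∈ shadowUV S m U V,
    PowerSeries.coeff n ((Eexp - 1) ^ D.card * (FGF S) ^ (D.sup id))

/-- The connection set `C_S^{V,W}` as a `Finset`. -/
noncomputable def connF (S : Set ℤ) (m : ℕ) (V W : Finset ℕ) : Finset ℕ :=
  (Finset.range (m + 1)).filter fun s => s = 0 ∨ (1 ≤ s ∧
    ∃ d ∈ insert 0 V, ∃ d' ∈ insert 0 W, ((s : ℤ) + (d : ℤ) + (d' : ℤ)) ∈ S)

/-- `C_S^{V,W}(Y) = Σ_{s ∈ C_S^{V,W}} Y^s`. -/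
noncomputable def Cval (S : Set ℤ) (m : ℕ) (V W : Finset ℕ)
    (Y : PowerSeries (Polynomial ℚ)) : PowerSeries (Polynomial ℚ) :=
  ∑ s ∈ connF S m V W, Y ^ s

/-- `start` of the root-shadow of a marked tree with root `r`. -/
def rootStart {m n : ℕ} (T : Tree m n) (μ : Set (Fin n)) (r : Fin n) : Set ℕ :=
  {d | (∃ j, simMu T μ r j ∧ T.drift j = d) ∧ 1 ≤ d ∧ d ≤ m - 1}

/-- The generating function `F_S^U` of marked trees in `ŌT(S)` with at least one node whose
root-shadow `D` satisfies `start(D) = U`. -/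
noncomputable def FU (S : Set ℤ) (m : ℕ) (U : Finset ℕ) : PowerSeries (Polynomial ℚ) :=
  PowerSeries.mk fun n => Polynomial.C ((n.factorial : ℚ)⁻¹) *
    ∑ᶠ p ∈ {p : Tree m n × Set (Fin n) | p ∈ OTset m n (arrS S n) ∧
        ∃ r : Fin n, p.1.path r = [] ∧ rootStart p.1 p.2 r = ↑U},
      Polynomial.X ^ (blocksOf p.1 p.2).ncard


/-! ### Sign patterns and the Euler characteristic argument -/

abbrev Trip (n : ℕ) := Fin n × Fin n × ℤ

def fval {n : ℕ} (x : Fin n → ℝ) (h : Trip n) : ℝ := x h.1 - x h.2.1 - (h.2.2 : ℝ)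

noncomputable def pat {n : ℕ} (H : Finset (Trip n)) (x : Fin n → ℝ) : Trip n → SignType :=
  fun h => if h ∈ H then SignType.sign (fval x h) else 1

noncomputable def res {n : ℕ} (H : Finset (Trip n)) (σ : Trip n → SignType) : Trip n → SignType :=
  fun h => if h ∈ H then σ h else 1

def zrel {n : ℕ} (σ : Trip n → SignType) (a b : Fin n) : Prop := ∃ s, σ (a, b, s) = 0

noncomputable def comp {n : ℕ} (σ : Trip n → SignType) : ℕ := Nat.card (Quot (zrel σ))

lemma res_pat {n : ℕ} {H H' : Finset (Trip n)} (h : H ⊆ H') (x : Fin n → ℝ) :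
    res H (pat H' x) = pat H x := by
  funext a
  unfold res pat
  by_cases ha : a ∈ H
  · simp [ha, h ha]
  · simp [ha]

lemma res_res {n : ℕ} {H H' : Finset (Trip n)} (h : H ⊆ H') (σ) :
    res H (res H' σ) = res H σ := by
  funext a
  unfold res
  by_cases ha : a ∈ H
  · simp [ha, h ha]
  · simp [ha]

lemma range_pat_finite {n : ℕ} (H : Finset (Trip n)) : (Set.range (pat H)).Finite := by
  have : Set.range (pat H) ⊆ Set.range (fun f : H → SignType => fun h : Trip n =>
      if hh : h ∈ H then f ⟨h, hh⟩ else 1) := by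
    rintro _ ⟨x, rfl⟩
    refine ⟨fun h => pat H x h, ?_⟩
    funext a
    by_cases ha : a ∈ H <;> simp [pat, ha]
  exact (Set.finite_range _).subset this

noncomputable def pats {n : ℕ} (H : Finset (Trip n)) : Finset (Trip n → SignType) :=
  (range_pat_finite H).toFinset

lemma mem_pats {n : ℕ} {H : Finset (Trip n)} {σ} : σ ∈ pats H ↔ ∃ x, pat H x = σ := by
  simp [pats]

lemma quot_card_congr {α : Type*} {r r' : α → α → Prop}
    (h : ∀ a b, r a b → Relation.EqvGen r' a b) (h' : ∀ a b, r' a b → Relation.EqvGen r a b) :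
    Nat.card (Quot r) = Nat.card (Quot r') := by
  apply Nat.card_congr
  refine ⟨Quot.lift (fun a => Quot.mk r' a) (fun a b hab => Quot.eqvGen_sound (h a b hab)),
    Quot.lift (fun a => Quot.mk r a) (fun a b hab => Quot.eqvGen_sound (h' a b hab)), ?_, ?_⟩
  · rintro ⟨a⟩; rfl
  · rintro ⟨a⟩; rfl

lemma quot_card_add_same {α : Type*} {r : α → α → Prop} {i j : α} (hij : Relation.EqvGen r i j) :
    Nat.card (Quot (fun a b => r a b ∨ (a = i ∧ b = j))) = Nat.card (Quot r) := by
  apply quot_card_congr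
  · rintro a b (h | ⟨rfl, rfl⟩)
    · exact .rel _ _ h
    · exact hij
  · intro a b h
    exact .rel _ _ (Or.inl h)

lemma quot_card_add_diff {α : Type*} [Finite α] {r : α → α → Prop} {i j : α}
    (hij : ¬ Relation.EqvGen r i j) :
    Nat.card (Quot (fun a b => r a b ∨ (a = i ∧ b = j))) + 1 = Nat.card (Quot r) := by
  have hne : Quot.mk r i ≠ Quot.mk r j := fun h => hij (Quot.eqvGen_exact h)
  set r' := (fun a b => r a b ∨ (a = i ∧ b = j)) with hr'
  have e : Quot r' ≃ {q : Quot r // q ≠ Quot.mk r j} := by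
    refine ⟨Quot.lift (fun a => if h : Quot.mk r a = Quot.mk r j then ⟨Quot.mk r i, hne⟩
        else ⟨Quot.mk r a, h⟩) ?_,
      fun q => Quot.lift (fun a => Quot.mk r' a)
        (fun a b hab => Quot.sound (Or.inl hab)) q.1, ?_, ?_⟩
    · rintro a b (h | ⟨rfl, rfl⟩)
      · have : Quot.mk r a = Quot.mk r b := Quot.sound h
        simp [this]
      · simp [hne]
    · rintro ⟨a⟩
      by_cases h : Quot.mk r a = Quot.mk r j
      · simp only [h, dite_true]
        have h1 : Quot.mk r' i = Quot.mk r' j := Quot.sound (Or.inr ⟨rfl, rfl⟩)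
        have h2 : Quot.mk r' a = Quot.mk r' j := by
          have := congrArg (Quot.lift (fun a => Quot.mk r' a)
            (fun a b hab => Quot.sound (Or.inl hab))) h
          exact this
        exact h1.trans h2.symm
      · simp [h]
    · rintro ⟨⟨a⟩, h⟩
      have h' : ¬ Quot.mk r a = Quot.mk r j := h
      simp [h']
  have := Fintype.ofFinite (Quot r)
  have h3 : Fintype.card {q // q ≠ Quot.mk r j} = Fintype.card (Quot r) - 1 := by
    rw [← Set.card_ne_eq (Quot.mk r j)]; rfl
  rw [Nat.card_congr e, Nat.card_eq_fintype_card, Nat.card_eq_fintype_card, h3]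
  have : 0 < Fintype.card (Quot r) := Fintype.card_pos_iff.mpr ⟨Quot.mk r j⟩
  omega

lemma pat_eq_iff {n : ℕ} {H : Finset (Trip n)} {x y : Fin n → ℝ} :
    pat H x = pat H y ↔ ∀ h ∈ H, SignType.sign (fval x h) = SignType.sign (fval y h) := by
  constructor
  · intro e h hh
    have := congrFun e h
    simpa [pat, hh] using this
  · intro e
    funext h
    by_cases hh : h ∈ H
    · simp [pat, hh, e h hh]
    · simp [pat, hh]

lemma eqvGen_sub_const {n : ℕ} {H : Finset (Trip n)} {x y : Fin n → ℝ}
    (hxy : pat H x = pat H y) {i j : Fin n} (hij : Relation.EqvGen (zrel (pat H x)) i j) :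
    x i - x j = y i - y j := by
  induction hij with
  | rel a b h =>
    obtain ⟨s, hs⟩ := h
    have hs' := hs
    rw [hxy] at hs'
    have hm : (a, b, s) ∈ H := by
      by_contra hc
      simp [pat, hc] at hs
    simp [pat, hm, fval, sub_eq_zero] at hs hs'
    rw [hs, hs']
  | refl a => simp
  | symm a b _ ih => linarith
  | trans a b c _ _ ih1 ih2 => linarith

/-- moving a union of components a little does not change the pattern -/
lemma exists_move {n : ℕ} (H : Finset (Trip n)) (x : Fin n → ℝ) (D : Fin n → ℝ)
    (hD : ∀ a b, zrel (pat H x) a b → D a = D b) :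
    ∃ ε > 0, ∀ t : ℝ, |t| < ε → pat H (fun a => x a + t * D a) = pat H x := by
  have key : ∀ h ∈ H, ∃ ε > 0, ∀ t : ℝ, |t| < ε →
      SignType.sign (fval (fun a => x a + t * D a) h) = SignType.sign (fval x h) := by
    intro h hh
    have hf : ∀ t : ℝ, fval (fun a => x a + t * D a) h = fval x h + t * (D h.1 - D h.2.1) := by
      intro t; simp only [fval]; ring
    rcases lt_trichotomy (fval x h) 0 with h0 | h0 | h0
    · refine ⟨(- fval x h) / (|D h.1 - D h.2.1| + 1), by
        apply div_pos <;> [linarith; positivity], fun t ht => ?_⟩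
      rw [sign_neg h0, sign_eq_neg_one_iff, hf]
      have h1 : 0 < |D h.1 - D h.2.1| + 1 := by positivity
      rw [lt_div_iff₀ h1] at ht
      have : t * (D h.1 - D h.2.1) ≤ |t| * |D h.1 - D h.2.1| := by
        rw [← abs_mul]; exact le_abs_self _
      nlinarith [abs_nonneg t]
    · have e : D h.1 = D h.2.1 := hD _ _ ⟨h.2.2, by simp [pat, hh, h0]⟩
      exact ⟨1, one_pos, fun t _ => by rw [hf, e]; simp⟩
    · refine ⟨(fval x h) / (|D h.1 - D h.2.1| + 1), by
        apply div_pos <;> [linarith; positivity], fun t ht => ?_⟩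
      rw [sign_pos h0, sign_eq_one_iff, hf]
      have h1 : 0 < |D h.1 - D h.2.1| + 1 := by positivity
      rw [lt_div_iff₀ h1] at ht
      have : -(t * (D h.1 - D h.2.1)) ≤ |t| * |D h.1 - D h.2.1| := by
        rw [← abs_mul]; exact neg_le_abs _
      nlinarith [abs_nonneg t]
  choose! e he1 he2 using key
  obtain ⟨ε, hε, hle⟩ : ∃ ε > 0, ∀ h ∈ H, ε ≤ e h := by
    rcases H.eq_empty_or_nonempty with rfl | hne
    · exact ⟨1, one_pos, by simp⟩
    · refine ⟨H.inf' hne e, ?_, fun h hh => Finset.inf'_le _ hh⟩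
      rw [gt_iff_lt, Finset.lt_inf'_iff]
      exact he1
  refine ⟨ε, hε, fun t ht => ?_⟩
  rw [pat_eq_iff]
  intro h hh
  exact he2 h hh t (lt_of_lt_of_le ht (hle h hh))

lemma pat_convex {n : ℕ} {H : Finset (Trip n)} {x y : Fin n → ℝ} (hxy : pat H y = pat H x)
    {a b : ℝ} (ha : 0 < a) (hb : 0 < b) (hab : a + b = 1) :
    pat H (fun i => a * x i + b * y i) = pat H x := by
  rw [pat_eq_iff] at *
  intro h hh
  have hs := hxy h hh
  have hf : fval (fun i => a * x i + b * y i) h = a * fval x h + b * fval y h := by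
    simp only [fval]
    have : (h.2.2 : ℝ) = (a + b) * h.2.2 := by rw [hab, one_mul]
    linear_combination (-1 : ℝ) * this
  rw [hf]
  rcases lt_trichotomy (fval x h) 0 with h0 | h0 | h0
  · rw [sign_neg h0] at hs ⊢
    rw [sign_eq_neg_one_iff] at hs ⊢
    nlinarith
  · rw [h0, sign_zero] at hs ⊢
    rw [sign_eq_zero_iff] at hs
    simp [hs]
  · rw [sign_pos h0] at hs ⊢
    rw [sign_eq_one_iff] at hs ⊢
    nlinarith [mul_pos ha h0, mul_pos hb hs]

lemma pat_insert {n : ℕ} (H : Finset (Trip n)) (h : Trip n) (x : Fin n → ℝ) :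
    pat (insert h H) x = Function.update (pat H x) h (SignType.sign (fval x h)) := by
  funext a
  by_cases ha : a = h
  · subst ha; simp [pat]
  · simp [pat, ha]

lemma comp_update_ne {n : ℕ} {τ : Trip n → SignType} {h : Trip n} (h1 : τ h = 1) {ε : SignType}
    (hε : ε ≠ 0) : comp (Function.update τ h ε) = comp τ := by
  unfold comp
  congr 2
  funext a b
  apply propext
  unfold zrel
  refine exists_congr fun s => ?_
  by_cases e : (a, b, s) = h
  · rw [e]; simp [h1, hε]
  · simp [Function.update_of_ne e]

lemma zrel_update_zero {n : ℕ} {τ : Trip n → SignType} {h : Trip n} (h1 : τ h = 1) :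
    zrel (Function.update τ h 0) = fun a b => zrel τ a b ∨ (a = h.1 ∧ b = h.2.1) := by
  funext a b
  apply propext
  unfold zrel
  constructor
  · rintro ⟨s, hs⟩
    by_cases e : (a, b, s) = h
    · subst e; simp
    · rw [Function.update_of_ne e] at hs; exact Or.inl ⟨s, hs⟩
  · rintro (⟨s, hs⟩ | ⟨rfl, rfl⟩)
    · refine ⟨s, ?_⟩
      by_cases e : (a, b, s) = h
      · rw [e]; simp
      · rwa [Function.update_of_ne e]
    · exact ⟨h.2.2, by simp⟩

lemma fibre_sum {n : ℕ} {R : Type*} [CommRing R] (H : Finset (Trip n)) (h : Trip n) (hh : h ∉ H)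
    (x : Fin n → ℝ) :
    ∑ σ ∈ (pats (insert h H)).filter (fun σ => res H σ = pat H x), (-1 : R) ^ comp σ
      = (-1 : R) ^ comp (pat H x) := by
  set τ := pat H x with hτ
  have h1 : τ h = 1 := by simp [hτ, pat, hh]
  set E : Finset SignType := Finset.univ.filter
    (fun ε => ∃ y, pat H y = τ ∧ SignType.sign (fval y h) = ε) with hE
  have himg : (pats (insert h H)).filter (fun σ => res H σ = τ)
      = E.image (fun ε => Function.update τ h ε) := by
    ext σ
    simp only [Finset.mem_filter, Finset.mem_image, mem_pats, hE, Finset.mem_univ, true_and]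
    constructor
    · rintro ⟨⟨y, rfl⟩, hy⟩
      rw [res_pat (Finset.subset_insert _ _)] at hy
      exact ⟨_, ⟨y, hy, rfl⟩, by rw [pat_insert, hy]⟩
    · rintro ⟨ε, ⟨y, hy, rfl⟩, rfl⟩
      refine ⟨⟨y, by rw [pat_insert, hy]⟩, ?_⟩
      rw [← hy, ← pat_insert, res_pat (Finset.subset_insert _ _)]
  rw [himg, Finset.sum_image (by
    intro a _ b _ hab
    have := congrFun hab h
    simpa using this)]
  have hxE : SignType.sign (fval x h) ∈ E := by simp only [hE, Finset.mem_filter]; exact ⟨Finset.mem_univ _, x, rfl, rfl⟩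
  by_cases hc : Relation.EqvGen (zrel τ) h.1 h.2.1
  · have hE1 : E = {SignType.sign (fval x h)} := by
      apply Finset.eq_singleton_iff_unique_mem.mpr ⟨hxE, ?_⟩
      intro ε hε
      simp only [hE, Finset.mem_filter, Finset.mem_univ, true_and] at hε
      obtain ⟨y, hy, rfl⟩ := hε
      have := eqvGen_sub_const (x := x) (y := y) (hy.symm) hc
      simp only [fval]
      rw [this]
    rw [hE1, Finset.sum_singleton]
    congr 1
    by_cases h0 : SignType.sign (fval x h) = 0
    · rw [h0]
      unfold comp
      rw [zrel_update_zero h1]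
      exact quot_card_add_same hc
    · exact comp_update_ne h1 h0
  · have hz : comp (Function.update τ h 0) + 1 = comp τ := by
      unfold comp
      rw [zrel_update_zero h1]
      exact quot_card_add_diff hc
    have hzero : (0 : SignType) ∈ E → E = Finset.univ := by
      intro h0
      simp only [hE, Finset.mem_filter, Finset.mem_univ, true_and] at h0
      obtain ⟨y, hy, h0⟩ := h0
      rw [sign_eq_zero_iff] at h0
      obtain ⟨ε, hε, hmv⟩ := exists_move H y
        (fun a => if Relation.EqvGen (zrel τ) h.1 a then 1 else 0) (by
          intro a b hab
          rw [hy] at hab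
          have : Relation.EqvGen (zrel τ) h.1 a ↔ Relation.EqvGen (zrel τ) h.1 b :=
            ⟨fun hh => hh.trans _ _ _ (.rel _ _ hab), fun hh => hh.trans _ _ _ ((Relation.EqvGen.rel _ _ hab).symm)⟩
          simp [this])
      have hf : ∀ t : ℝ, fval (fun a => y a + t * (if Relation.EqvGen (zrel τ) h.1 a then 1 else 0)) h = t := by
        intro t
        have : Relation.EqvGen (zrel τ) h.1 h.1 := .refl _
        simp only [fval] at h0 ⊢
        simp only [this, hc, if_true, if_false]
        linarith
      ext δ
      simp only [hE, Finset.mem_filter, Finset.mem_univ, true_and, iff_true]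
      rcases δ with _ | _ | _
      · exact ⟨y, hy, by rw [h0]; simp⟩
      · refine ⟨_, (hmv (-(ε/2)) (by rw [abs_neg, abs_of_pos] <;> linarith)).trans hy, ?_⟩
        rw [hf, sign_neg (by linarith)]; rfl
      · refine ⟨_, (hmv ((ε/2)) (by rw [abs_of_pos] <;> linarith)).trans hy, ?_⟩
        rw [hf, sign_pos (by linarith)]; rfl
    by_cases h0 : (0 : SignType) ∈ E
    · rw [hzero h0]
      have hu : (Finset.univ : Finset SignType) = {0, -1, 1} := rfl
      rw [hu, Finset.sum_insert (by decide), Finset.sum_insert (by decide), Finset.sum_singleton,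
        comp_update_ne h1 (ε := -1) (by decide), comp_update_ne h1 (ε := 1) (by decide), ← hz, pow_succ]
      ring
    · have hone : ∀ ε ∈ E, ε = SignType.sign (fval x h) := by
        intro ε hε
        by_contra hne
        apply h0
        have hε' := hε
        simp only [hE, Finset.mem_filter, Finset.mem_univ, true_and] at hε'
        obtain ⟨y, hy, rfl⟩ := hε'
        have hy0 : fval y h ≠ 0 := by
          intro e; apply h0; rw [e, sign_zero] at hε; exact hε
        have hx0 : fval x h ≠ 0 := by
          intro e; apply h0; rw [e, sign_zero] at hxE; exact hxE
        have hmul : fval x h * fval y h < 0 := by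
          rcases lt_or_gt_of_ne hy0 with h2 | h2 <;> rcases lt_or_gt_of_ne hx0 with h3 | h3
          · simp [sign_neg h2, sign_neg h3] at hne
          · nlinarith
          · nlinarith
          · simp [sign_pos h2, sign_pos h3] at hne
        simp only [hE, Finset.mem_filter, Finset.mem_univ, true_and]
        have hd : 0 < |fval x h| + |fval y h| := by positivity
        refine ⟨_, pat_convex (a := |fval y h| / (|fval x h| + |fval y h|))
          (b := |fval x h| / (|fval x h| + |fval y h|)) hy (by positivity) (by positivity)
          (by field_simp; ring), ?_⟩
        rw [sign_eq_zero_iff]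
        have hab : |fval y h| / (|fval x h| + |fval y h|) + |fval x h| / (|fval x h| + |fval y h|) = 1 := by
          field_simp; ring
        have hf : ∀ a b : ℝ, a + b = 1 → fval (fun i => a * x i + b * y i) h = a * fval x h + b * fval y h := by
          intro a b hab
          simp only [fval]
          have : (h.2.2 : ℝ) = (a + b) * h.2.2 := by rw [hab, one_mul]
          linear_combination (-1 : ℝ) * this
        rw [hf _ _ hab]
        have : |fval y h| * fval x h + |fval x h| * fval y h = 0 := by
          rcases lt_or_gt_of_ne hy0 with h2 | h2 <;> rcases lt_or_gt_of_ne hx0 with h3 | h3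
          · nlinarith
          · rw [abs_of_neg h2, abs_of_pos h3]; ring
          · rw [abs_of_pos h2, abs_of_neg h3]; ring
          · nlinarith
        field_simp
        linarith
      have hE1 : E = {SignType.sign (fval x h)} :=
        Finset.eq_singleton_iff_unique_mem.mpr ⟨hxE, hone⟩
      rw [hE1, Finset.sum_singleton, comp_update_ne h1]
      intro e; rw [e] at hxE; exact h0 hxE

lemma euler_step {n : ℕ} {R : Type*} [CommRing R] (H : Finset (Trip n)) (h : Trip n) (hh : h ∉ H)
    (g : (Trip n → SignType) → R) :
    ∑ σ ∈ pats (insert h H), (-1 : R) ^ comp σ * g (res H σ)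
      = ∑ τ ∈ pats H, (-1 : R) ^ comp τ * g τ := by
  rw [← Finset.sum_fiberwise_of_maps_to (s := pats (insert h H)) (t := pats H) (g := res H)]
  · refine Finset.sum_congr rfl fun τ hτ => ?_
    obtain ⟨x, rfl⟩ := mem_pats.mp hτ
    rw [← fibre_sum (R := R) H h hh x, Finset.sum_mul]
    refine Finset.sum_congr rfl fun σ hσ => ?_
    rw [(Finset.mem_filter.mp hσ).2]
  · intro σ hσ
    obtain ⟨x, rfl⟩ := mem_pats.mp hσ
    rw [res_pat (Finset.subset_insert _ _)]
    exact mem_pats.mpr ⟨x, rfl⟩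

lemma euler_sum {n : ℕ} {R : Type*} [CommRing R] (H0 K : Finset (Trip n))
    (g : (Trip n → SignType) → R) :
    ∑ σ ∈ pats (H0 ∪ K), (-1 : R) ^ comp σ * g (res H0 σ)
      = ∑ τ ∈ pats H0, (-1 : R) ^ comp τ * g τ := by
  induction K using Finset.induction_on with
  | empty =>
    rw [Finset.union_empty]
    refine Finset.sum_congr rfl fun τ hτ => ?_
    obtain ⟨x, rfl⟩ := mem_pats.mp hτ
    rw [res_pat (Finset.Subset.refl _)]
  | insert h K hK ih =>
    rw [Finset.union_insert]
    by_cases hm : h ∈ H0 ∪ K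
    · rw [Finset.insert_eq_of_mem hm, ih]
    · rw [← ih, ← euler_step (H0 ∪ K) h hm]
      refine Finset.sum_congr rfl fun σ _ => ?_
      rw [res_res Finset.subset_union_left]



/-! ### Faces and sign patterns -/

lemma hyp_eq_hyp {n : ℕ} {i j i' j' : Fin n} {s s' : ℝ} (hij : i ≠ j)
    (h : hyp n i j s = hyp n i' j' s') :
    (i' = i ∧ j' = j ∧ s' = s) ∨ (i' = j ∧ j' = i ∧ s' = -s) := by
  have hx : ∀ x : Fin n → ℝ, x i - x j = s ↔ x i' - x j' = s' := by
    intro x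
    have := Set.ext_iff.mp h x
    simpa [hyp] using this
  have p0 := (hx (Pi.single i s)).mp (by simp [hij.symm])
  have hne : i' ≠ j' := by
    rintro rfl
    have h1 := (hx (Pi.single i (s + 1))).mpr (by rw [← p0]; simp)
    simp [hij.symm] at h1
  have hk : ∀ k, k ≠ i → k ≠ j → i' ≠ k ∧ j' ≠ k := by
    intro k hki hkj
    have p1 := (hx (Pi.single i s + Pi.single k 1)).mp (by simp [hij.symm, hki.symm, hkj.symm])
    rw [← p0] at p1
    constructor
    · rintro rfl
      simp [hki, hne.symm] at p1
    · rintro rfl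
      simp [hki, hne] at p1
  have hi' : i' = i ∨ i' = j := by
    by_contra hc; push Not at hc
    exact (hk i' hc.1 hc.2).1 rfl
  have hj' : j' = i ∨ j' = j := by
    by_contra hc; push Not at hc
    exact (hk j' hc.1 hc.2).2 rfl
  rcases hi' with rfl | rfl
  · rcases hj' with rfl | rfl
    · exact absurd rfl hne
    · left; simp [hij.symm] at p0; exact ⟨rfl, rfl, p0.symm⟩
  · rcases hj' with rfl | rfl
    · right; simp [hij.symm] at p0; exact ⟨rfl, rfl, p0.symm⟩
    · exact absurd rfl hne

lemma hyp_flip {n : ℕ} (i j : Fin n) (s : ℝ) : hyp n i j s = hyp n j i (-s) := by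
  ext x; simp only [hyp, Set.mem_ofPred_eq]; constructor <;> intro h <;> linarith

lemma mem_arrS {S : Set ℤ} (hsym : ∀ s : ℤ, s ∈ S ↔ -s ∈ S) {n : ℕ} (a b : Fin n) (s : ℤ) :
    hyp n a b (s : ℝ) ∈ arrS S n ↔ a ≠ b ∧ s ∈ S := by
  constructor
  · rintro ⟨i, j, t, hij, ht, e⟩
    rcases hyp_eq_hyp hij.ne e.symm with ⟨rfl, rfl, e'⟩ | ⟨rfl, rfl, e'⟩
    · have : s = t := by exact_mod_cast e'
      subst this
      exact ⟨hij.ne, ht⟩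
    · have : s = -t := by exact_mod_cast e'
      subst this
      exact ⟨hij.ne', (hsym t).mp ht⟩
  · rintro ⟨hab, hs⟩
    rcases lt_or_gt_of_ne hab with h | h
    · exact ⟨a, b, s, h, hs, rfl⟩
    · exact ⟨b, a, -s, h, (hsym s).mp hs, by rw [hyp_flip]; push_cast; rfl⟩

noncomputable def HS (S : Finset ℤ) (n : ℕ) : Finset (Trip n) :=
  Finset.univ ×ˢ Finset.univ ×ˢ S

def cell {n : ℕ} (H : Finset (Trip n)) (x : Fin n → ℝ) : Set (Fin n → ℝ) := {y | pat H y = pat H x}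

lemma pat_HS_eq_iff {S : Finset ℤ} (hsym : ∀ s : ℤ, s ∈ S ↔ -s ∈ S) {n : ℕ} (x y : Fin n → ℝ) :
    pat (HS S n) x = pat (HS S n) y ↔ ∀ i j : Fin n, ∀ s ∈ S, i < j →
      SignType.sign (x i - x j - (s : ℝ)) = SignType.sign (y i - y j - (s : ℝ)) := by
  rw [pat_eq_iff]
  constructor
  · intro h i j s hs _
    exact h (i, j, s) (by simp [HS, hs])
  · rintro h ⟨i, j, s⟩ hh
    simp only [HS, Finset.mem_product, Finset.mem_univ, true_and] at hh
    simp only [fval]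
    rcases lt_trichotomy i j with hij | rfl | hij
    · exact h i j s hh hij
    · simp
    · have := h j i (-s) ((hsym s).mp hh) hij
      have e : ∀ z : Fin n → ℝ, z i - z j - (s : ℝ) = -(z j - z i - ((-s : ℤ) : ℝ)) := by
        intro z; push_cast; ring
      rw [e x, e y, Left.sign_neg, Left.sign_neg, this]

lemma isFace_iff {S : Set ℤ} {Sf : Finset ℤ} (hSf : ∀ s, s ∈ Sf ↔ s ∈ S)
    (hsym : ∀ s : ℤ, s ∈ S ↔ -s ∈ S) {n : ℕ} (F : Set (Fin n → ℝ)) :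
    IsFace n (arrS S n) F ↔ ∃ x, F = cell (HS Sf n) x := by
  have hsym' : ∀ s : ℤ, s ∈ Sf ↔ -s ∈ Sf := by intro s; rw [hSf, hSf]; exact hsym s
  constructor
  · rintro ⟨⟨x, hx⟩, σ, hσ, rfl⟩
    refine ⟨x, ?_⟩
    have key : ∀ i j : Fin n, ∀ s ∈ Sf, i < j → ∀ y, (y ∈ σ (hyp n i j (s : ℝ)) ↔
        SignType.sign (y i - y j - (s : ℝ)) = SignType.sign (x i - x j - (s : ℝ))) := by
      intro i j s hs hij y
      have hA : hyp n i j (s : ℝ) ∈ arrS S n := ⟨i, j, s, hij, (hSf s).mp hs, rfl⟩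
      have hxs : x ∈ σ (hyp n i j (s : ℝ)) := by
        simp only [Set.mem_iInter] at hx; exact hx _ hA
      have hlt : ∀ (a b : ℝ), a < 0 → (b < 0 ↔ SignType.sign b = SignType.sign a) := by
        intro a b ha; rw [sign_neg ha, sign_eq_neg_one_iff]
      have hgt : ∀ (a b : ℝ), 0 < a → (0 < b ↔ SignType.sign b = SignType.sign a) := by
        intro a b ha; rw [sign_pos ha, sign_eq_one_iff]
      rcases hσ _ hA with e | ⟨i', j', s', e, e2⟩
      · rw [e] at hxs ⊢
        simp only [hyp, Set.mem_ofPred_eq] at hxs ⊢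
        rw [hxs, sub_self, sign_zero, sign_eq_zero_iff, sub_eq_zero]
      · rcases hyp_eq_hyp hij.ne e with ⟨rfl, rfl, rfl⟩ | ⟨rfl, rfl, rfl⟩
        · rcases e2 with e2 | e2 <;> rw [e2] at hxs ⊢ <;> simp only [Set.mem_ofPred_eq] at hxs ⊢
          · rw [← hlt _ _ (by linarith)]; constructor <;> intro <;> linarith
          · rw [← hgt _ _ (by linarith)]; constructor <;> intro <;> linarith
        · rcases e2 with e2 | e2 <;> rw [e2] at hxs ⊢ <;> simp only [Set.mem_ofPred_eq] at hxs ⊢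
          · rw [← hgt _ _ (by linarith)]; constructor <;> intro <;> linarith
          · rw [← hlt _ _ (by linarith)]; constructor <;> intro <;> linarith
    ext y
    simp only [cell, Set.mem_ofPred_eq, pat_HS_eq_iff hsym', Set.mem_iInter]
    constructor
    · intro h i j s hs hij
      exact (key i j s hs hij y).mp (h _ ⟨i, j, s, hij, (hSf s).mp hs, rfl⟩)
    · rintro h _ ⟨i, j, s, hij, hs, rfl⟩
      exact (key i j s ((hSf s).mpr hs) hij y).mpr (h i j s ((hSf s).mpr hs) hij)
  · rintro ⟨x, rfl⟩
    refine ⟨⟨x, rfl⟩, fun H => {y | ∀ i j : Fin n, ∀ s ∈ Sf, i < j → H = hyp n i j (s : ℝ) →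
      SignType.sign (y i - y j - (s : ℝ)) = SignType.sign (x i - x j - (s : ℝ))}, ?_, ?_⟩
    · rintro _ ⟨i, j, s, hij, hs, rfl⟩
      have : {y : Fin n → ℝ | ∀ i' j' : Fin n, ∀ s' ∈ Sf, i' < j' → hyp n i j (s : ℝ) = hyp n i' j' (s' : ℝ) →
        SignType.sign (y i' - y j' - (s' : ℝ)) = SignType.sign (x i' - x j' - (s' : ℝ))} =
        {y | SignType.sign (y i - y j - (s : ℝ)) = SignType.sign (x i - x j - (s : ℝ))} := by
        ext y
        simp only [Set.mem_ofPred_eq]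
        constructor
        · intro h; exact h i j s ((hSf s).mpr hs) hij rfl
        · intro h i' j' s' _ hij' e
          rcases hyp_eq_hyp hij.ne e with ⟨rfl, rfl, e'⟩ | ⟨rfl, rfl, e'⟩
          · rw [e']; exact h
          · exact absurd hij hij'.not_gt
      simp only [this]
      rcases lt_trichotomy (x i - x j - (s : ℝ)) 0 with h0 | h0 | h0
      · right; refine ⟨i, j, s, rfl, Or.inl ?_⟩
        ext y; simp [sign_neg h0, sign_eq_neg_one_iff]
      · left
        ext y; simp [h0, hyp, sub_eq_zero, sign_eq_zero_iff]
      · right; refine ⟨i, j, s, rfl, Or.inr ?_⟩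
        ext y; simp [sign_pos h0, sign_eq_one_iff]
    · ext y
      simp only [cell, Set.mem_ofPred_eq, pat_HS_eq_iff hsym', Set.mem_iInter]
      constructor
      · rintro h _ _ i j s hs hij _
        exact h i j s hs hij
      · intro h i j s hs hij
        exact h _ ⟨i, j, s, hij, (hSf s).mp hs, rfl⟩ i j s hs hij rfl

def constSub {n : ℕ} (r : Fin n → Fin n → Prop) : Submodule ℝ (Fin n → ℝ) where
  carrier := {v | ∀ a b, r a b → v a = v b}
  add_mem' := by
    intro v w hv hw a b h
    simp [hv a b h, hw a b h]
  zero_mem' := by intro a b _; rfl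
  smul_mem' := by
    intro c v hv a b h
    simp [hv a b h]

noncomputable def constEquiv {n : ℕ} (r : Fin n → Fin n → Prop) : constSub r ≃ₗ[ℝ] (Quot r → ℝ) where
  toFun v := Quot.lift v.1 v.2
  invFun f := ⟨fun a => f (Quot.mk r a), fun a b h => congrArg f (Quot.sound h)⟩
  left_inv v := rfl
  right_inv f := by funext q; induction q using Quot.ind; rfl
  map_add' v w := by funext q; induction q using Quot.ind; rfl
  map_smul' v w := by funext q; induction q using Quot.ind; rfl

lemma faceDim_cell {n : ℕ} (H : Finset (Trip n)) (x : Fin n → ℝ) :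
    faceDim n (cell H x) = comp (pat H x) := by
  have h1 : (affineSpan ℝ (cell H x)).direction = constSub (zrel (pat H x)) := by
    rw [direction_affineSpan]
    apply le_antisymm
    · rw [vectorSpan_def, Submodule.span_le]
      rintro _ ⟨y, hy, z, hz, rfl⟩
      intro a b hab
      have e1 := eqvGen_sub_const (x := x) (y := y) (Eq.symm hy) (.rel _ _ hab)
      have e2 := eqvGen_sub_const (x := x) (y := z) (Eq.symm hz) (.rel _ _ hab)
      simp only [vsub_eq_sub, Pi.sub_apply]
      linarith
    · intro v hv
      obtain ⟨ε, hε, hm⟩ := exists_move H x v hv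
      have h2 := hm (ε / 2) (by rw [abs_of_pos] <;> linarith)
      have h3 : (fun a => x a + ε / 2 * v a) -ᵥ x ∈ vectorSpan ℝ (cell H x) :=
        vsub_mem_vectorSpan ℝ h2 (by rfl)
      have h4 : v = (ε / 2)⁻¹ • ((fun a => x a + ε / 2 * v a) -ᵥ x) := by
        funext a
        simp
        field_simp
      rw [h4]
      exact Submodule.smul_mem _ _ h3
  unfold faceDim comp
  rw [h1, LinearEquiv.finrank_eq (constEquiv _)]
  have := Fintype.ofFinite (Quot (zrel (pat H x)))
  rw [Module.finrank_fintype_fun_eq_card, Nat.card_eq_fintype_card]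

lemma comp_le {n : ℕ} (σ : Trip n → SignType) : comp σ ≤ n := by
  unfold comp
  calc _ ≤ Nat.card (Fin n) := Nat.card_le_card_of_surjective (Quot.mk _) Quot.mk_surjective
    _ = n := by simp

lemma faceCount_eq {S : Set ℤ} {Sf : Finset ℤ} (hSf : ∀ s, s ∈ Sf ↔ s ∈ S)
    (hsym : ∀ s : ℤ, s ∈ S ↔ -s ∈ S) (n k : ℕ) :
    faceCount S n k = ((pats (HS Sf n)).filter (fun σ => comp σ = k)).card := by
  unfold faceCount
  rw [← Fintype.card_coe, ← Nat.card_eq_fintype_card]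
  symm
  apply Nat.card_congr
  refine Equiv.ofBijective (fun σ => ⟨{y | pat (HS Sf n) y = σ.1}, ?_⟩) ⟨?_, ?_⟩
  · obtain ⟨h1, h2⟩ := Finset.mem_filter.mp σ.2
    obtain ⟨x, hx⟩ := mem_pats.mp h1
    rw [← hx] at h2 ⊢
    exact ⟨(isFace_iff hSf hsym _).mpr ⟨x, rfl⟩, (faceDim_cell _ x).trans h2⟩
  · rintro ⟨σ, hσ⟩ ⟨τ, hτ⟩ h
    obtain ⟨x, hx⟩ := mem_pats.mp (Finset.mem_filter.mp hσ).1
    simp only [Subtype.mk.injEq] at h ⊢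
    have : x ∈ {y | pat (HS Sf n) y = σ} := hx
    rw [h] at this
    exact hx.symm.trans this
  · rintro ⟨F, hF, hd⟩
    obtain ⟨x, rfl⟩ := (isFace_iff hSf hsym _).mp hF
    rw [faceDim_cell] at hd
    exact ⟨⟨pat (HS Sf n) x, Finset.mem_filter.mpr ⟨mem_pats.mpr ⟨x, rfl⟩, hd⟩⟩, rfl⟩

lemma face_sum_eq {S : Set ℤ} {Sf : Finset ℤ} (hSf : ∀ s, s ∈ Sf ↔ s ∈ S)
    (hsym : ∀ s : ℤ, s ∈ S ↔ -s ∈ S) (n : ℕ) :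
    ∑ k ∈ Finset.range (n + 1), (faceCount S n k : ℚ) • (Polynomial.X : Polynomial ℚ) ^ k
      = ∑ σ ∈ pats (HS Sf n), (Polynomial.X : Polynomial ℚ) ^ comp σ := by
  rw [← Finset.sum_fiberwise_of_maps_to (s := pats (HS Sf n)) (t := Finset.range (n + 1))
    (g := comp) (fun σ _ => Finset.mem_range.mpr (Nat.lt_succ_of_le (comp_le σ)))]
  refine Finset.sum_congr rfl fun k _ => ?_
  rw [faceCount_eq hSf hsym, Finset.sum_congr rfl (g := fun _ => (Polynomial.X : Polynomial ℚ) ^ k)]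
  · rw [Finset.sum_const, Nat.cast_smul_eq_nsmul]
  · intro σ hσ
    rw [(Finset.mem_filter.mp hσ).2]

/-- Number of faces through the Catalan arrangement. -/
lemma face_sum_cat {S : Set ℤ} {Sf : Finset ℤ} (hSf : ∀ s, s ∈ Sf ↔ s ∈ S)
    (hsym : ∀ s : ℤ, s ∈ S ↔ -s ∈ S) (m : ℕ) (hmax : ∀ s ∈ S, s ≤ (m : ℤ)) (n : ℕ) :
    ∑ k ∈ Finset.range (n + 1), (faceCount S n k : ℚ) • (Polynomial.X : Polynomial ℚ) ^ k
      = ∑ σ ∈ pats (HS (Finset.Icc (-(m : ℤ)) m) n),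
        (-1 : Polynomial ℚ) ^ comp σ * (-Polynomial.X) ^ comp (res (HS Sf n) σ) := by
  rw [face_sum_eq hSf hsym]
  have hu : HS Sf n ∪ HS (Finset.Icc (-(m : ℤ)) m) n = HS (Finset.Icc (-(m : ℤ)) m) n := by
    apply Finset.union_eq_right.mpr
    intro h hh
    simp only [HS, Finset.mem_product, Finset.mem_univ, true_and, Finset.mem_Icc, hSf] at hh ⊢
    have h1 := hmax _ hh
    have h2 := hmax _ ((hsym _).mp hh)
    omega
  rw [← hu, euler_sum (R := Polynomial ℚ) (HS Sf n) _ (fun τ => (-Polynomial.X) ^ comp τ)]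
  refine Finset.sum_congr rfl fun σ _ => ?_
  rw [← mul_pow]
  simp



/-! ### Chains in marked trees -/

section chains
variable {m n : ℕ} {T : Tree m n}

lemma child_unique {i j j' : Fin n} {s s' : ℕ} (h : T.IsChild i j s) (h' : T.IsChild i j' s') :
    j = j' ∧ s = s' := by
  unfold Tree.IsChild at h h'
  rw [h] at h'
  have := List.append_inj' h' rfl
  exact ⟨T.inj this.1, by simpa using this.2⟩

lemma child_inj {i i' j : Fin n} {s : ℕ} (h : T.IsChild i j s) (h' : T.IsChild i' j s) : i = i' :=
  T.inj (h.trans h'.symm)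

lemma child_le {i j : Fin n} {s : ℕ} (h : T.IsChild i j s) : s ≤ m :=
  T.entry_le i s (by unfold Tree.IsChild at h; rw [h]; simp)

lemma cadet_unique {i i' j : Fin n} {s s' : ℕ} (h : T.IsCadet i j s) (h' : T.IsCadet i' j s') :
    i = i' ∧ s = s' := by
  rcases lt_trichotomy s s' with hs | rfl | hs
  · exact absurd ⟨i', h'.1⟩ (h.2 s' hs (child_le h'.1))
  · exact ⟨child_inj h.1 h'.1, rfl⟩
  · exact absurd ⟨i, h.1⟩ (h'.2 s hs (child_le h.1))

lemma exists_parent {i : Fin n} (h : T.path i ≠ []) : ∃ j s, T.IsChild i j s := by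
  obtain ⟨w, hw⟩ := T.parent_closed i h
  refine ⟨w, (T.path i).getLast h, ?_⟩
  unfold Tree.IsChild
  rw [hw]
  exact (List.dropLast_append_getLast h).symm

lemma child_drift {i j : Fin n} {s : ℕ} (h : T.IsChild i j s) : T.drift i = T.drift j + s := by
  unfold Tree.IsChild at h
  simp [Tree.drift, h]

lemma child_len {i j : Fin n} {s : ℕ} (h : T.IsChild i j s) :
    (T.path i).length = (T.path j).length + 1 := by
  unfold Tree.IsChild at h
  simp [h]

def Edge (T : Tree m n) (μ : Set (Fin n)) (a b : Fin n) : Prop := b ∈ μ ∧ ∃ s, T.IsChild b a s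

def Ch (T : Tree m n) (μ : Set (Fin n)) : Fin n → Fin n → Prop := Relation.ReflTransGen (Edge T μ)

def IsMkb (T : Tree m n) (i : Fin n) : Prop :=
  ∃ j s, T.IsCadet i j s ∧ (s = 0 → (j : ℕ) < (i : ℕ))

variable {μ ν : Set (Fin n)}

lemma Ch.pathPre {a b : Fin n} (h : Ch T μ a b) : T.path a <+: T.path b := by
  induction h with
  | refl => exact List.prefix_refl _
  | tail _ h ih =>
    obtain ⟨_, s, hs⟩ := h
    unfold Tree.IsChild at hs
    rw [hs]
    exact ih.trans (List.prefix_append _ _)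

lemma Ch.drift_le {a b : Fin n} (h : Ch T μ a b) : T.drift a ≤ T.drift b := by
  induction h with
  | refl => exact le_refl _
  | tail _ h ih =>
    obtain ⟨_, s, hs⟩ := h
    rw [child_drift hs]
    omega

lemma Ch.len_le {a b : Fin n} (h : Ch T μ a b) : (T.path a).length ≤ (T.path b).length :=
  h.pathPre.length_le

lemma Ch.mono (hle : ν ⊆ μ) {a b : Fin n} (h : Ch T ν a b) : Ch T μ a b :=
  Relation.ReflTransGen.mono (fun _ _ h => ⟨hle h.1, h.2⟩) _ _ h

lemma Ch.antisymm {a b : Fin n} (h : Ch T μ a b) (h' : Ch T μ b a) : a = b :=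
  T.inj (h.pathPre.eq_of_length (le_antisymm h.len_le h'.len_le))

lemma edge_parent {a a' b : Fin n} (h : Edge T μ a b) (h' : Edge T ν a' b) : a = a' := by
  obtain ⟨_, s, hs⟩ := h
  obtain ⟨_, s', hs'⟩ := h'
  exact (child_unique hs hs').1

lemma mkb_edge (hμ : IsMarking T μ) {a b : Fin n} (h : Edge T μ a b) : ∃ s, T.IsCadet b a s := by
  obtain ⟨hb, s, hs⟩ := h
  obtain ⟨j, s', hc, _⟩ := hμ b hb
  obtain ⟨rfl, rfl⟩ := child_unique hs hc.1
  exact ⟨s, hc⟩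

lemma edge_child (hμ : IsMarking T μ) {a b b' : Fin n} (h : Edge T μ a b) (h' : Edge T μ a b') :
    b = b' := by
  obtain ⟨s, hs⟩ := mkb_edge hμ h
  obtain ⟨s', hs'⟩ := mkb_edge hμ h'
  exact (cadet_unique hs hs').1

lemma simMu_iff (hμ : IsMarking T μ) {a b : Fin n} :
    simMu T μ a b ↔ Ch T μ a b ∨ Ch T μ b a := by
  constructor
  · intro h
    induction h with
    | refl => exact Or.inl .refl
    | @tail b c _ hbc ih =>
      rcases hbc with hbc | hbc
      · have e : Edge T μ c b := hbc
        rcases ih with ih | ih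
        · rcases Relation.ReflTransGen.cases_tail ih with rfl | ⟨d, hd, hdb⟩
          · exact Or.inr (.single e)
          · rw [edge_parent e hdb]; exact Or.inl hd
        · exact Or.inr (.head e ih)
      · have e : Edge T μ b c := hbc
        rcases ih with ih | ih
        · exact Or.inl (.tail ih e)
        · rcases Relation.ReflTransGen.cases_head ih with rfl | ⟨d, hd, hdb⟩
          · exact Or.inl (.single e)
          · rw [edge_child hμ e hd]; exact Or.inr hdb
  · rintro (h | h)
    · exact Relation.ReflTransGen.mono (fun _ _ h => Or.inr h) _ _ h
    · have := Relation.ReflTransGen.mono (r := Edge T μ) (p := fun a b =>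
        (b ∈ μ ∧ ∃ s, T.IsChild b a s) ∨ (a ∈ μ ∧ ∃ s, T.IsChild a b s)) (fun _ _ h => Or.inl h) _ _ h
      exact Relation.reflTransGen_swap.mp this

lemma simMu_symm (hμ : IsMarking T μ) {a b : Fin n} (h : simMu T μ a b) : simMu T μ b a := by
  rw [simMu_iff hμ] at *; exact h.symm

lemma exists_top (T : Tree m n) (μ : Set (Fin n)) (hμ : IsMarking T μ) (i : Fin n) :
    ∃ a, a ∉ μ ∧ Ch T μ a i := by
  induction h : (T.path i).length using Nat.strong_induction_on generalizing i with
  | _ k ih =>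
    by_cases hi : i ∈ μ
    · obtain ⟨j, s, hc, _⟩ := hμ i hi
      obtain ⟨a, ha, hch⟩ := ih _ (by rw [← h, child_len hc.1]; exact Nat.lt_succ_self _) j rfl
      exact ⟨a, ha, hch.tail ⟨hi, s, hc.1⟩⟩
    · exact ⟨i, hi, .refl⟩

lemma ch_top {a b : Fin n} (hb : b ∉ μ) (h : Ch T μ a b) : a = b := by
  rcases Relation.ReflTransGen.cases_tail h with h | ⟨d, hd, hdb⟩
  · exact h.symm
  · exact absurd hdb.1 hb

lemma blocks_ncard (hμ : IsMarking T μ) : (blocksOf T μ).ncard = n - μ.ncard := by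
  have h1 : blocksOf T μ = blockOf T μ '' μᶜ := by
    ext B
    constructor
    · rintro ⟨i, rfl⟩
      obtain ⟨a, ha, hch⟩ := exists_top T μ hμ i
      refine ⟨a, ha, ?_⟩
      have h2 : simMu T μ a i := (simMu_iff hμ).mpr (Or.inl hch)
      ext c
      exact ⟨fun h => Relation.ReflTransGen.trans (simMu_symm hμ h2) h,
        fun h => Relation.ReflTransGen.trans h2 h⟩
    · rintro ⟨i, _, rfl⟩
      exact ⟨i, rfl⟩
  rw [h1, Set.InjOn.ncard_image, Set.ncard_compl]
  · simp
  · intro a ha b hb hab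
    have h3 : b ∈ blockOf T μ a := by rw [hab]; exact Relation.ReflTransGen.refl
    rcases (simMu_iff hμ).mp h3 with h | h
    · exact ch_top hb h
    · exact (ch_top ha h).symm

lemma eqvGen_edge_sim {a b : Fin n} (h : Relation.EqvGen (Edge T μ) a b) (hμ : IsMarking T μ) :
    simMu T μ a b := by
  induction h with
  | rel a b h => exact .single (Or.inr h)
  | refl a => exact .refl
  | symm a b _ ih => exact simMu_symm hμ ih
  | trans a b c _ _ ih1 ih2 => exact Relation.ReflTransGen.trans ih1 ih2

lemma ch_eqvGen {r : Fin n → Fin n → Prop} {a b : Fin n} (h : Relation.ReflTransGen r a b) :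
    Relation.EqvGen r a b := by
  induction h with
  | refl => exact .refl _
  | tail _ h ih => exact .trans _ _ _ ih (.rel _ _ h)

lemma edge_quot_card (hμ : IsMarking T μ) : Nat.card (Quot (Edge T μ)) = n - μ.ncard := by
  have e : Nat.card (Quot (Edge T μ)) = Nat.card (μᶜ : Set (Fin n)) := by
    symm
    apply Nat.card_congr
    refine Equiv.ofBijective (fun a => Quot.mk _ a.1) ⟨?_, ?_⟩
    · rintro ⟨a, ha⟩ ⟨b, hb⟩ hab
      have := eqvGen_edge_sim (Quot.eqvGen_exact hab) hμ
      rcases (simMu_iff hμ).mp this with h | h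
      · exact Subtype.ext (ch_top hb h)
      · exact Subtype.ext (ch_top ha h).symm
    · rintro ⟨i⟩
      obtain ⟨a, ha, hch⟩ := exists_top T μ hμ i
      exact ⟨⟨a, ha⟩, Quot.eqvGen_sound (ch_eqvGen hch)⟩
  rw [e, Nat.card_coe_set_eq, Set.ncard_compl]
  simp

/-- the link condition across the edge `(j,i)` -/
def lnk (S : Set ℤ) (T : Tree m n) (μ : Set (Fin n)) (i j : Fin n) : Prop :=
  ∃ j' i', Ch T μ j' j ∧ Ch T μ i i' ∧ ((T.drift i' : ℤ) - T.drift j') ∈ S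

def lnkP (S : Set ℤ) (T : Tree m n) (μ : Set (Fin n)) (i : Fin n) : Prop :=
  ∃ j s, T.IsChild i j s ∧ lnk S T μ i j

variable {S : Set ℤ}

lemma between (hclosed : ∀ s t : ℕ, (s : ℤ) ∉ S → (t : ℤ) ∉ S → ((s : ℤ) + (t : ℤ)) ∉ S)
    {a b c : Fin n} (h1 : T.drift a ≤ T.drift c) (h2 : T.drift c ≤ T.drift b)
    (h : ((T.drift b : ℤ) - T.drift a) ∈ S) :
    ((T.drift c : ℤ) - T.drift a) ∈ S ∨ ((T.drift b : ℤ) - T.drift c) ∈ S := by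
  by_contra hc
  push Not at hc
  obtain ⟨s, hs⟩ := Nat.exists_eq_add_of_le h1
  obtain ⟨t, ht⟩ := Nat.exists_eq_add_of_le h2
  have e1 : (T.drift c : ℤ) - T.drift a = s := by omega
  have e2 : (T.drift b : ℤ) - T.drift c = t := by omega
  have e3 : (T.drift b : ℤ) - T.drift a = s + t := by omega
  rw [e1, e2] at hc
  rw [e3] at h
  exact hclosed s t hc.1 hc.2 h

lemma child_ne {i j : Fin n} {s : ℕ} (h : T.IsChild i j s) : i ≠ j := by
  rintro rfl
  have := child_len h
  omega

lemma otset_iff (hsym : ∀ s : ℤ, s ∈ S ↔ -s ∈ S)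
    (hclosed : ∀ s t : ℕ, (s : ℤ) ∉ S → (t : ℤ) ∉ S → ((s : ℤ) + (t : ℤ)) ∉ S)
    (hμ : IsMarking T μ) :
    (AConnected (arrS S n) T μ ∧ CadetCond (arrS S n) T μ) ↔ ∀ i, IsMkb T i → lnkP S T μ i := by
  have hyp_iff : ∀ a b : Fin n, hyp n a b ((T.drift a : ℝ) - (T.drift b : ℝ)) ∈ arrS S n ↔
      a ≠ b ∧ ((T.drift a : ℤ) - T.drift b) ∈ S := by
    intro a b
    rw [← mem_arrS hsym]
    push_cast
    rfl
  have hflip : ∀ a b : Fin n, ((T.drift a : ℤ) - T.drift b) ∈ S → ((T.drift b : ℤ) - T.drift a) ∈ S := by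
    intro a b h
    rw [hsym] at h
    convert h using 1
    ring
  constructor
  · rintro ⟨hA, hC⟩ i ⟨j, s, hc, hs⟩
    refine ⟨j, s, hc.1, ?_⟩
    by_cases hi : i ∈ μ
    · have hB := hA (blockOf T μ j) ⟨j, rfl⟩ i (.single (Or.inr ⟨hi, s, hc.1⟩)) j .refl
      have hcross : ∀ c, Relation.ReflTransGen (fun a b => a ∈ blockOf T μ j ∧ b ∈ blockOf T μ j ∧
          hyp n a b ((T.drift a : ℝ) - (T.drift b : ℝ)) ∈ arrS S n) i c →
          Ch T μ i c ∨ lnk S T μ i j := by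
        intro c hc'
        induction hc' with
        | refl => exact Or.inl .refl
        | @tail b d _ hbd ih =>
          rcases ih with ih | ih
          · obtain ⟨_, hd, hh⟩ := hbd
            rw [hyp_iff] at hh
            rcases (simMu_iff hμ).mp hd with h | h
            · rcases Relation.ReflTransGen.cases_head h with rfl | ⟨e, he, hed⟩
              · exact Or.inr ⟨_, b, .refl, ih, hh.2⟩
              · rw [edge_child hμ (b' := i) he ⟨hi, s, hc.1⟩] at hed
                exact Or.inl hed
            · exact Or.inr ⟨d, b, h, ih, hh.2⟩
          · exact Or.inr ih
      rcases hcross j hB with h | h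
      · have := h.len_le
        rw [child_len hc.1] at this
        omega
      · exact h
    · rcases hC i j s hc hi with ⟨rfl, h⟩ | ⟨i', j', h1, h2, hh⟩
      · have := hs rfl; omega
      · rw [hyp_iff] at hh
        have h1' : Ch T μ i i' := by
          rcases (simMu_iff hμ).mp h1 with h | h
          · exact h
          · rw [ch_top hi h]; exact .refl
        have h2' : Ch T μ j' j := by
          rcases (simMu_iff hμ).mp h2 with h | h
          · rcases Relation.ReflTransGen.cases_head h with rfl | ⟨e, he, hed⟩
            · exact .refl
            · obtain ⟨s', hs'⟩ := mkb_edge hμ he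
              obtain ⟨rfl, _⟩ := cadet_unique hs' hc
              exact absurd he.1 hi
          · exact h
        exact ⟨j', i', h2', h1', hh.2⟩
  · intro hl
    constructor
    · rintro B ⟨i0, rfl⟩ a ha b hb
      have hB : ∀ {c d}, c ∈ blockOf T μ i0 → simMu T μ c d → d ∈ blockOf T μ i0 :=
        fun hc hd => Relation.ReflTransGen.trans hc hd
      have hab : simMu T μ a b := Relation.ReflTransGen.trans (simMu_symm hμ ha) hb
      set R := (fun a b => a ∈ blockOf T μ i0 ∧ b ∈ blockOf T μ i0 ∧
          hyp n a b ((T.drift a : ℝ) - (T.drift b : ℝ)) ∈ arrS S n) with hR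
      have hRs : ∀ a b, R a b → R b a := by
        rintro a b ⟨h1, h2, h3⟩
        refine ⟨h2, h1, ?_⟩
        rw [hyp_iff] at h3 ⊢
        exact ⟨h3.1.symm, hflip _ _ h3.2⟩
      have hRsym : ∀ a b, Relation.ReflTransGen R a b → Relation.ReflTransGen R b a := by
        intro a b h
        have : Std.Symm R := ⟨hRs⟩
        exact symm h
      have hdir : ∀ a b, a ∈ blockOf T μ i0 → b ∈ blockOf T μ i0 →
          ((T.drift a : ℤ) - T.drift b) ∈ S → Relation.ReflTransGen R a b := by
        intro a b ha hb h
        by_cases e : a = b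
        · rw [e]
        · exact .single ⟨ha, hb, (hyp_iff a b).mpr ⟨e, h⟩⟩
      have hbet : ∀ a b c, Ch T μ a c → Ch T μ c b → ((T.drift b : ℤ) - T.drift a) ∈ S →
          a ∈ blockOf T μ i0 → Relation.ReflTransGen R a c := by
        intro a b c h1 h2 hS ha
        have hc : c ∈ blockOf T μ i0 := hB ha ((simMu_iff hμ).mpr (Or.inl h1))
        have hb : b ∈ blockOf T μ i0 := hB hc ((simMu_iff hμ).mpr (Or.inl h2))
        rcases between hclosed h1.drift_le h2.drift_le hS with h | h
        · exact hdir _ _ ha hc (hflip _ _ h)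
        · exact (hdir _ _ ha hb (hflip _ _ hS)).trans (hdir _ _ hb hc h)
      have hedge : ∀ j i, Edge T μ j i → j ∈ blockOf T μ i0 → Relation.ReflTransGen R j i := by
        intro j i he hj
        obtain ⟨j2, s2, hc2, hl2⟩ := hl i (hμ i he.1)
        have : j2 = j := (child_unique hc2 he.2.choose_spec).1
        subst this
        obtain ⟨j', i', h1, h2, hS⟩ := hl2
        have hj' : j' ∈ blockOf T μ i0 := hB hj ((simMu_iff hμ).mpr (Or.inr h1))
        exact (hRsym _ _ (hbet j' i' j2 h1 (.head he h2) hS hj')).trans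
          (hbet j' i' i (.tail h1 he) h2 hS hj')
      clear hb
      induction hab with
      | refl => exact .refl
      | @tail c d hc hcd ih =>
        have hcB := hB ha hc
        refine ih.trans ?_
        rcases hcd with hcd | hcd
        · exact hRsym _ _ (hedge _ _ hcd (hB hcB (.single (Or.inl hcd))))
        · exact hedge _ _ hcd hcB
    · intro i j s hc hi
      by_cases h0 : s = 0 ∧ (i : ℕ) < (j : ℕ)
      · exact Or.inl h0
      · right
        have hij : (i : ℕ) ≠ (j : ℕ) := fun e => child_ne hc.1 (Fin.ext e)
        obtain ⟨j2, s2, hc2, j', i', h1, h2, hS⟩ := hl i ⟨j, s, hc, fun hs => by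
          by_contra hlt
          exact h0 ⟨hs, by omega⟩⟩
        obtain ⟨rfl, rfl⟩ := child_unique hc2 hc.1
        refine ⟨i', j', (simMu_iff hμ).mpr (Or.inl h2), (simMu_iff hμ).mpr (Or.inr h1), ?_⟩
        rw [hyp_iff]
        refine ⟨?_, hS⟩
        rintro rfl
        have e1 := h1.len_le
        have e2 := h2.len_le
        have := child_len hc.1
        omega

/-- the set of marked edges inside the `S`-components -/
def nu (S : Set ℤ) (T : Tree m n) (μ : Set (Fin n)) : Set (Fin n) := {i | i ∈ μ ∧ lnkP S T μ i}

def srel (S : Set ℤ) (T : Tree m n) (μ : Set (Fin n)) (a b : Fin n) : Prop :=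
  (Ch T μ a b ∨ Ch T μ b a) ∧ ((T.drift a : ℤ) - T.drift b) ∈ S

lemma ch_nu {a b c : Fin n} (h1 : Ch T μ a c) (h2 : Ch T μ c b)
    (hS : ((T.drift b : ℤ) - T.drift a) ∈ S) : Ch T (nu S T μ) a c := by
  induction h1 with
  | refl => exact .refl
  | @tail c d hc hcd ih =>
    refine (ih (.head hcd h2)).tail ⟨⟨hcd.1, ?_⟩, hcd.2⟩
    obtain ⟨s, hs⟩ := hcd.2
    exact ⟨c, s, hs, a, b, hc, h2, hS⟩

lemma ch_nu' {a b c : Fin n} (h1 : Ch T μ a c) (h2 : Ch T μ c b)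
    (hS : ((T.drift b : ℤ) - T.drift a) ∈ S) : Ch T (nu S T μ) c b := by
  revert h1
  induction h2 using Relation.ReflTransGen.head_induction_on with
  | refl => exact fun _ => .refl
  | @head c d hcd hdb ih =>
    intro h1
    obtain ⟨s, hs⟩ := hcd.2
    exact .head ⟨⟨hcd.1, c, s, hs, a, b, h1, hdb, hS⟩, hcd.2⟩ (ih (h1.tail hcd))

lemma srel_quot_card (hsym : ∀ s : ℤ, s ∈ S ↔ -s ∈ S)
    (hclosed : ∀ s t : ℕ, (s : ℤ) ∉ S → (t : ℤ) ∉ S → ((s : ℤ) + (t : ℤ)) ∉ S)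
    (hμ : IsMarking T μ) : Nat.card (Quot (srel S T μ)) = n - (nu S T μ).ncard := by
  have hflip : ∀ a b : Fin n, ((T.drift a : ℤ) - T.drift b) ∈ S → ((T.drift b : ℤ) - T.drift a) ∈ S := by
    intro a b h
    rw [hsym] at h
    convert h using 1
    ring
  have hν : IsMarking T (nu S T μ) := fun i hi => hμ i hi.1
  rw [← edge_quot_card hν]
  apply quot_card_congr
  · rintro a b ⟨h | h, hS⟩
    · exact ch_eqvGen (ch_nu h .refl (hflip _ _ hS))
    · exact (ch_eqvGen (ch_nu h .refl hS)).symm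
  · rintro j i ⟨⟨hi, j2, s, hc, j', i', h1, h2, hS⟩, s', hc'⟩
    obtain ⟨rfl, rfl⟩ := child_unique hc hc'
    have hbet : ∀ c, Ch T μ j' c → Ch T μ c i' → Relation.EqvGen (srel S T μ) j' c := by
      intro c h3 h4
      rcases between hclosed h3.drift_le h4.drift_le hS with h | h
      · exact .rel _ _ ⟨Or.inl h3, hflip _ _ h⟩
      · exact .trans _ i' _ (.rel _ _ ⟨Or.inl (h3.trans h4), hflip _ _ hS⟩) (.rel _ _ ⟨Or.inr h4, h⟩)
    have he : Edge T μ j2 i := ⟨hi, s, hc⟩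
    exact (hbet j2 h1 (.head he h2)).symm.trans _ _ _ (hbet i (.tail h1 he) h2)

lemma lnkP_mono (hle : ν ⊆ μ) {i : Fin n} (h : lnkP S T ν i) : lnkP S T μ i := by
  obtain ⟨j, s, hc, j', i', h1, h2, hS⟩ := h
  exact ⟨j, s, hc, j', i', h1.mono hle, h2.mono hle, hS⟩

lemma nu_nu : nu S T (nu S T μ) = nu S T μ := by
  ext i
  constructor
  · exact fun h => h.1
  · intro h
    refine ⟨h, ?_⟩
    obtain ⟨hi, j, s, hc, j', i', h1, h2, hS⟩ := h
    have he : Edge T μ j i := ⟨hi, s, hc⟩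
    exact ⟨j, s, hc, j', i', ch_nu h1 (.head he h2) hS, ch_nu' (.tail h1 he) h2 hS, hS⟩

lemma ch_mem {a b : Fin n} (h : Ch T ν a b) {i : Fin n} (h1 : T.path i <+: T.path b)
    (h2 : (T.path a).length < (T.path i).length) : i ∈ ν := by
  induction h with
  | refl => have := h1.length_le; omega
  | @tail b c _ hbc ih =>
    obtain ⟨hc, s, hs⟩ := hbc
    unfold Tree.IsChild at hs
    rw [hs, List.prefix_concat_iff] at h1
    rcases h1 with h1 | h1
    · have : i = c := T.inj (by rw [hs, h1])
      exact this ▸ hc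
    · exact ih h1

lemma nu_union (hclosed : ∀ s t : ℕ, (s : ℤ) ∉ S → (t : ℤ) ∉ S → ((s : ℤ) + (t : ℤ)) ∉ S)
    (hν : nu S T ν = ν) {X : Set (Fin n)} (hX : ∀ i ∈ X, ¬ lnkP S T ν i) :
    nu S T (ν ∪ X) = ν := by
  have Q : ∀ b c, Ch T (ν ∪ X) c b → ∀ a, Ch T ν a c → ((T.drift b : ℤ) - T.drift a) ∈ S →
      Ch T ν c b := by
    intro b c h
    induction h using Relation.ReflTransGen.head_induction_on with
    | refl => exact fun _ _ _ => .refl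
    | @head c i hci hib ih =>
      intro a hac hS
      by_cases hi : i ∈ ν
      · have he : Edge T ν c i := ⟨hi, hci.2⟩
        exact .head he (ih a (hac.tail he) hS)
      · exfalso
        have hiX : i ∈ X := hci.1.resolve_left hi
        obtain ⟨s, hs⟩ := hci.2
        have h1 : T.drift a ≤ T.drift i := by
          have := hac.drift_le
          rw [child_drift hs]; omega
        rcases between hclosed h1 (Ch.drift_le hib) hS with h | h
        · exact hX i hiX ⟨c, s, hs, a, i, hac, .refl, h⟩
        · exact hX i hiX ⟨c, s, hs, a, b, hac, ih i .refl h, hS⟩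
  apply Set.Subset.antisymm
  · rintro i ⟨_, j, s, hc, j', i', h1, h2, hS⟩
    by_cases hi : i ∈ ν ∪ X
    · have h3 : Ch T (ν ∪ X) j' i' := h1.trans (.head ⟨hi, s, hc⟩ h2)
      refine ch_mem (Q i' j' h3 j' .refl hS) h2.pathPre ?_
      have := h1.len_le
      rw [child_len hc]; omega
    · contradiction
  · intro i hi
    rw [← hν] at hi
    exact ⟨Or.inl hi.1, lnkP_mono Set.subset_union_left hi.2⟩

/-- The cancellation argument for a fixed tree. -/
lemma fixed_tree_sum (hclosed : ∀ s t : ℕ, (s : ℤ) ∉ S → (t : ℤ) ∉ S → ((s : ℤ) + (t : ℤ)) ∉ S)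
    {R : Type*} [CommRing R] (u : R) (M : Finset (Fin n)) :
    ∑ μ ∈ M.powerset, (-1 : R) ^ (n - (μ : Set (Fin n)).ncard) *
        (-u) ^ (n - (nu S T (μ : Set (Fin n))).ncard)
      = ∑ μ ∈ M.powerset.filter (fun μ : Finset (Fin n) => ∀ i ∈ M, lnkP S T (μ : Set (Fin n)) i),
        u ^ (n - (μ : Set (Fin n)).ncard) := by
  set N : Finset (Fin n) → Finset (Fin n) := fun μ => (nu S T (μ : Set (Fin n))).toFinset with hN
  have hNc : ∀ μ : Finset (Fin n), ((N μ : Finset (Fin n)) : Set (Fin n)) = nu S T (μ : Set (Fin n)) := by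
    intro μ; simp [hN]
  have hNsub : ∀ μ, N μ ⊆ μ := by
    intro μ i hi
    have : i ∈ nu S T (μ : Set (Fin n)) := by simpa [hN] using hi
    exact this.1
  have hcard : ∀ μ : Finset (Fin n), μ.card ≤ n := fun μ => by simpa using Finset.card_le_univ μ
  rw [← Finset.sum_fiberwise_of_maps_to (s := M.powerset) (t := M.powerset.filter (fun ν => N ν = ν))
    (g := N)]
  swap
  · intro μ hμ
    rw [Finset.mem_powerset] at hμ
    rw [Finset.mem_filter, Finset.mem_powerset]
    refine ⟨(hNsub μ).trans hμ, ?_⟩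
    apply Finset.coe_injective
    rw [hNc, hNc, nu_nu]
  have hfib : ∀ ν ∈ M.powerset.filter (fun ν => N ν = ν),
      ∑ μ ∈ M.powerset.filter (fun μ => N μ = ν), (-1 : R) ^ (n - (μ : Set (Fin n)).ncard) *
        (-u) ^ (n - (nu S T (μ : Set (Fin n))).ncard)
      = if (∀ i ∈ M, lnkP S T (ν : Set (Fin n)) i) then u ^ (n - (ν : Set (Fin n)).ncard) else 0 := by
    intro ν hν
    obtain ⟨hνM, hνν⟩ := Finset.mem_filter.mp hν
    rw [Finset.mem_powerset] at hνM
    have hνν' : nu S T (ν : Set (Fin n)) = ν := by rw [← hNc, hνν]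
    set L := M.filter (fun i => i ∉ ν ∧ ¬ lnkP S T (ν : Set (Fin n)) i) with hL
    have hset : M.powerset.filter (fun μ => N μ = ν) = L.powerset.image (fun X => ν ∪ X) := by
      ext μ
      simp only [Finset.mem_filter, Finset.mem_powerset, Finset.mem_image]
      constructor
      · rintro ⟨hμM, hμ⟩
        refine ⟨μ \ ν, ?_, ?_⟩
        · intro i hi
          rw [Finset.mem_sdiff] at hi
          rw [hL, Finset.mem_filter]
          refine ⟨hμM hi.1, hi.2, fun h => hi.2 ?_⟩
          have h2 : i ∈ nu S T (μ : Set (Fin n)) :=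
            ⟨hi.1, lnkP_mono (by rw [← hμ]; exact_mod_cast hNsub μ) h⟩
          rw [← hNc, hμ] at h2
          exact_mod_cast h2
        · apply Finset.union_sdiff_of_subset
          rw [← hμ]; exact hNsub μ
      · rintro ⟨X, hX, rfl⟩
        refine ⟨Finset.union_subset hνM (hX.trans (Finset.filter_subset _ _)), ?_⟩
        apply Finset.coe_injective
        rw [hNc, Finset.coe_union]
        apply nu_union hclosed hνν'
        intro i hi
        exact (Finset.mem_filter.mp (hX hi)).2.2
    have hdisj : ∀ X ∈ L.powerset, Disjoint ν X := by
      intro X hX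
      rw [Finset.mem_powerset] at hX
      rw [Finset.disjoint_right]
      intro i hi
      exact (Finset.mem_filter.mp (hX hi)).2.1
    rw [hset, Finset.sum_image]
    swap
    · intro X hX Y hY hXY
      have h1 := hdisj X hX
      have h2 := hdisj Y hY
      have : (ν ∪ X) \ ν = (ν ∪ Y) \ ν := by rw [show ν ∪ X = ν ∪ Y from hXY]
      rwa [Finset.union_sdiff_cancel_left h1, Finset.union_sdiff_cancel_left h2] at this
    have hterm : ∀ X ∈ L.powerset, (-1 : R) ^ (n - ((ν ∪ X : Finset (Fin n)) : Set (Fin n)).ncard) *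
        (-u) ^ (n - (nu S T ((ν ∪ X : Finset (Fin n)) : Set (Fin n))).ncard)
        = u ^ (n - (ν : Set (Fin n)).ncard) * (((-1 : ℤ) ^ X.card : ℤ) : R) := by
      intro X hX
      have hX' := Finset.mem_powerset.mp hX
      rw [Finset.coe_union, nu_union hclosed hνν' (fun i hi => (Finset.mem_filter.mp (hX' hi)).2.2),
        ← Finset.coe_union, Set.ncard_coe_finset, Set.ncard_coe_finset,
        Finset.card_union_of_disjoint (hdisj X hX)]
      have hc := hcard (ν ∪ X)
      rw [Finset.card_union_of_disjoint (hdisj X hX)] at hc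
      obtain ⟨k, hk⟩ := Nat.exists_eq_add_of_le hc
      have e1 : n - (ν.card + X.card) = k := by omega
      have e2 : n - ν.card = k + X.card := by omega
      rw [e1, e2, neg_pow u]
      push_cast
      have : (-1 : R) ^ k * (-1) ^ k = 1 := by rw [← mul_pow]; simp
      calc (-1 : R) ^ k * ((-1) ^ (k + X.card) * u ^ (k + X.card))
          = ((-1 : R) ^ k * (-1) ^ k) * ((-1) ^ X.card * u ^ (k + X.card)) := by ring
        _ = _ := by rw [this]; ring
    rw [Finset.sum_congr rfl hterm, ← Finset.mul_sum, ← Int.cast_sum, Finset.sum_powerset_neg_one_pow_card]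
    by_cases hLe : L = ∅
    · have : ∀ i ∈ M, lnkP S T (ν : Set (Fin n)) i := by
        intro i hi
        by_contra hc
        by_cases hiν : i ∈ ν
        · have : i ∈ nu S T (ν : Set (Fin n)) := by rw [hνν']; exact_mod_cast hiν
          exact hc this.2
        · have : i ∈ L := Finset.mem_filter.mpr ⟨hi, hiν, hc⟩
          rw [hLe] at this
          simp at this
      rw [if_pos hLe, if_pos this]
      simp
    · rw [if_neg hLe, if_neg]
      · simp
      · intro h
        apply hLe
        rw [hL, Finset.filter_eq_empty_iff]
        intro i hi hc
        exact hc.2 (h i hi)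
  rw [Finset.sum_congr rfl hfib, ← Finset.sum_filter, Finset.filter_filter]
  apply Finset.sum_congr ?_ (fun _ _ => rfl)
  ext ν
  simp only [Finset.mem_filter, Finset.mem_powerset]
  constructor
  · rintro ⟨h1, _, h2⟩; exact ⟨h1, h2⟩
  · rintro ⟨h1, h2⟩
    refine ⟨h1, ?_, h2⟩
    apply Finset.coe_injective
    rw [hNc]
    ext i
    exact ⟨fun h => h.1, fun h => ⟨h, h2 i (h1 h)⟩⟩

end chains


/-! ### The Catalan arrangement and marked trees -/

section catalan
variable {m n : ℕ}

noncomputable def K (x : Fin n → ℝ) (j : Fin n) (s : ℕ) : ℝ ×ₗ ℝ ×ₗ Fin n :=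
  toLex (x j + s, toLex (x j, j))

lemma K_lt {x : Fin n → ℝ} {j k : Fin n} {s t : ℕ} : K x j s < K x k t ↔
    x j + s < x k + t ∨ (x j + s = x k + t ∧ (x j < x k ∨ (x j = x k ∧ j < k))) := by
  unfold K
  rw [Prod.Lex.toLex_lt_toLex]
  simp only [Prod.Lex.toLex_lt_toLex]

lemma K_inj {x : Fin n → ℝ} {j k : Fin n} {s t : ℕ} (h : K x j s = K x k t) : j = k ∧ s = t := by
  unfold K at h
  have h1 := congrArg (fun z => (ofLex (ofLex z).2).2) h
  have h2 := congrArg (fun z => (ofLex z).1) h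
  simp at h1 h2
  subst h1
  simpa using h2

lemma K_shift {x : Fin n → ℝ} {j k : Fin n} {s t : ℕ} :
    K x j (s + 1) < K x k (t + 1) ↔ K x j s < K x k t := by
  rw [K_lt, K_lt]
  push_cast
  simp only [← add_assoc, add_lt_add_iff_right, add_left_inj]

lemma K_sub {x : Fin n → ℝ} {j k : Fin n} {s t : ℕ} (r : ℕ) :
    K x j (s + r) < K x k (t + r) ↔ K x j s < K x k t := by
  induction r with
  | zero => rfl
  | succ r ih => rw [← add_assoc, ← add_assoc, K_shift, ih]

lemma K_mono {x : Fin n → ℝ} {j : Fin n} {s t : ℕ} (h : s ≤ t) : K x j s ≤ K x j t := by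
  rcases h.lt_or_eq with h | rfl
  · apply le_of_lt
    rw [K_lt]
    left
    have : (s : ℝ) < t := by exact_mod_cast h
    linarith
  · rfl

def Rep (x : Fin n → ℝ) (T : Tree m n) (μ : Set (Fin n)) : Prop :=
  (∀ r, T.path r = [] → ∀ k t, t ≤ m → K x r 0 ≤ K x k t) ∧
  ∀ i j s, T.IsChild i j s → K x j s < K x i 0 ∧
    (∀ k t, t ≤ m → K x k t ≤ K x j s ∨ K x i 0 ≤ K x k t) ∧ (i ∈ μ ↔ x i = x j + s)

lemma path_nil_or (T : Tree m n) (i : Fin n) : T.path i = [] ∨ ∃ j s, T.IsChild i j s := by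
  by_cases h : T.path i = []
  · exact Or.inl h
  · exact Or.inr (exists_parent h)

/-- R4 -/
lemma rep_unique {x x' : Fin n → ℝ} {T T' : Tree m n} {μ μ' : Set (Fin n)}
    (hμ : IsMarking T μ) (hμ' : IsMarking T' μ') (h : Rep x T μ) (h' : Rep x' T' μ')
    (hK : ∀ j k s t, s ≤ m → t ≤ m → (K x j s < K x k t ↔ K x' j s < K x' k t))
    (hE : ∀ i j s, s ≤ m → (x i = x j + (s : ℝ) ↔ x' i = x' j + (s : ℝ))) :
    T = T' ∧ μ = μ' := by
  have hle : ∀ j k s t, s ≤ m → t ≤ m → (K x j s ≤ K x k t ↔ K x' j s ≤ K x' k t) := by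
    intro j k s t hs ht
    rw [← not_lt, ← not_lt, hK _ _ _ _ ht hs]
  have main : ∀ N, ∀ i, (T.path i).length = N → T'.path i = T.path i ∧
      ∀ j s, T.IsChild i j s → T'.IsChild i j s := by
    intro N
    induction N using Nat.strong_induction_on with
    | _ N ih =>
      intro i hi
      rcases path_nil_or T i with h0 | ⟨j, s, hc⟩
      · refine ⟨?_, ?_⟩
        · rcases path_nil_or T' i with h1 | ⟨j', s', hc'⟩
          · rw [h0, h1]
          · have h2 := (h'.2 i j' s' hc').1
            rw [← hK _ _ _ _ (child_le hc') (Nat.zero_le _)] at h2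
            exact absurd h2 (not_lt.mpr (h.1 i h0 j' s' (child_le hc')))
        · intro j s hc
          unfold Tree.IsChild at hc
          rw [h0] at hc
          simp at hc
      · obtain ⟨e1, e2, _⟩ := h.2 i j s hc
        have hch : T'.IsChild i j s := by
          rcases path_nil_or T' i with h1 | ⟨j', s', hc'⟩
          · have := h'.1 i h1 j s (child_le hc)
            rw [← hle _ _ _ _ (Nat.zero_le _) (child_le hc)] at this
            exact absurd e1 (not_lt.mpr this)
          · obtain ⟨e3, e4, _⟩ := h'.2 i j' s' hc'
            have hs := child_le hc
            have hs' := child_le hc'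
            have a1 : K x j' s' ≤ K x j s := by
              rcases e2 j' s' hs' with h5 | h5
              · exact h5
              · rw [hle _ _ _ _ (Nat.zero_le _) hs'] at h5
                exact absurd e3 (not_lt.mpr h5)
            have a2 : K x j s ≤ K x j' s' := by
              rcases e4 j s hs with h5 | h5
              · rwa [← hle _ _ _ _ hs hs'] at h5
              · rw [← hle _ _ _ _ (Nat.zero_le _) hs] at h5
                exact absurd e1 (not_lt.mpr h5)
            obtain ⟨rfl, rfl⟩ := K_inj (le_antisymm a1 a2)
            exact hc'
        have hj := (ih _ (by have := child_len hc; omega) j rfl).1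
        refine ⟨?_, ?_⟩
        · unfold Tree.IsChild at hc hch
          rw [hc, hch, hj]
        · intro j2 s2 hc2
          obtain ⟨rfl, rfl⟩ := child_unique hc2 hc
          exact hch
  have hT : T = T' := by
    cases T; cases T'
    congr 1
    funext i
    exact (main _ i rfl).1.symm
  subst hT
  refine ⟨rfl, ?_⟩
  ext i
  rcases path_nil_or T i with h0 | ⟨j, s, hc⟩
  · have hno : ∀ (ρ : Set (Fin n)), IsMarking T ρ → i ∉ ρ := by
      intro ρ hρ hi
      obtain ⟨j, s, hc, _⟩ := hρ i hi
      have := hc.1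
      unfold Tree.IsChild at this
      rw [h0] at this
      simp at this
    exact ⟨fun h => absurd h (hno _ hμ), fun h => absurd h (hno _ hμ')⟩
  · rw [(h.2 i j s hc).2.2, (h'.2 i j s hc).2.2, hE _ _ _ (child_le hc)]

/-- R3: the tree determines the order. -/
lemma rep_order {x x' : Fin n → ℝ} {T : Tree m n} {μ : Set (Fin n)}
    (h : Rep x T μ) (h' : Rep x' T μ) :
    ∀ j k s t, s ≤ m → t ≤ m → (K x j s < K x k t ↔ K x' j s < K x' k t) := by
  have main : ∀ N, ∀ j k, (T.path j).length + (T.path k).length = N → ∀ s t, s ≤ m → t ≤ m →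
      (K x j s < K x k t ↔ K x' j s < K x' k t) := by
    intro N
    induction N using Nat.strong_induction_on with
    | _ N ih =>
      intro j k hN s
      induction s with
      | zero =>
        intro t _ ht
        by_cases heq : j = k ∧ 0 = t
        · obtain ⟨rfl, rfl⟩ := heq
          simp
        · have ne : ∀ y : Fin n → ℝ, K y j 0 ≠ K y k t := fun y e => heq (K_inj e)
          rcases path_nil_or T j with h0 | ⟨j', s', hc⟩
          · exact ⟨fun _ => lt_of_le_of_ne (h'.1 j h0 k t ht) (ne x'),
              fun _ => lt_of_le_of_ne (h.1 j h0 k t ht) (ne x)⟩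
          · have key : ∀ y : Fin n → ℝ, Rep y T μ → (K y j 0 < K y k t ↔ K y j' s' < K y k t) := by
              intro y hy
              obtain ⟨e1, e2, _⟩ := hy.2 j j' s' hc
              constructor
              · exact fun h => e1.trans h
              · intro h3
                rcases e2 k t ht with h4 | h4
                · exact absurd h3 (not_lt.mpr h4)
                · exact lt_of_le_of_ne h4 (ne y)
            rw [key x h, key x' h']
            exact ih _ (by have := child_len hc; omega) j' k rfl s' t (child_le hc) ht
      | succ s ihs =>
        intro t hs ht
        cases t with
        | succ t =>
          rw [K_shift, K_shift]
          exact ihs t (by omega) (by omega)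
        | zero =>
          rcases path_nil_or T k with h0 | ⟨k', t', hc⟩
          · exact ⟨fun h2 => absurd h2 (not_lt.mpr (h.1 k h0 j _ hs)),
              fun h2 => absurd h2 (not_lt.mpr (h'.1 k h0 j _ hs))⟩
          · have key : ∀ y : Fin n → ℝ, Rep y T μ →
                (K y j (s + 1) < K y k 0 ↔ ¬ K y k' t' < K y j (s + 1)) := by
              intro y hy
              obtain ⟨e1, e2, _⟩ := hy.2 k k' t' hc
              rw [not_lt]
              constructor
              · intro h3
                rcases e2 j (s + 1) hs with h4 | h4
                · exact h4
                · exact absurd h3 (not_lt.mpr h4)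
              · exact fun h3 => lt_of_le_of_lt h3 e1
            rw [key x h, key x' h']
            exact not_congr (ih _ (by have := child_len hc; omega) k' j rfl t' (s + 1) (child_le hc) hs)
  intro j k
  exact main _ j k rfl

lemma rep_ch {x : Fin n → ℝ} {T : Tree m n} {μ : Set (Fin n)} (h : Rep x T μ) {j i : Fin n}
    (hc : Ch T μ j i) : x i - x j = (T.drift i : ℝ) - T.drift j := by
  induction hc with
  | refl => simp
  | @tail b c _ hbc ih =>
    obtain ⟨hcμ, s, hs⟩ := hbc
    have := (h.2 c b s hs).2.2.mp hcμ
    rw [child_drift hs, this]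
    push_cast
    linarith

lemma rep_ch_conv {x : Fin n → ℝ} {T : Tree m n} {μ : Set (Fin n)} (h : Rep x T μ) :
    ∀ N, ∀ i j s, (T.path i).length = N → s ≤ m → x i = x j + (s : ℝ) → K x j s ≤ K x i 0 →
      Ch T μ j i ∧ T.drift i = T.drift j + s := by
  intro N
  induction N using Nat.strong_induction_on with
  | _ N ih =>
    intro i j s hN hs hx hle
    rcases hle.lt_or_eq with hlt | heq
    swap
    · obtain ⟨rfl, rfl⟩ := K_inj heq
      exact ⟨.refl, rfl⟩
    rcases path_nil_or T i with h0 | ⟨k, t, hc⟩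
    · exact absurd hlt (not_lt.mpr (h.1 i h0 j s hs))
    obtain ⟨e1, e2, e3⟩ := h.2 i k t hc
    have h1 : K x j s ≤ K x k t := by
      rcases e2 j s hs with h4 | h4
      · exact h4
      · exact absurd hlt (not_lt.mpr h4)
    have hxk : x i = x k + t := by
      have a1 : x k + t ≤ x i := by
        rw [K_lt] at e1
        rcases e1 with e | e
        · simp at e; exact e.le
        · have := e.1; simp at this; exact this.le
      have a2 : x j + s ≤ x k + t := by
        rcases h1.lt_or_eq with h5 | h5
        · rw [K_lt] at h5
          rcases h5 with e | e
          · exact e.le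
          · exact e.1.le
        · obtain ⟨rfl, rfl⟩ := K_inj h5; rfl
      linarith
    have hedge : Edge T μ k i := ⟨e3.mpr hxk, t, hc⟩
    rcases h1.lt_or_eq with h5 | h5
    · have hts : t ≤ s := by
        rw [K_lt] at h5
        have : x j ≤ x k := by
          rcases h5 with e | ⟨_, e | e⟩
          · linarith
          · exact e.le
          · exact e.1.le
        have : (t : ℝ) ≤ s := by linarith
        exact_mod_cast this
      obtain ⟨r, rfl⟩ := Nat.exists_eq_add_of_le hts
      rw [add_comm t r] at h5
      have h6 : K x j r < K x k 0 := by
        rw [← K_sub t, zero_add]; exact h5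
      push_cast at hx
      obtain ⟨g1, g2⟩ := ih _ (by have := child_len hc; omega) k j r rfl (by omega) (by linarith) h6.le
      refine ⟨g1.tail hedge, ?_⟩
      rw [child_drift hc, g2]
      omega
    · obtain ⟨rfl, rfl⟩ := K_inj h5
      exact ⟨.single hedge, child_drift hc⟩

/-- R5 -/
lemma rep_eq_iff {x : Fin n → ℝ} {T : Tree m n} {μ : Set (Fin n)} (h : Rep x T μ)
    (i j : Fin n) (s : ℤ) (hs : -(m : ℤ) ≤ s) (hs' : s ≤ m) :
    x i - x j = (s : ℝ) ↔ (Ch T μ i j ∨ Ch T μ j i) ∧ (T.drift i : ℤ) - T.drift j = s := by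
  constructor
  · intro hx
    have main : ∀ i j : Fin n, ∀ s : ℕ, s ≤ m → x i = x j + (s : ℝ) →
        (Ch T μ i j ∨ Ch T μ j i) ∧ (T.drift i : ℤ) - T.drift j = s := by
      intro i j s hs hx
      rcases le_or_gt (K x j s) (K x i 0) with hk | hk
      · obtain ⟨g1, g2⟩ := rep_ch_conv h _ i j s rfl hs hx hk
        exact ⟨Or.inr g1, by omega⟩
      · have : s = 0 := by
          rw [K_lt] at hk
          by_contra hs0
          have : (0 : ℝ) < s := by exact_mod_cast Nat.pos_of_ne_zero hs0
          rcases hk with e | ⟨_, e | e⟩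
          · simp at e; linarith
          · linarith
          · linarith [e.1]
        subst this
        obtain ⟨g1, g2⟩ := rep_ch_conv h _ j i 0 rfl hs (by simp at hx ⊢; linarith) hk.le
        exact ⟨Or.inl g1, by push_cast; omega⟩
    rcases le_total 0 s with h0 | h0
    · obtain ⟨t, rfl⟩ := Int.eq_ofNat_of_zero_le h0
      exact main i j t (by omega) (by push_cast at hx; linarith)
    · obtain ⟨t, ht⟩ := Int.eq_ofNat_of_zero_le (neg_nonneg.mpr h0)
      have : s = -(t : ℤ) := by omega
      subst this
      obtain ⟨g1, g2⟩ := main j i t (by omega) (by push_cast at hx; linarith)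
      exact ⟨g1.symm, by omega⟩
  · rintro ⟨hc | hc, hd⟩
    · have := rep_ch h hc
      rw [← hd]
      push_cast
      linarith
    · have := rep_ch h hc
      rw [← hd]
      push_cast
      linarith

lemma rep_zrel {x : Fin n → ℝ} {T : Tree m n} {μ : Set (Fin n)} (h : Rep x T μ)
    (Sf : Finset ℤ) (hSf : Sf ⊆ Finset.Icc (-(m : ℤ)) m) :
    zrel (pat (HS Sf n) x) = srel (Sf : Set ℤ) T μ := by
  funext a b
  apply propext
  unfold zrel srel
  constructor
  · rintro ⟨s, hs⟩
    have hm : (a, b, s) ∈ HS Sf n := by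
      by_contra hc
      simp [pat, hc] at hs
    have hsS : s ∈ Sf := by simpa [HS] using hm
    simp only [pat, hm, if_true, fval, sign_eq_zero_iff] at hs
    have hI := Finset.mem_Icc.mp (hSf hsS)
    obtain ⟨g1, g2⟩ := (rep_eq_iff h a b s hI.1 hI.2).mp (by linarith)
    exact ⟨g1, by rw [g2]; exact hsS⟩
  · rintro ⟨g1, g2⟩
    have hI := Finset.mem_Icc.mp (hSf g2)
    refine ⟨(T.drift a : ℤ) - T.drift b, ?_⟩
    · have := (rep_eq_iff h a b _ hI.1 hI.2).mpr ⟨g1, rfl⟩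
      have hm : (a, b, (T.drift a : ℤ) - T.drift b) ∈ HS Sf n := by simpa [HS] using g2
      simp only [pat, hm, if_true, fval, sign_eq_zero_iff]
      linarith

/-- the same tree gives the same pattern -/
lemma rep_pat {x x' : Fin n → ℝ} {T : Tree m n} {μ : Set (Fin n)}
    (h : Rep x T μ) (h' : Rep x' T μ) :
    pat (HS (Finset.Icc (-(m : ℤ)) m) n) x = pat (HS (Finset.Icc (-(m : ℤ)) m) n) x' := by
  rw [pat_eq_iff]
  rintro ⟨i, j, s⟩ hs
  simp only [HS, Finset.mem_product, Finset.mem_univ, true_and, Finset.mem_Icc] at hs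
  simp only [fval]
  have heq : x i - x j = (s : ℝ) ↔ x' i - x' j = (s : ℝ) := by
    rw [rep_eq_iff h i j s hs.1 hs.2, rep_eq_iff h' i j s hs.1 hs.2]
  by_cases he : x i - x j = (s : ℝ)
  · rw [he, heq.mp he]
  · have he' : ¬ x' i - x' j = (s : ℝ) := fun e => he (heq.mpr e)
    have hlt : x i - x j < (s : ℝ) ↔ x' i - x' j < (s : ℝ) := by
      rcases le_total 0 s with h0 | h0
      · obtain ⟨t, rfl⟩ := Int.eq_ofNat_of_zero_le h0
        have key : ∀ y : Fin n → ℝ, ¬ y i - y j = ((t : ℤ) : ℝ) →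
            (y i - y j < ((t : ℤ) : ℝ) ↔ K y i 0 < K y j t) := by
          intro y hy
          rw [K_lt]
          push_cast at hy ⊢
          constructor
          · intro h; left; linarith
          · rintro (h | ⟨h, _⟩)
            · linarith
            · exact absurd (by linarith) hy
        rw [key x he, key x' he']
        exact rep_order h h' i j 0 t (Nat.zero_le _) (by omega)
      · obtain ⟨t, ht⟩ := Int.eq_ofNat_of_zero_le (neg_nonneg.mpr h0)
        have hst : s = -(t : ℤ) := by omega
        subst hst
        have key : ∀ y : Fin n → ℝ, ¬ y i - y j = ((-(t : ℤ) : ℤ) : ℝ) →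
            (y i - y j < ((-(t : ℤ) : ℤ) : ℝ) ↔ K y i t < K y j 0) := by
          intro y hy
          rw [K_lt]
          push_cast at hy ⊢
          constructor
          · intro h; left; linarith
          · rintro (h | ⟨h, _⟩)
            · linarith
            · exact absurd (by linarith) hy
        rw [key x he, key x' he']
        exact rep_order h h' i j t 0 (by omega) (Nat.zero_le _)
    rcases lt_or_gt_of_ne he with h1 | h1
    · rw [sign_neg (by linarith), sign_neg (by linarith [hlt.mp h1])]
    · have h2 : (s : ℝ) < x' i - x' j := by
        rcases lt_or_gt_of_ne he' with h3 | h3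
        · linarith [hlt.mpr h3]
        · exact h3
      rw [sign_pos (by linarith), sign_pos (by linarith)]

lemma pat_order {x x' : Fin n → ℝ}
    (hp : pat (HS (Finset.Icc (-(m : ℤ)) m) n) x = pat (HS (Finset.Icc (-(m : ℤ)) m) n) x') :
    (∀ j k s t, s ≤ m → t ≤ m → (K x j s < K x k t ↔ K x' j s < K x' k t)) ∧
    (∀ i j s, s ≤ m → (x i = x j + (s : ℝ) ↔ x' i = x' j + (s : ℝ))) := by
  rw [pat_eq_iff] at hp
  have hsg : ∀ i j : Fin n, ∀ s : ℤ, -(m : ℤ) ≤ s → s ≤ m →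
      SignType.sign (x i - x j - (s : ℝ)) = SignType.sign (x' i - x' j - (s : ℝ)) := by
    intro i j s h1 h2
    exact hp (i, j, s) (by simp [HS, h1, h2])
  have hlt : ∀ i j : Fin n, ∀ s : ℤ, -(m : ℤ) ≤ s → s ≤ m →
      (x i - x j < (s : ℝ) ↔ x' i - x' j < (s : ℝ)) := by
    intro i j s h1 h2
    rw [← sub_neg, ← sub_neg (b := (s : ℝ)), ← sign_eq_neg_one_iff, ← sign_eq_neg_one_iff, hsg i j s h1 h2]
  have heq : ∀ i j : Fin n, ∀ s : ℤ, -(m : ℤ) ≤ s → s ≤ m →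
      (x i - x j = (s : ℝ) ↔ x' i - x' j = (s : ℝ)) := by
    intro i j s h1 h2
    have h3 := hsg i j s h1 h2
    rw [← sub_eq_zero, ← sub_eq_zero (b := (s : ℝ))]
    constructor <;> intro h4
    · rw [h4, sign_zero] at h3; exact sign_eq_zero_iff.mp h3.symm
    · rw [h4, sign_zero] at h3; exact sign_eq_zero_iff.mp h3
  constructor
  · intro j k s t hs ht
    rw [K_lt, K_lt]
    have a1 := hlt j k ((t : ℤ) - s) (by omega) (by omega)
    have a2 := heq j k ((t : ℤ) - s) (by omega) (by omega)
    have a3 := hlt j k 0 (by omega) (by omega)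
    have a4 := heq j k 0 (by omega) (by omega)
    push_cast at a1 a2 a3 a4
    have b1 : x j + s < x k + t ↔ x' j + s < x' k + t := by
      rw [show x j + s < x k + t ↔ x j - x k < t - s by constructor <;> intro <;> linarith, a1]
      constructor <;> intro <;> linarith
    have b2 : x j + s = x k + t ↔ x' j + s = x' k + t := by
      rw [show x j + s = x k + t ↔ x j - x k = t - s by constructor <;> intro <;> linarith, a2]
      constructor <;> intro <;> linarith
    rw [sub_neg, sub_neg] at a3
    rw [sub_eq_zero, sub_eq_zero] at a4
    rw [b1, b2, a3, a4]
  · intro i j s hs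
    have a2 := heq i j s (by omega) (by omega)
    push_cast at a2
    rw [sub_eq_iff_eq_add, sub_eq_iff_eq_add] at a2
    rw [add_comm, a2, add_comm]

end catalan


section catalan2
variable {m n : ℕ}

lemma exists_pred (m : ℕ) (x : Fin n → ℝ) (i : Fin n) (h : ¬ ∀ k t, t ≤ m → K x i 0 ≤ K x k t) :
    ∃ p : Fin n × ℕ, p.2 ≤ m ∧ K x p.1 p.2 < K x i 0 ∧
      ∀ k t, t ≤ m → K x k t ≤ K x p.1 p.2 ∨ K x i 0 ≤ K x k t := by
  push Not at h
  obtain ⟨k, t, ht, hk⟩ := h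
  obtain ⟨p, hp, hmax⟩ := Finset.exists_max_image
    ((Finset.univ ×ˢ Finset.range (m + 1) : Finset (Fin n × ℕ)).filter
      (fun p => K x p.1 p.2 < K x i 0)) (fun p => K x p.1 p.2)
    ⟨(k, t), by simp only [Finset.mem_filter, Finset.mem_product, Finset.mem_univ, Finset.mem_range,
      true_and]; exact ⟨by omega, hk⟩⟩
  simp only [Finset.mem_filter, Finset.mem_product, Finset.mem_univ, Finset.mem_range,
      true_and] at hp hmax
  refine ⟨p, by omega, hp.2, fun k t ht => ?_⟩
  rcases lt_or_ge (K x k t) (K x i 0) with h | h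
  · exact Or.inl (hmax (k, t) ⟨by omega, h⟩)
  · exact Or.inr h

/-- R1 -/
lemma rep_exists_tree (m : ℕ) (x : Fin n → ℝ) : ∃ (T : Tree m n) (μ : Set (Fin n)),
    IsMarking T μ ∧ Rep x T μ := by
  set isMin : Fin n → Prop := fun i => ∀ k t, t ≤ m → K x i 0 ≤ K x k t with hisMin
  choose p hp using fun i => fun (h : ¬ isMin i) => exists_pred m x i h
  have wf : WellFounded (fun i j : Fin n => K x i 0 < K x j 0) := by
    have : IsTrans (Fin n) (fun i j : Fin n => K x i 0 < K x j 0) := ⟨fun _ _ _ h1 h2 => lt_trans h1 h2⟩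
    have : Std.Irrefl (fun i j : Fin n => K x i 0 < K x j 0) := ⟨fun _ h => lt_irrefl _ h⟩
    exact Finite.wellFounded_of_trans_of_irrefl _
  have hdec : ∀ i (h : ¬ isMin i), K x (p i h).1 0 < K x i 0 := fun i h =>
    lt_of_le_of_lt (K_mono (Nat.zero_le _)) (hp i h).2.1
  obtain ⟨path, hpath⟩ : ∃ path : Fin n → List ℕ, ∀ i, path i =
      if h : isMin i then [] else path (p i h).1 ++ [(p i h).2] := by
    refine ⟨wf.fix (fun i rec => if h : isMin i then [] else
      rec (p i h).1 (hdec i h) ++ [(p i h).2]), fun i => ?_⟩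
    rw [wf.fix_eq]
  have hmin : ∀ i, isMin i → path i = [] := fun i h => by rw [hpath, dif_pos h]
  have hnmin : ∀ i (h : ¬ isMin i), path i = path (p i h).1 ++ [(p i h).2] := fun i h => by
    rw [hpath, dif_neg h]
  have hinj : ∀ N, ∀ i i', (path i).length = N → path i = path i' → i = i' := by
    intro N
    induction N using Nat.strong_induction_on with
    | _ N ih =>
      intro i i' hN he
      by_cases h : isMin i
      · by_cases h' : isMin i'
        · exact (K_inj (le_antisymm (h i' 0 (Nat.zero_le _)) (h' i 0 (Nat.zero_le _)))).1
        · rw [hmin i h, hnmin i' h'] at he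
          simp at he
      · by_cases h' : isMin i'
        · rw [hmin i' h', hnmin i h] at he
          simp at he
        · rw [hnmin i h, hnmin i' h'] at he
          have e := List.append_inj' he rfl
          have e1 : (p i h).1 = (p i' h').1 := ih _ (by rw [← hN, hnmin i h]; simp) _ _ rfl e.1
          have e2 : p i h = p i' h' := Prod.ext e1 (by simpa using e.2)
          have a := hp i h
          have a' := hp i' h'
          rw [← e2] at a'
          have b1 := (a.2.2 i' 0 (Nat.zero_le _)).resolve_left (not_le.mpr a'.2.1)
          have b2 := (a'.2.2 i 0 (Nat.zero_le _)).resolve_left (not_le.mpr a.2.1)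
          exact (K_inj (le_antisymm b1 b2)).1
  have hentry : ∀ N, ∀ i, (path i).length = N → ∀ s ∈ path i, s ≤ m := by
    intro N
    induction N using Nat.strong_induction_on with
    | _ N ih =>
      intro i hN s hs
      by_cases h : isMin i
      · rw [hmin i h] at hs; simp at hs
      · have hl := hnmin i h
        rw [hl, List.mem_append] at hs
        rcases hs with hs | hs
        · exact ih _ (by rw [← hN, hl]; simp) _ rfl s hs
        · simp at hs; rw [hs]; exact (hp i h).1
  let T : Tree m n := ⟨path, fun i => hentry _ i rfl, fun i i' he => hinj _ i i' rfl he, by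
    intro i hi
    by_cases h : isMin i
    · exact absurd (hmin i h) hi
    · exact ⟨(p i h).1, by rw [hnmin i h]; simp⟩⟩
  have hchild : ∀ i j s, T.IsChild i j s → ∃ h : ¬ isMin i, p i h = (j, s) := by
    intro i j s hc
    have hc' : path i = path j ++ [s] := hc
    have h : ¬ isMin i := by
      intro h
      rw [hmin i h] at hc'
      simp at hc'
    refine ⟨h, ?_⟩
    have h2 : T.IsChild i (p i h).1 (p i h).2 := hnmin i h
    obtain ⟨e1, e2⟩ := child_unique h2 hc
    exact Prod.ext e1 e2
  have hrep0 : ∀ i j s, T.IsChild i j s → s ≤ m ∧ K x j s < K x i 0 ∧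
      ∀ k t, t ≤ m → K x k t ≤ K x j s ∨ K x i 0 ≤ K x k t := by
    intro i j s hc
    obtain ⟨h, e⟩ := hchild i j s hc
    have := hp i h
    rw [e] at this
    exact this
  refine ⟨T, {i | ∃ j s, T.IsChild i j s ∧ x i = x j + s}, ?_, ?_, ?_⟩
  · rintro i ⟨j, s, hc, hx⟩
    obtain ⟨hs, h1, h2⟩ := hrep0 i j s hc
    have h1' := K_lt.mp h1
    have hjs : x j < x i ∨ (x j = x i ∧ j < i) := by
      rcases h1' with h | h
      · simp [hx] at h
      · exact h.2
    refine ⟨j, s, ⟨hc, ?_⟩, ?_⟩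
    · rintro t hst htm ⟨k, hk⟩
      obtain ⟨_, h3, h4⟩ := hrep0 k j t hk
      have hst' : (s : ℝ) < t := by exact_mod_cast hst
      have ht : ((t - s : ℕ) : ℝ) = t - s := by rw [Nat.cast_sub hst.le]
      rcases h4 i (t - s) (by omega) with h5 | h5
      · apply absurd h5 (not_le.mpr _)
        rw [K_lt]
        right
        rw [ht]
        exact ⟨by linarith, hjs⟩
      · apply absurd h5 (not_le.mpr _)
        rw [K_lt, ht]
        rw [K_lt] at h3
        simp at h3 ⊢
        rcases h3 with h3 | h3
        · left; linarith
        · right; exact ⟨by linarith, Or.inl (by linarith)⟩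
    · rintro rfl
      simp at hx
      rcases hjs with h | h
      · linarith
      · exact h.2
  · intro r hr k t ht
    by_cases h : isMin r
    · exact h k t ht
    · have : path r = [] := hr
      rw [hnmin r h] at this
      simp at this
  · intro i j s hc
    obtain ⟨hs, h1, h2⟩ := hrep0 i j s hc
    refine ⟨h1, h2, ?_, fun hx => ⟨j, s, hc, hx⟩⟩
    rintro ⟨j', s', hc', hx⟩
    obtain ⟨rfl, rfl⟩ := child_unique hc hc'
    exact hx

lemma prefix_node (T : Tree m n) : ∀ N, ∀ i p, (T.path i).length = N → p <+: T.path i →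
    ∃ w, T.path w = p := by
  intro N
  induction N using Nat.strong_induction_on with
  | _ N ih =>
    intro i p hN hp
    rcases path_nil_or T i with h0 | ⟨j, s, hc⟩
    · rw [h0] at hp
      exact ⟨i, by rw [h0, List.prefix_nil.mp hp]⟩
    · have hl := child_len hc
      unfold Tree.IsChild at hc
      rw [hc, List.prefix_concat_iff] at hp
      rcases hp with rfl | hp
      · exact ⟨i, hc⟩
      · exact ih _ (by omega) j p rfl hp

lemma list_tri (P Q : List ℕ) : P <+: Q ∨ Q <+: P ∨
    ∃ r e f p q, e ≠ f ∧ P = r ++ e :: p ∧ Q = r ++ f :: q := by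
  induction P generalizing Q with
  | nil => left; exact List.nil_prefix
  | cons a P ih =>
    cases Q with
    | nil => right; left; exact List.nil_prefix
    | cons b Q =>
      by_cases hab : a = b
      · subst hab
        rcases ih Q with h | h | ⟨r, e, f, p, q, h, rfl, rfl⟩
        · left; exact (List.prefix_cons_inj a).mpr h
        · right; left; exact (List.prefix_cons_inj a).mpr h
        · right; right; exact ⟨a :: r, e, f, p, q, h, rfl, rfl⟩
      · right; right; exact ⟨[], a, b, P, Q, hab, rfl, rfl⟩

noncomputable def wgt (T : Tree m n) (μ : Set (Fin n)) (i : Fin n) : ℝ :=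
  ∑ l ∈ Finset.univ.filter (fun l => T.path l <+: T.path i ∧ l ∉ μ),
    (1 / (2 * (n + 1) : ℝ)) ^ (T.drift l + 1)

section
variable (T : Tree m n) (μ : Set (Fin n))

lemma eps_pos : 0 < (1 / (2 * (n + 1) : ℝ)) := by positivity

lemma eps_le : (1 / (2 * (n + 1) : ℝ)) ≤ 1 := by
  rw [div_le_one (by positivity)]
  have : (0 : ℝ) ≤ n := Nat.cast_nonneg n
  linarith

lemma n_eps : n * (1 / (2 * (n + 1) : ℝ)) < 1 := by
  rw [mul_one_div, div_lt_one (by positivity)]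
  have : (0 : ℝ) ≤ n := Nat.cast_nonneg n
  linarith

lemma wgt_nonneg (i : Fin n) : 0 ≤ wgt T μ i :=
  Finset.sum_nonneg fun _ _ => pow_nonneg (eps_pos).le _

lemma wgt_lt (i : Fin n) : wgt T μ i < 1 := by
  unfold wgt
  calc _ ≤ ∑ l ∈ Finset.univ.filter (fun l => T.path l <+: T.path i ∧ l ∉ μ),
            (1 / (2 * (n + 1) : ℝ)) := by
        apply Finset.sum_le_sum
        intro l _
        exact pow_le_of_le_one eps_pos.le eps_le (by omega)
    _ ≤ n * (1 / (2 * (n + 1) : ℝ)) := by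
        rw [Finset.sum_const, nsmul_eq_mul]
        apply mul_le_mul_of_nonneg_right _ eps_pos.le
        exact_mod_cast (Finset.card_le_univ _).trans (by simp)
    _ < 1 := n_eps

lemma wgt_mono {a b : Fin n} (h : T.path a <+: T.path b) : wgt T μ a ≤ wgt T μ b := by
  unfold wgt
  apply Finset.sum_le_sum_of_subset_of_nonneg
  · intro l hl
    simp only [Finset.mem_filter, Finset.mem_univ, true_and] at hl ⊢
    exact ⟨hl.1.trans h, hl.2⟩
  · intro l _ _
    exact pow_nonneg (eps_pos).le _

lemma wgt_child {i j : Fin n} {s : ℕ} (hc : T.IsChild i j s) :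
    wgt T μ i = wgt T μ j + if i ∈ μ then 0 else (1 / (2 * (n + 1) : ℝ)) ^ (T.drift i + 1) := by
  have hl := child_len hc
  have hc' : T.path i = T.path j ++ [s] := hc
  unfold wgt
  have hiff : ∀ l, T.path l <+: T.path i ↔ l = i ∨ T.path l <+: T.path j := by
    intro l
    rw [hc', List.prefix_concat_iff, ← hc']
    exact or_congr ⟨fun e => T.inj e, fun e => by rw [e]⟩ Iff.rfl
  have hnot : ¬ T.path i <+: T.path j := fun h => by have := h.length_le; omega
  by_cases hi : i ∈ μ
  · rw [if_pos hi, add_zero]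
    apply Finset.sum_congr _ (fun _ _ => rfl)
    ext l
    simp only [Finset.mem_filter, Finset.mem_univ, true_and, hiff]
    constructor
    · rintro ⟨rfl | h, h2⟩
      · exact absurd hi h2
      · exact ⟨h, h2⟩
    · rintro ⟨h, h2⟩; exact ⟨Or.inr h, h2⟩
  · rw [if_neg hi]
    have : Finset.univ.filter (fun l => T.path l <+: T.path i ∧ l ∉ μ) =
        insert i (Finset.univ.filter (fun l => T.path l <+: T.path j ∧ l ∉ μ)) := by
      ext l
      simp only [Finset.mem_filter, Finset.mem_univ, true_and, hiff, Finset.mem_insert]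
      constructor
      · rintro ⟨rfl | h, h2⟩
        · exact Or.inl rfl
        · exact Or.inr ⟨h, h2⟩
      · rintro (rfl | ⟨h, h2⟩)
        · exact ⟨Or.inl rfl, hi⟩
        · exact ⟨Or.inr h, h2⟩
    rw [this, Finset.sum_insert (by simp [hnot])]
    ring

lemma prefix_drift {p : List ℕ} {k : Fin n} (h : p <+: T.path k) : p.sum ≤ T.drift k := by
  obtain ⟨q, hq⟩ := h
  unfold Tree.drift
  rw [← hq]
  simp

/-- strict comparison of two branches -/
lemma wgt_branch (hμ : IsMarking T μ) {a k l : Fin n} {e f : ℕ} (hef : f < e)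
    (hk : T.path a ++ [e] <+: T.path k) (hl : T.path a ++ [f] <+: T.path l) :
    wgt T μ k < wgt T μ l := by
  obtain ⟨b, hb⟩ := prefix_node T _ k _ rfl hk
  obtain ⟨c, hc⟩ := prefix_node T _ l _ rfl hl
  have hcμ : c ∉ μ := by
    intro h
    obtain ⟨j, s, hcad, _⟩ := hμ c h
    obtain ⟨rfl, rfl⟩ := child_unique hcad.1 hc
    exact hcad.2 e hef (child_le (T := T) (i := b) (j := j) hb) ⟨b, hb⟩
  have h1 : wgt T μ a + (1 / (2 * (n + 1) : ℝ)) ^ (T.drift c + 1) ≤ wgt T μ l := by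
    have h2 := wgt_child T μ (i := c) (j := a) (s := f) hc
    rw [if_neg hcμ] at h2
    rw [← h2]
    exact wgt_mono T μ (by rw [hc]; exact hl)
  have hdb : T.drift c + 1 ≤ T.drift b := by
    rw [child_drift (T := T) (i := b) (j := a) hb, child_drift (T := T) (i := c) (j := a) hc]
    omega
  have h3 : wgt T μ k ≤ wgt T μ a + n * (1 / (2 * (n + 1) : ℝ)) ^ (T.drift b + 1) := by
    unfold wgt
    have hsub : Finset.univ.filter (fun l => T.path l <+: T.path k ∧ l ∉ μ) ⊆
        Finset.univ.filter (fun l => T.path l <+: T.path a ∧ l ∉ μ) ∪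
        Finset.univ.filter (fun l => T.path b <+: T.path l) := by
      intro l hl
      simp only [Finset.mem_filter, Finset.mem_univ, true_and, Finset.mem_union] at hl ⊢
      rw [← hb] at hk
      rcases List.prefix_or_prefix_of_prefix hl.1 hk with h | h
      · rw [hb, List.prefix_concat_iff, ← hb] at h
        rcases h with h | h
        · right; rw [h]
        · exact Or.inl ⟨h, hl.2⟩
      · exact Or.inr h
    calc _ ≤ _ := Finset.sum_le_sum_of_subset_of_nonneg hsub (fun _ _ _ => pow_nonneg (eps_pos).le _)
      _ ≤ _ := by
        have hui := Finset.sum_union_inter (s₁ := Finset.univ.filter (fun l => T.path l <+: T.path a ∧ l ∉ μ)) (s₂ := Finset.univ.filter (fun l => T.path b <+: T.path l)) (f := fun l => (1 / (2 * (n + 1) : ℝ)) ^ (T.drift l + 1))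
        have hnn : 0 ≤ ∑ l ∈ Finset.univ.filter (fun l => T.path l <+: T.path a ∧ l ∉ μ) ∩ Finset.univ.filter (fun l => T.path b <+: T.path l), (1 / (2 * (n + 1) : ℝ)) ^ (T.drift l + 1) :=
          Finset.sum_nonneg (fun _ _ => pow_nonneg (eps_pos).le _)
        exact (le_add_of_nonneg_right hnn).trans hui.le
      _ ≤ _ := by
        apply add_le_add le_rfl
        calc _ ≤ ∑ l ∈ Finset.univ.filter (fun l => T.path b <+: T.path l),
              (1 / (2 * (n + 1) : ℝ)) ^ (T.drift b + 1) := by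
              apply Finset.sum_le_sum
              intro l hl
              simp only [Finset.mem_filter, Finset.mem_univ, true_and] at hl
              apply pow_le_pow_of_le_one eps_pos.le eps_le
              have := prefix_drift T hl
              unfold Tree.drift at this ⊢
              omega
          _ ≤ _ := by
            rw [Finset.sum_const, nsmul_eq_mul]
            apply mul_le_mul_of_nonneg_right _ (pow_nonneg (eps_pos).le _)
            exact_mod_cast (Finset.card_le_univ _).trans (by simp)
  have h4 : (n : ℝ) * (1 / (2 * (n + 1) : ℝ)) ^ (T.drift b + 1) < (1 / (2 * (n + 1) : ℝ)) ^ (T.drift c + 1) := by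
    calc (n : ℝ) * (1 / (2 * (n + 1) : ℝ)) ^ (T.drift b + 1) =
          (n * (1 / (2 * (n + 1) : ℝ))) * (1 / (2 * (n + 1) : ℝ)) ^ T.drift b := by ring
      _ < 1 * (1 / (2 * (n + 1) : ℝ)) ^ T.drift b :=
          mul_lt_mul_of_pos_right n_eps (pow_pos eps_pos _)
      _ ≤ _ := by
        rw [one_mul]
        exact pow_le_pow_of_le_one eps_pos.le eps_le hdb
  linarith

/-- R2 -/
lemma rep_exists_pt (hμ : IsMarking T μ) : ∃ x, Rep x T μ := by
  set x : Fin n → ℝ := fun i => T.drift i + wgt T μ i with hx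
  have hchild : ∀ i j s, T.IsChild i j s → K x j s < K x i 0 ∧ (i ∈ μ ↔ x i = x j + s) := by
    intro i j s hc
    have h1 := wgt_child T μ hc
    have h2 := child_drift hc
    have hxi : x i = x j + s + if i ∈ μ then 0 else (1 / (2 * (n + 1) : ℝ)) ^ (T.drift i + 1) := by
      simp only [hx]
      rw [h1]
      have : (T.drift i : ℝ) = T.drift j + s := by exact_mod_cast h2
      rw [this]; ring
    by_cases hi : i ∈ μ
    · rw [if_pos hi, add_zero] at hxi
      refine ⟨?_, by simp [hi, hxi]⟩
      rw [K_lt]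
      right
      refine ⟨by rw [hxi]; simp, ?_⟩
      rcases Nat.eq_zero_or_pos s with rfl | hs
      · right
        refine ⟨by rw [hxi]; simp, ?_⟩
        obtain ⟨j', s', hcad, hlt⟩ := hμ i hi
        obtain ⟨rfl, rfl⟩ := child_unique hc hcad.1
        exact hlt rfl
      · left
        have : (0 : ℝ) < s := by exact_mod_cast hs
        linarith
    · rw [if_neg hi] at hxi
      have hp : 0 < (1 / (2 * (n + 1) : ℝ)) ^ (T.drift i + 1) := pow_pos eps_pos _
      refine ⟨?_, ?_⟩
      · rw [K_lt]; left; simp only [Nat.cast_zero, add_zero]; linarith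
      · simp only [hi, false_iff]; intro h; linarith
  have hpre : ∀ N, ∀ a b, (T.path b).length = N → T.path a <+: T.path b → K x a 0 ≤ K x b 0 := by
    intro N
    induction N using Nat.strong_induction_on with
    | _ N ih =>
      intro a b hN hab
      rcases path_nil_or T b with h0 | ⟨j, s, hc⟩
      · rw [h0, List.prefix_nil, ← h0] at hab
        rw [T.inj hab]
      · have hc' : T.path b = T.path j ++ [s] := hc
        have hlen := child_len hc
        rw [hc', List.prefix_concat_iff, ← hc'] at hab
        rcases hab with h | h
        · rw [T.inj h]
        · exact (ih _ (by omega) a j rfl h).trans ((K_mono (Nat.zero_le _)).trans (hchild b j s hc).1.le)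
  have hsum : ∀ (k : Fin n) (t : ℕ), x k + (t : ℝ) = ((T.path k ++ [t]).sum : ℕ) + wgt T μ k := by
    intro k t
    have : (T.path k ++ [t]).sum = T.drift k + t := by simp [Tree.drift]
    rw [this]; push_cast; simp only [hx]; ring
  have hxs : ∀ k, x k = ((T.path k).sum : ℕ) + wgt T μ k := fun k => rfl
  refine ⟨x, ?_, ?_⟩
  · intro r hr k t ht
    exact (hpre _ r k rfl (by rw [hr]; exact List.nil_prefix)).trans (K_mono (Nat.zero_le _))
  · intro i j s hc
    refine ⟨(hchild i j s hc).1, ?_, (hchild i j s hc).2⟩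
    intro k t ht
    have hc' : T.path i = T.path j ++ [s] := hc
    have hiw := wgt_nonneg T μ i
    have hjw := wgt_nonneg T μ j
    have hkw := wgt_nonneg T μ k
    have hiw' := wgt_lt T μ i
    have hjw' := wgt_lt T μ j
    have hkw' := wgt_lt T μ k
    rcases lt_trichotomy (T.path k ++ [t]).sum (T.path i).sum with hs | hs | hs
    · left
      apply le_of_lt
      rw [K_lt]
      left
      rw [hsum, hsum, ← hc']
      have : ((T.path k ++ [t]).sum : ℝ) + 1 ≤ ((T.path i).sum : ℕ) := by exact_mod_cast hs
      linarith
    · rcases list_tri (T.path i) (T.path k ++ [t]) with h | h | ⟨r, e, f, p, q, hef, hP, hQ⟩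
      · rw [List.prefix_concat_iff] at h
        rcases h with h | h
        · rw [hc'] at h
          have e := List.append_inj' h rfl
          have e1 := T.inj e.1
          have e2 : s = t := by simpa using e.2
          left; rw [e1, e2]
        · right
          exact (hpre _ i k rfl h).trans (K_mono (Nat.zero_le _))
      · left
        by_cases he : T.path k ++ [t] = T.path i
        · rw [hc'] at he
          have e := List.append_inj' he rfl
          have e1 := T.inj e.1
          have e2 : t = s := by simpa using e.2
          rw [e1, e2]
        · rw [hc', List.prefix_concat_iff, ← hc'] at h
          have h := h.resolve_left he
          obtain ⟨c, hcc⟩ := prefix_node T _ j _ rfl h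
          exact (hchild c k t hcc).1.le.trans
            ((hpre _ c j rfl (by rw [hcc]; exact h)).trans (K_mono (Nat.zero_le _)))
      · obtain ⟨a, ha⟩ := prefix_node T _ i r rfl (by rw [hP]; exact List.prefix_append _ _)
        subst ha
        have hPe : T.path a ++ [e] <+: T.path i := ⟨p, by rw [hP]; simp⟩
        have hQf : T.path a ++ [f] <+: T.path k ++ [t] := ⟨q, by rw [hQ]; simp⟩
        rcases lt_or_gt_of_ne hef with hlt | hlt
        · -- the mark `(k,t)` comes first
          left
          have hpn : T.path a ++ [e] <+: T.path j := by
            rw [hc', List.prefix_concat_iff] at hPe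
            rcases hPe with h | h
            · exfalso
              have e0 := List.append_inj' h rfl
              rw [← hc'] at h
              rw [← h, hQ] at hs
              simp at hs
              omega
            · exact h
          rw [List.prefix_concat_iff] at hQf
          apply le_of_lt
          rcases hQf with h | h
          · have e0 := List.append_inj' h rfl
            have e1 := T.inj e0.1
            have e2 : f = t := by simpa using e0.2
            subst e1 e2
            have hpre' : T.path a <+: T.path j := (List.prefix_append _ _).trans hpn
            have hk1 : K x a 0 < K x j 0 := by
              apply lt_of_le_of_ne (hpre _ a j rfl hpre')
              intro he
              have := (K_inj he).1
              subst this
              have := hpn.length_le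
              simp at this
            have hw := wgt_mono T μ hpre'
            rw [K_lt] at hk1 ⊢
            have hval : x a + (f : ℝ) ≤ x j + (s : ℝ) := by
              rw [hsum, hsum, hs, ← hc']; linarith
            rcases hval.lt_or_eq with h5 | h5
            · exact Or.inl h5
            · right
              refine ⟨h5, ?_⟩
              rcases hk1 with h6 | h6
              · left; simpa using h6
              · exact h6.2
          · rw [K_lt]
            left
            rw [hsum, hsum, hs, ← hc']
            have := wgt_branch T μ hμ hlt h hpn
            linarith
        · right
          have hqn : T.path a ++ [f] <+: T.path k := by
            rw [List.prefix_concat_iff] at hQf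
            rcases hQf with h | h
            · exfalso
              rw [← h, hP] at hs
              simp at hs
              omega
            · exact h
          apply le_of_lt
          rw [K_lt]
          left
          rw [hsum k t, hs]
          simp only [Nat.cast_zero, add_zero]
          rw [hxs i]
          have := wgt_branch T μ hμ hlt hPe hqn
          linarith
    · right
      apply le_of_lt
      rw [K_lt]
      left
      rw [hsum k t]
      simp only [Nat.cast_zero, add_zero]
      rw [hxs i]
      have : ((T.path i).sum : ℝ) + 1 ≤ ((T.path k ++ [t]).sum : ℕ) := by exact_mod_cast hs
      linarith
end

end catalan2


/-! ### Face counting by marked trees -/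

section faces
variable {m n : ℕ}

noncomputable def ptOf (p : Tree m n × Set (Fin n)) : Fin n → ℝ :=
  if h : IsMarking p.1 p.2 then (rep_exists_pt p.1 p.2 h).choose else 0

lemma ptOf_rep (p : Tree m n × Set (Fin n)) (h : IsMarking p.1 p.2) : Rep (ptOf p) p.1 p.2 := by
  unfold ptOf
  rw [dif_pos h]
  exact (rep_exists_pt p.1 p.2 h).choose_spec

noncomputable def Hc (m n : ℕ) : Finset (Trip n) := HS (Finset.Icc (-(m : ℤ)) m) n

lemma ptOf_inj : Set.InjOn (fun p : Tree m n × Set (Fin n) => pat (Hc m n) (ptOf p)) (OTall m n) := by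
  intro p hp q hq h
  obtain ⟨h1, h2⟩ := pat_order (m := m) h
  obtain ⟨h3, h4⟩ := rep_unique hp hq (ptOf_rep p hp) (ptOf_rep q hq) h1 h2
  exact Prod.ext h3 h4

lemma otall_finite : (OTall m n).Finite := by
  apply Set.Finite.of_finite_image _ ptOf_inj
  apply (pats (Hc m n)).finite_toSet.subset
  rintro _ ⟨p, -, rfl⟩
  exact mem_pats.2 ⟨_, rfl⟩

instance tree_finite : Finite (Tree m n) := by
  have := (otall_finite (m := m) (n := n)).to_subtype
  apply Finite.of_injective (β := OTall m n) (fun T : Tree m n => ⟨(T, ∅), by intro i hi; exact hi.elim⟩)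
  intro T T' h
  exact congrArg (fun z => z.1.1) h

noncomputable instance tree_fintype : Fintype (Tree m n) := Fintype.ofFinite _

noncomputable def Mk (T : Tree m n) : Finset (Fin n) := Finset.univ.filter fun i => IsMkb T i

lemma isMarking_iff (T : Tree m n) (μ : Finset (Fin n)) :
    IsMarking T (μ : Set (Fin n)) ↔ μ ∈ (Mk T).powerset := by
  rw [Finset.mem_powerset]
  constructor
  · intro h i hi
    exact Finset.mem_filter.2 ⟨Finset.mem_univ _, h i hi⟩
  · intro h i hi
    exact (Finset.mem_filter.1 (h hi)).2

lemma nu_cat {T : Tree m n} {μ : Set (Fin n)} (hμ : IsMarking T μ) :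
    nu (↑(Finset.Icc (-(m : ℤ)) m)) T μ = μ := by
  ext i
  constructor
  · exact fun h => h.1
  · intro hi
    refine ⟨hi, ?_⟩
    obtain ⟨j, s, hc, -⟩ := hμ i hi
    refine ⟨j, s, hc.1, j, i, .refl, .refl, ?_⟩
    have h1 := child_drift hc.1
    have h2 := child_le hc.1
    simp only [Finset.coe_Icc, Set.mem_Icc]
    omega

lemma face_sum_trees {S : Set ℤ} (hfin : S.Finite)
    (hsym : ∀ s : ℤ, s ∈ S ↔ -s ∈ S)
    (hclosed : ∀ s t : ℕ, (s : ℤ) ∉ S → (t : ℤ) ∉ S → ((s : ℤ) + (t : ℤ)) ∉ S)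
    (hmax : ∀ s ∈ S, s ≤ (m : ℤ)) :
    ∑ k ∈ Finset.range (n + 1), (faceCount S n k : ℚ) • (Polynomial.X : Polynomial ℚ) ^ k =
      ∑ᶠ p ∈ OTset m n (arrS S n), (Polynomial.X : Polynomial ℚ) ^ (blocksOf p.1 p.2).ncard := by
  have hSf : ∀ s, s ∈ hfin.toFinset ↔ s ∈ S := by simp
  have hsub : hfin.toFinset ⊆ Finset.Icc (-(m : ℤ)) m := by
    intro s hs
    rw [hSf] at hs
    have h1 := hmax s hs
    have h2 := hmax (-s) ((hsym s).1 hs)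
    rw [Finset.mem_Icc]; constructor <;> linarith
  rw [face_sum_cat hSf hsym m hmax n]
  have hHsub : HS hfin.toFinset n ⊆ Hc m n := by
    rintro ⟨i, j, s⟩ h
    simp only [Hc, HS, Finset.mem_product, Finset.mem_univ, true_and] at h ⊢
    exact hsub h
  have hcoe : (↑hfin.toFinset : Set ℤ) = S := by simp
  have key : ∀ T : Tree m n, ∀ μ : Finset (Fin n), IsMarking T (μ : Set (Fin n)) →
      comp (pat (Hc m n) (ptOf (T, (μ : Set (Fin n))))) = n - (μ : Set (Fin n)).ncard ∧
      comp (res (HS hfin.toFinset n) (pat (Hc m n) (ptOf (T, (μ : Set (Fin n)))))) =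
        n - (nu S T (μ : Set (Fin n))).ncard := by
    intro T μ hμ
    have hr := ptOf_rep (T, (μ : Set (Fin n))) hμ
    constructor
    · unfold comp Hc
      rw [rep_zrel hr _ (Finset.Subset.refl _), srel_quot_card _ _ hμ, nu_cat hμ]
      · intro s; simp only [Finset.coe_Icc, Set.mem_Icc]; omega
      · intro s t; simp only [Finset.coe_Icc, Set.mem_Icc]; omega
    · rw [res_pat hHsub]
      unfold comp
      rw [rep_zrel hr _ hsub, hcoe, srel_quot_card hsym hclosed hμ]
  have e1 : ∑ σ ∈ pats (HS (Finset.Icc (-(m : ℤ)) m) n), (-1 : Polynomial ℚ) ^ comp σ *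
      (-Polynomial.X) ^ comp (res (HS hfin.toFinset n) σ) =
      ∑ p ∈ (Finset.univ : Finset (Tree m n)).sigma (fun T => (Mk T).powerset),
        (-1 : Polynomial ℚ) ^ (n - ((p.2 : Finset (Fin n)) : Set (Fin n)).ncard) *
        (-Polynomial.X) ^ (n - (nu S p.1 ((p.2 : Finset (Fin n)) : Set (Fin n))).ncard) := by
    symm
    refine Finset.sum_bij (fun p _ => pat (Hc m n) (ptOf (p.1, (p.2 : Set (Fin n))))) ?_ ?_ ?_ ?_
    · intro p hp
      exact mem_pats.2 ⟨_, rfl⟩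
    · rintro ⟨T, μ⟩ hp ⟨T', μ'⟩ hq h
      simp only [Finset.mem_sigma, Finset.mem_univ, true_and, ← isMarking_iff] at hp hq
      have := ptOf_inj (m := m) (n := n) (show (T, (μ : Set (Fin n))) ∈ OTall m n from hp)
        (show (T', (μ' : Set (Fin n))) ∈ OTall m n from hq) h
      simp only [Prod.mk.injEq, Finset.coe_inj] at this
      obtain ⟨rfl, rfl⟩ := this
      rfl
    · intro σ hσ
      obtain ⟨x, rfl⟩ := mem_pats.1 hσ
      obtain ⟨T, μ, hμ, hr⟩ := rep_exists_tree m x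
      have hc : ((μ.toFinset : Finset (Fin n)) : Set (Fin n)) = μ := by simp
      refine ⟨⟨T, μ.toFinset⟩, ?_, ?_⟩
      · simp only [Finset.mem_sigma, Finset.mem_univ, true_and, ← isMarking_iff]
        rwa [hc]
      · simp only [hc]
        exact rep_pat (ptOf_rep (T, μ) hμ) hr
    · rintro ⟨T, μ⟩ hp
      simp only [Finset.mem_sigma, Finset.mem_univ, true_and, ← isMarking_iff] at hp
      obtain ⟨h1, h2⟩ := key T μ hp
      simp only [h1, h2]
  rw [e1, Finset.sum_sigma]
  simp only [fixed_tree_sum hclosed]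
  rw [← Finset.sum_sigma (s := (Finset.univ : Finset (Tree m n)))
    (t := fun T => (Mk T).powerset.filter (fun μ : Finset (Fin n) => ∀ i ∈ Mk T, lnkP S T (μ : Set (Fin n)) i))
    (f := fun p => (Polynomial.X : Polynomial ℚ) ^ (n - ((p.2 : Finset (Fin n)) : Set (Fin n)).ncard))]
  have hOf : (OTset m n (arrS S n)).Finite := otall_finite.subset (fun p hp => hp.1)
  rw [finsum_mem_eq_finite_toFinset_sum _ hOf]
  refine Finset.sum_bij (fun p _ => (p.1, (p.2 : Set (Fin n)))) ?_ ?_ ?_ ?_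
  · rintro ⟨T, μ⟩ hp
    simp only [Finset.mem_sigma, Finset.mem_univ, true_and, Finset.mem_filter, ← isMarking_iff] at hp
    rw [Set.Finite.mem_toFinset]
    refine ⟨hp.1, (otset_iff hsym hclosed hp.1).2 fun i hi => hp.2 i (by simp [Mk, hi])⟩
  · rintro ⟨T, μ⟩ hp ⟨T', μ'⟩ hq h
    simp only [Prod.mk.injEq, Finset.coe_inj] at h
    obtain ⟨rfl, rfl⟩ := h
    rfl
  · rintro ⟨T, μ⟩ hp
    rw [Set.Finite.mem_toFinset] at hp
    have hc : ((μ.toFinset : Finset (Fin n)) : Set (Fin n)) = μ := by simp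
    refine ⟨⟨T, μ.toFinset⟩, ?_, by simp⟩
    simp only [Finset.mem_sigma, Finset.mem_univ, true_and, Finset.mem_filter, ← isMarking_iff]
    rw [hc]
    refine ⟨hp.1, fun i hi => (otset_iff hsym hclosed hp.1).1 hp.2 i ?_⟩
    simpa [Mk] using hi
  · rintro ⟨T, μ⟩ hp
    simp only [Finset.mem_sigma, Finset.mem_univ, true_and, Finset.mem_filter, ← isMarking_iff] at hp
    simp only [blocks_ncard hp.1]

/-- Sum of `u^#blocks` over `ŌT_m^n(A_S^n)`. -/
noncomputable def otsum (S : Set ℤ) (m n : ℕ) : Polynomial ℚ :=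
  ∑ᶠ p ∈ OTset m n (arrS S n), (Polynomial.X : Polynomial ℚ) ^ (blocksOf p.1 p.2).ncard

end faces


/-! ### Labelled recursive trees and exponential generating functions -/

abbrev RR := Polynomial ℚ

/-- Recursive marked `(m+1)`-ary trees; the flag says that the edge to the cadet is marked. -/
inductive MT (m : ℕ) : Type
  | leaf : MT m
  | node (a : ℕ) (mk : Bool) (ch : Fin (m + 1) → MT m) : MT m

section MTsec
variable {m : ℕ}

def MT.lab : MT m → Multiset ℕ
  | .leaf => 0
  | .node a _ ch => a ::ₘ ∑ c, (ch c).lab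

def MT.map (f : ℕ → ℕ) : MT m → MT m
  | .leaf => .leaf
  | .node a mk ch => .node (f a) mk (fun c => (ch c).map f)

def MT.rt : MT m → ℕ
  | .leaf => 0
  | .node a _ _ => a

lemma MT.lab_map (f : ℕ → ℕ) (t : MT m) : (t.map f).lab = t.lab.map f := by
  induction t with
  | leaf => rfl
  | node a mk ch ih =>
    simp only [MT.map, MT.lab, Multiset.map_cons, ih]
    congr 1
    exact (map_sum (Multiset.mapAddMonoidHom f) (fun c => (ch c).lab) Finset.univ).symm

lemma MT.lab_eq_zero {t : MT m} : t.lab = 0 ↔ t = .leaf := by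
  cases t with
  | leaf => simp [MT.lab]
  | node a mk ch => simp [MT.lab]

lemma MT.map_inj {f : ℕ → ℕ} (hf : Function.Injective f) : Function.Injective (MT.map (m := m) f) := by
  intro t
  induction t with
  | leaf =>
    intro t' h
    cases t' with
    | leaf => rfl
    | node a mk ch => simp [MT.map] at h
  | node a mk ch ih =>
    intro t' h
    cases t' with
    | leaf => simp [MT.map] at h
    | node a' mk' ch' =>
      simp only [MT.map, MT.node.injEq] at h
      obtain ⟨h1, h2, h3⟩ := h
      rw [hf h1, h2]
      congr 1
      funext c
      exact ih c (congrFun h3 c)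

lemma MT.exists_map {f : ℕ → ℕ} (t : MT m) (h : ∀ a ∈ t.lab, a ∈ Set.range f) :
    ∃ t', MT.map f t' = t := by
  induction t with
  | leaf => exact ⟨.leaf, rfl⟩
  | node a mk ch ih =>
    have h1 : ∀ c, ∃ t', MT.map f t' = ch c := by
      intro c
      apply ih
      intro b hb
      apply h
      simp only [MT.lab, Multiset.mem_cons]
      right
      rw [Multiset.mem_sum]
      exact ⟨c, Finset.mem_univ _, hb⟩
    choose g hg using h1
    obtain ⟨b, hb⟩ := h a (by simp [MT.lab])
    refine ⟨.node b mk g, ?_⟩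
    simp only [MT.map, hb, hg]

lemma lab_finite_aux (N : ℕ) : ∀ s : Multiset ℕ, s.card ≤ N → {t : MT m | t.lab = s}.Finite := by
  induction N with
  | zero =>
    intro s hs
    have : s = 0 := by simpa using hs
    subst this
    simp only [MT.lab_eq_zero]
    exact Set.finite_singleton _
  | succ N ih =>
    intro s hs
    have hfin : ∀ a ∈ s, {t : MT m | t.lab ≤ s.erase a}.Finite := by
      intro a ha
      have : {t : MT m | t.lab ≤ s.erase a} ⊆ ⋃ s' ∈ (s.erase a).powerset.toFinset, {t : MT m | t.lab = s'} := by
        intro t ht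
        simp only [Set.mem_iUnion, Multiset.mem_toFinset, Multiset.mem_powerset, exists_prop]
        exact ⟨t.lab, ht, rfl⟩
      apply Set.Finite.subset _ this
      apply Set.Finite.biUnion (Finset.finite_toSet _)
      intro s' hs'
      apply ih
      simp only [Finset.mem_coe, Multiset.mem_toFinset, Multiset.mem_powerset] at hs'
      have h1 := Multiset.card_le_card hs'
      have h2 := Multiset.card_erase_of_mem ha
      have h3 : 0 < s.card := Multiset.card_pos_iff_exists_mem.2 ⟨a, ha⟩
      have h4 : (s.erase a).card = s.card - 1 := by rw [h2]; rfl
      omega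
    have : {t : MT m | t.lab = s} ⊆ {MT.leaf} ∪ ⋃ a ∈ s.toFinset,
        ⋃ mk ∈ (Set.univ : Set Bool), (fun ch => MT.node a mk ch) ''
          (Set.pi Set.univ (fun _ : Fin (m + 1) => {t : MT m | t.lab ≤ s.erase a})) := by
      intro t ht
      cases t with
      | leaf => left; rfl
      | node a mk ch =>
        right
        have ht' : a ::ₘ ∑ c, (ch c).lab = s := ht
        simp only [Set.mem_iUnion]
        refine ⟨a, by simp [← ht'], mk, trivial, ch, ?_, rfl⟩
        intro c _
        show (ch c).lab ≤ s.erase a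
        rw [← ht', Multiset.erase_cons_head]
        exact Finset.single_le_sum (f := fun c => (ch c).lab) (fun _ _ => Multiset.zero_le _) (Finset.mem_univ c)
    apply Set.Finite.subset _ this
    apply (Set.finite_singleton _).union
    apply Set.Finite.biUnion (Finset.finite_toSet _)
    intro a ha
    apply Set.Finite.biUnion Set.finite_univ
    intro mk _
    apply Set.Finite.image
    apply Set.Finite.pi
    intro _
    exact hfin a (by simpa using ha)

lemma lab_finite (s : Multiset ℕ) : {t : MT m | t.lab = s}.Finite := lab_finite_aux _ s le_rfl

lemma lab_le_finite (s : Multiset ℕ) : {t : MT m | t.lab ≤ s}.Finite := by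
  have : {t : MT m | t.lab ≤ s} ⊆ ⋃ s' ∈ s.powerset.toFinset, {t : MT m | t.lab = s'} := by
    intro t ht
    simp only [Set.mem_iUnion, Multiset.mem_toFinset, Multiset.mem_powerset, exists_prop]
    exact ⟨t.lab, ht, rfl⟩
  exact Set.Finite.subset (Set.Finite.biUnion (Finset.finite_toSet _) (fun _ _ => lab_finite _)) this

lemma ch_finite (N : ℕ) (s : Multiset ℕ) : {ch : Fin N → MT m | ∑ c, (ch c).lab = s}.Finite := by
  apply Set.Finite.subset (Set.Finite.pi (fun _ : Fin N => lab_le_finite (m := m) s))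
  intro ch hch c _
  show (ch c).lab ≤ s
  rw [← (show ∑ c, (ch c).lab = s from hch)]
  exact Finset.single_le_sum (f := fun c => (ch c).lab) (fun _ _ => Multiset.zero_le _) (Finset.mem_univ c)

/-- trees with label set `A` -/
noncomputable def TS (m : ℕ) (A : Finset ℕ) : Finset (MT m) := (lab_finite (m := m) A.val).toFinset

noncomputable def CH (m N : ℕ) (A : Finset ℕ) : Finset (Fin N → MT m) := (ch_finite (m := m) N A.val).toFinset

lemma mem_TS {A : Finset ℕ} {t : MT m} : t ∈ TS m A ↔ t.lab = A.val := by simp [TS]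

lemma mem_CH {N : ℕ} {A : Finset ℕ} {ch : Fin N → MT m} : ch ∈ CH m N A ↔ ∑ c, (ch c).lab = A.val := by
  simp [CH]

noncomputable def cnt (g : MT m → RR) (A : Finset ℕ) : RR := ∑ t ∈ TS m A, g t

noncomputable def cntP {N : ℕ} (g : Fin N → MT m → RR) (A : Finset ℕ) : RR :=
  ∑ ch ∈ CH m N A, ∏ c, g c (ch c)

noncomputable def fr (F : MT m → RR) (A : Finset ℕ) (a : ℕ) : RR :=
  ∑ ch ∈ CH m (m + 1) (A.erase a), (F (.node a false ch) + F (.node a true ch))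

lemma cnt_eq_fr (F : MT m → RR) (A : Finset ℕ) :
    cnt F A = (if A = ∅ then F .leaf else 0) + ∑ a ∈ A, fr F A a := by
  have key : ∑ a ∈ A, fr F A a = ∑ p ∈ A.sigma (fun a => (Finset.univ : Finset Bool) ×ˢ CH m (m + 1) (A.erase a)),
      F (.node p.1 p.2.1 p.2.2) := by
    rw [Finset.sum_sigma]
    apply Finset.sum_congr rfl
    intro a ha
    rw [Finset.sum_product]
    simp [fr, Finset.sum_add_distrib, add_comm]
  by_cases hA : A = ∅
  · subst hA
    have : TS m ∅ = {MT.leaf} := by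
      ext t
      rw [mem_TS, Finset.mem_singleton, ← MT.lab_eq_zero]; rfl
    simp [cnt, this]
  · rw [if_neg hA, zero_add, key]
    symm
    refine Finset.sum_bij (fun p _ => MT.node p.1 p.2.1 p.2.2) ?_ ?_ ?_ ?_
    · rintro ⟨a, mk, ch⟩ h
      simp only [Finset.mem_sigma, Finset.mem_product, Finset.mem_univ, true_and, mem_CH] at h
      rw [mem_TS]
      simp only [MT.lab, h.2, Finset.erase_val]
      exact Multiset.cons_erase h.1
    · rintro ⟨a, mk, ch⟩ h ⟨a', mk', ch'⟩ h' e
      simp only [MT.node.injEq] at e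
      obtain ⟨rfl, rfl, rfl⟩ := e
      rfl
    · intro t ht
      rw [mem_TS] at ht
      cases t with
      | leaf => exact absurd (Finset.val_eq_zero.1 ht.symm) hA
      | node a mk ch =>
        have ht' : a ::ₘ ∑ c, (ch c).lab = A.val := ht
        refine ⟨⟨a, mk, ch⟩, ?_, rfl⟩
        simp only [Finset.mem_sigma, Finset.mem_product, Finset.mem_univ, true_and, mem_CH, Finset.erase_val]
        refine ⟨?_, ?_⟩
        · rw [← Finset.mem_val, ← ht']; simp
        · rw [← ht', Multiset.erase_cons_head]
    · intros; rfl

/-- binomial convolution -/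
noncomputable def cv (F G : Finset ℕ → RR) (A : Finset ℕ) : RR := ∑ B ∈ A.powerset, F B * G (A \ B)

lemma cntP_succ {N : ℕ} (g : Fin (N + 1) → MT m → RR) (A : Finset ℕ) :
    cntP g A = cv (cnt (g 0)) (cntP (fun c : Fin N => g c.succ)) A := by
  have key : cv (cnt (g 0)) (cntP (fun c : Fin N => g c.succ)) A =
      ∑ p ∈ A.powerset.sigma (fun B => TS m B ×ˢ CH m N (A \ B)), g 0 p.2.1 * ∏ c : Fin N, g c.succ (p.2.2 c) := by
    rw [Finset.sum_sigma]
    apply Finset.sum_congr rfl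
    intro B hB
    rw [Finset.sum_product, cnt, cntP, Finset.sum_mul_sum]
  rw [key]
  unfold cntP
  symm
  refine Finset.sum_bij (fun p _ => Fin.cons p.2.1 p.2.2) ?_ ?_ ?_ ?_
  · rintro ⟨B, t, ch⟩ h
    simp only [Finset.mem_sigma, Finset.mem_product, Finset.mem_powerset, mem_TS, mem_CH] at h ⊢
    rw [Fin.sum_univ_succ]
    simp only [Fin.cons_zero, Fin.cons_succ, h.2.1, h.2.2, Finset.sdiff_val]
    exact add_tsub_cancel_of_le (Finset.val_le_iff.2 h.1)
  · rintro ⟨B, t, ch⟩ h ⟨B', t', ch'⟩ h' e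
    simp only [Finset.mem_sigma, Finset.mem_product, Finset.mem_powerset, mem_TS, mem_CH] at h h'
    have e' : (Fin.cons t ch : Fin (N + 1) → MT m) = Fin.cons t' ch' := e
    have e1 := congrFun e' 0
    simp only [Fin.cons_zero] at e1
    have e2 : ch = ch' := by
      funext c
      have := congrFun e' c.succ
      simpa using this
    subst e1 e2
    have : B = B' := Finset.val_injective (h.2.1.symm.trans h'.2.1)
    subst this
    rfl
  · intro ch hch
    rw [mem_CH, Fin.sum_univ_succ] at hch
    have hnd : (ch 0).lab.Nodup := by
      apply Multiset.nodup_of_le _ A.nodup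
      rw [← hch]; exact Multiset.le_add_right _ _
    refine ⟨⟨⟨(ch 0).lab, hnd⟩, ch 0, fun c => ch c.succ⟩, ?_, ?_⟩
    · simp only [Finset.mem_sigma, Finset.mem_product, Finset.mem_powerset, mem_TS, mem_CH]
      refine ⟨?_, trivial, ?_⟩
      · rw [← Finset.val_le_iff, ← hch]; exact Multiset.le_add_right _ _
      · rw [Finset.sdiff_val, ← hch]
        simp
    · funext c
      refine Fin.cases ?_ (fun c => ?_) c <;> simp
  · rintro ⟨B, t, ch⟩ h
    rw [Fin.prod_univ_succ]
    simp

lemma cntP_zero (g : Fin 0 → MT m → RR) (A : Finset ℕ) : cntP g A = if A = ∅ then 1 else 0 := by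
  unfold cntP
  by_cases hA : A = ∅
  · subst hA
    have : CH m 0 ∅ = Finset.univ := by
      ext ch
      simp only [mem_CH, Finset.univ_eq_empty, Finset.sum_empty, Finset.mem_univ, iff_true]; rfl
    simp [this]
  · have : CH m 0 A = ∅ := by
      ext ch; simp only [mem_CH, Finset.univ_eq_empty, Finset.sum_empty, Finset.notMem_empty, iff_false]
      intro h; exact hA (Finset.val_eq_zero.1 h.symm)
    simp [this, hA]

/-! invariance -/

def Inv (F : Finset ℕ → RR) : Prop := ∀ A, F A = F (Finset.range A.card)

lemma Inv.congr {F : Finset ℕ → RR} (h : Inv F) {A B : Finset ℕ} (hc : A.card = B.card) : F A = F B := by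
  rw [h A, h B, hc]

lemma exists_strictMono (A : Finset ℕ) : ∃ f : ℕ → ℕ, StrictMono f ∧ (Finset.range A.card).image f = A := by
  set p : ℕ → Prop := fun x => x ∈ A ∨ A.sup id < x with hp
  have hinf : (Set.ofPred p).Infinite := by
    apply Set.infinite_of_not_bddAbove
    rintro ⟨b, hb⟩
    have := hb (show p (max b (A.sup id) + 1) from Or.inr (by have := le_max_right b (A.sup id); omega))
    have := le_max_left b (A.sup id)
    omega
  have hsm := Nat.nth_strictMono hinf
  refine ⟨Nat.nth p, hsm, ?_⟩
  have hsub : A ⊆ (Finset.range A.card).image (Nat.nth p) := by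
    intro a ha
    rw [Finset.mem_image]
    refine ⟨Nat.count p a, ?_, Nat.nth_count (Or.inl ha)⟩
    rw [Finset.mem_range, Nat.count_eq_card_filter_range]
    apply Finset.card_lt_card
    rw [Finset.ssubset_iff_of_subset]
    · exact ⟨a, ha, by simp⟩
    · intro b hb
      simp only [Finset.mem_filter, Finset.mem_range] at hb
      rcases hb.2 with h | h
      · exact h
      · have : a ≤ A.sup id := Finset.le_sup (f := id) ha
        omega
  symm
  apply Finset.eq_of_subset_of_card_le hsub
  exact Finset.card_image_le.trans (by simp)

def MInv (g : MT m → RR) : Prop := ∀ f : ℕ → ℕ, StrictMono f → ∀ t, g (t.map f) = g t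

lemma cnt_inv {g : MT m → RR} (hg : MInv g) : Inv (cnt g) := by
  intro A
  obtain ⟨f, hf, hA⟩ := exists_strictMono A
  unfold cnt
  symm
  have hv : A.val = (Finset.range A.card).val.map f := by
    conv_lhs => rw [← hA]
    exact Finset.image_val_of_injOn hf.injective.injOn
  refine Finset.sum_bij (fun t _ => t.map f) ?_ ?_ ?_ ?_
  · intro t ht
    rw [mem_TS] at ht ⊢
    rw [MT.lab_map, ht, hv]
  · intro t _ t' _ h
    exact MT.map_inj hf.injective h
  · intro t ht
    rw [mem_TS] at ht
    obtain ⟨t', rfl⟩ := MT.exists_map (f := f) t (by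
      intro a ha
      rw [ht, hv, Multiset.mem_map] at ha
      obtain ⟨b, _, hb⟩ := ha
      exact ⟨b, hb⟩)
    refine ⟨t', ?_, rfl⟩
    rw [mem_TS]
    rw [MT.lab_map, hv] at ht
    exact Multiset.map_injective hf.injective ht
  · intro t _
    exact (hg f hf t).symm

noncomputable def gf (F : Finset ℕ → RR) : PowerSeries RR :=
  PowerSeries.mk fun n => Polynomial.C ((n.factorial : ℚ)⁻¹) * F (Finset.range n)

lemma cv_eq {F G : Finset ℕ → RR} (hF : Inv F) (hG : Inv G) (A : Finset ℕ) :
    cv F G A = ∑ k ∈ Finset.range (A.card + 1), A.card.choose k • (F (Finset.range k) * G (Finset.range (A.card - k))) := by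
  rw [← Finset.sum_powerset_apply_card (fun k => F (Finset.range k) * G (Finset.range (A.card - k)))]
  apply Finset.sum_congr rfl
  intro B hB
  rw [Finset.mem_powerset] at hB
  rw [hF B, hG (A \ B), Finset.card_sdiff_of_subset hB]

lemma cv_inv {F G : Finset ℕ → RR} (hF : Inv F) (hG : Inv G) : Inv (cv F G) := by
  intro A
  rw [cv_eq hF hG, cv_eq hF hG, Finset.card_range]

lemma gf_cv {F G : Finset ℕ → RR} (hF : Inv F) (hG : Inv G) : gf (cv F G) = gf F * gf G := by
  ext1 n
  rw [PowerSeries.coeff_mul, gf, PowerSeries.coeff_mk, cv_eq hF hG, Finset.card_range,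
    Finset.Nat.sum_antidiagonal_eq_sum_range_succ_mk, Finset.mul_sum]
  apply Finset.sum_congr rfl
  intro k hk
  rw [Finset.mem_range] at hk
  simp only [gf, PowerSeries.coeff_mk]
  rw [nsmul_eq_mul]
  have : (Polynomial.C ((n.factorial : ℚ)⁻¹) * (n.choose k : RR)) =
      Polynomial.C ((k.factorial : ℚ)⁻¹) * Polynomial.C (((n - k).factorial : ℚ)⁻¹) := by
    rw [← Polynomial.C_mul, show (n.choose k : RR) = Polynomial.C (n.choose k : ℚ) by simp, ← Polynomial.C_mul]
    congr 1
    rw [Nat.cast_choose ℚ (by omega)]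
    have h1 := Nat.factorial_ne_zero n
    have h2 := Nat.factorial_ne_zero k
    have h3 := Nat.factorial_ne_zero (n - k)
    field_simp
  calc _ = (Polynomial.C ((n.factorial : ℚ)⁻¹) * (n.choose k : RR)) * (F (Finset.range k) * G (Finset.range (n - k))) := by ring
    _ = _ := by rw [this]; ring

lemma gf_add (F G : Finset ℕ → RR) : gf (fun A => F A + G A) = gf F + gf G := by
  ext1 n; simp only [gf, PowerSeries.coeff_mk, map_add]; ring

lemma gf_sum {ι : Type*} (s : Finset ι) (F : ι → Finset ℕ → RR) :
    gf (fun A => ∑ i ∈ s, F i A) = ∑ i ∈ s, gf (F i) := by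
  ext1 n; simp only [gf, PowerSeries.coeff_mk, map_sum, Finset.mul_sum]

lemma gf_smul (c : RR) (F : Finset ℕ → RR) : gf (fun A => c * F A) = PowerSeries.C c * gf F := by
  ext1 n; simp only [gf, PowerSeries.coeff_mk, PowerSeries.coeff_C_mul]; ring

lemma gf_delta : gf (fun A => if A = ∅ then 1 else 0) = 1 := by
  ext1 n
  simp only [gf, PowerSeries.coeff_mk, PowerSeries.coeff_one, Finset.range_eq_empty_iff]
  split_ifs with h
  · subst h; simp
  · simp

lemma inv_delta : Inv (fun A => if A = ∅ then (1 : RR) else 0) := by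
  intro A
  simp [Finset.range_eq_empty_iff]

lemma cntP_inv_gf {N : ℕ} (g : Fin N → MT m → RR) (hg : ∀ c, MInv (g c)) :
    Inv (cntP g) ∧ gf (cntP g) = ∏ c, gf (cnt (g c)) := by
  induction N with
  | zero =>
    have : cntP g = fun A => if A = ∅ then 1 else 0 := by funext A; exact cntP_zero g A
    rw [this]
    exact ⟨inv_delta, by rw [gf_delta]; simp⟩
  | succ N ih =>
    have : cntP g = cv (cnt (g 0)) (cntP (fun c : Fin N => g c.succ)) := by funext A; exact cntP_succ g A
    obtain ⟨h1, h2⟩ := ih (fun c : Fin N => g c.succ) (fun c => hg _)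
    rw [this]
    refine ⟨cv_inv (cnt_inv (hg 0)) h1, ?_⟩
    rw [gf_cv (cnt_inv (hg 0)) h1, h2, Fin.prod_univ_succ]

/-! the level lemma -/

lemma powerset_min (C : Finset ℕ) (g : Finset ℕ → RR) :
    ∑ B ∈ C.powerset, g B = g ∅ + ∑ a ∈ C, ∑ B ∈ (C.filter (a < ·)).powerset, g (insert a B) := by
  induction C using Finset.induction_on_min with
  | empty => simp
  | insert c C hc ih =>
    have hcC : c ∉ C := fun h => lt_irrefl _ (hc c h)
    rw [Finset.sum_powerset_insert hcC, Finset.sum_insert hcC, ih]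
    have e1 : (insert c C).filter (c < ·) = C := by
      ext x; simp only [Finset.mem_filter, Finset.mem_insert]
      constructor
      · rintro ⟨rfl | h, h'⟩
        · exact absurd h' (lt_irrefl _)
        · exact h
      · intro h; exact ⟨Or.inr h, hc x h⟩
    have e2 : ∀ a ∈ C, (insert c C).filter (a < ·) = C.filter (a < ·) := by
      intro a ha
      ext x; simp only [Finset.mem_filter, Finset.mem_insert]
      constructor
      · rintro ⟨rfl | h, h'⟩
        · exact absurd h' (not_lt.2 (hc a ha).le)
        · exact ⟨h, h'⟩
      · rintro ⟨h, h'⟩; exact ⟨Or.inr h, h'⟩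
    rw [e1]
    have e3 : ∑ a ∈ C, ∑ B ∈ ((insert c C).filter (a < ·)).powerset, g (insert a B) =
        ∑ a ∈ C, ∑ B ∈ (C.filter (a < ·)).powerset, g (insert a B) :=
      Finset.sum_congr rfl (fun a ha => by rw [e2 a ha])
    rw [e3]
    ring

noncomputable def Kf (κ : RR) (B : Finset ℕ) : RR := if B = ∅ then 0 else κ ^ (B.card - 1)

lemma level (κ : RR) (r : Finset ℕ → RR) (f : Finset ℕ → ℕ → RR)
    (hf : ∀ A, ∀ a ∈ A, f A a = r (A.erase a) + κ * ∑ a' ∈ (A.erase a).filter (a < ·), f (A.erase a) a') :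
    ∀ A, ∑ a ∈ A, f A a = cv (Kf κ) r A := by
  have h1 : ∀ N, ∀ A : Finset ℕ, A.card = N → ∀ a ∈ A,
      f A a = ∑ B ∈ (A.filter (a < ·)).powerset, κ ^ B.card * r (A \ insert a B) := by
    intro N
    induction N using Nat.strong_induction_on with
    | _ N ih =>
      intro A hA a ha
      rw [hf A a ha, powerset_min]
      have e0 : (A.erase a).filter (a < ·) = A.filter (a < ·) := by
        ext x; simp only [Finset.mem_filter, Finset.mem_erase]
        constructor
        · rintro ⟨⟨_, h⟩, h'⟩; exact ⟨h, h'⟩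
        · rintro ⟨h, h'⟩; exact ⟨⟨h'.ne', h⟩, h'⟩
      rw [e0]
      congr 1
      · simp [Finset.erase_eq]
      · rw [Finset.mul_sum]
        apply Finset.sum_congr rfl
        intro a' ha'
        rw [Finset.mem_filter] at ha'
        have hcard := Finset.card_erase_lt_of_mem ha
        rw [ih _ (by omega) (A.erase a) rfl a' (Finset.mem_erase.2 ⟨ha'.2.ne', ha'.1⟩), Finset.mul_sum]
        have e1 : (A.erase a).filter (a' < ·) = (A.filter (a < ·)).filter (a' < ·) := by
          ext x; simp only [Finset.mem_filter, Finset.mem_erase]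
          constructor
          · rintro ⟨⟨_, h⟩, h'⟩; exact ⟨⟨h, ha'.2.trans h'⟩, h'⟩
          · rintro ⟨⟨h, h''⟩, h'⟩; exact ⟨⟨h''.ne', h⟩, h'⟩
        rw [e1]
        apply Finset.sum_congr rfl
        intro B hB
        have hB' : a' ∉ B := by
          intro h
          have := Finset.mem_powerset.1 hB h
          simp at this
        rw [Finset.card_insert_of_notMem hB', pow_succ']
        have e2 : A.erase a \ insert a' B = A \ insert a (insert a' B) := by
          ext x; simp only [Finset.mem_sdiff, Finset.mem_erase, Finset.mem_insert]; tauto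
        rw [e2]; ring
  intro A
  unfold cv
  rw [powerset_min]
  simp only [Kf, if_true, zero_mul, zero_add]
  apply Finset.sum_congr rfl
  intro a ha
  rw [h1 _ A rfl a ha]
  apply Finset.sum_congr rfl
  intro B hB
  have hB' : a ∉ B := by
    intro h
    have := Finset.mem_powerset.1 hB h
    simp at this
  rw [Finset.card_insert_of_notMem hB', if_neg (Finset.insert_ne_empty _ _)]
  rfl

lemma Kf_inv (κ : RR) : Inv (Kf κ) := by
  intro A
  simp [Kf, Finset.range_eq_empty_iff]

lemma gf_Kf_one : gf (Kf 1) = Eexp - 1 := by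
  ext1 n
  simp only [gf, Kf, Eexp, PowerSeries.coeff_mk, map_sub, PowerSeries.coeff_one, Finset.range_eq_empty_iff]
  split_ifs with h
  · subst h; simp
  · simp

lemma gf_Kf_neg : Useries * gf (Kf (-Polynomial.X)) = 1 - EexuNeg := by
  ext1 n
  unfold Useries
  simp only [gf, Kf, EexuNeg, PowerSeries.coeff_C_mul, PowerSeries.coeff_mk, map_sub, PowerSeries.coeff_one, Finset.range_eq_empty_iff]
  split_ifs with h
  · subst h; simp
  · obtain ⟨k, rfl⟩ := Nat.exists_eq_succ_of_ne_zero h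
    simp only [Finset.card_range, Nat.succ_eq_add_one, Nat.add_sub_cancel, zero_sub, Polynomial.smul_eq_C_mul, map_mul, map_pow, map_neg, map_one]
    rw [neg_pow]
    ring

end MTsec


section weights
variable {m : ℕ}

def IsCad (ch : Fin (m + 1) → MT m) (c : Fin (m + 1)) : Prop :=
  ch c ≠ .leaf ∧ ∀ c', c < c' → ch c' = .leaf

def shf (s : ℕ) (D : Finset ℕ) : Finset ℕ := insert 0 (D.image (· + s))

def lam (S : Set ℤ) (E : Finset ℕ) (s : ℕ) (D : Finset ℕ) : Prop :=
  ∃ e ∈ E, ∃ d ∈ D, ((e + s + d : ℕ) : ℤ) ∈ S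

noncomputable def MT.sh : MT m → Finset ℕ
  | .leaf => ∅
  | .node _ mk ch => insert 0 (if mk = true then
      Finset.univ.biUnion (fun c => if IsCad ch c then (ch c).sh.image (· + (c : ℕ)) else ∅) else ∅)

noncomputable def MT.bl : MT m → ℕ
  | .leaf => 0
  | .node _ mk ch => (if mk = true then 0 else 1) + ∑ c, (ch c).bl

def MT.V (S : Set ℤ) : MT m → Finset ℕ → Prop
  | .leaf, _ => True
  | .node a mk ch, E => (mk = true → ∃ c, IsCad ch c ∧ ((c : ℕ) = 0 → a < (ch c).rt)) ∧
      (∀ c, IsCad ch c → ((c : ℕ) = 0 → a < (ch c).rt) → lam S E c (ch c).sh) ∧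
      ∀ c, (ch c).V S (if IsCad ch c ∧ mk = true then shf c E else {0})

lemma isCad_unique {ch : Fin (m + 1) → MT m} {c c' : Fin (m + 1)} (h : IsCad ch c) (h' : IsCad ch c') : c = c' := by
  rcases lt_trichotomy c c' with hl | hl | hl
  · exact absurd (h.2 _ hl) h'.1
  · exact hl
  · exact absurd (h'.2 _ hl) h.1

lemma cad_cases (ch : Fin (m + 1) → MT m) : (∀ c, ch c = .leaf) ∨ ∃ s, IsCad ch s := by
  by_cases h : ∀ c, ch c = .leaf
  · exact Or.inl h
  · right
    push Not at h
    obtain ⟨s, hs⟩ := h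
    have hne : (Finset.univ.filter (fun c => ch c ≠ .leaf)).Nonempty := ⟨s, by simp [hs]⟩
    refine ⟨(Finset.univ.filter (fun c => ch c ≠ .leaf)).max' hne, ?_, ?_⟩
    · have := Finset.max'_mem _ hne
      simpa using this
    · intro c' hc'
      by_contra hl
      exact absurd (Finset.le_max' _ c' (by simp [hl])) (not_le.2 hc')

lemma sh_node_true {a : ℕ} {ch : Fin (m + 1) → MT m} {s : Fin (m + 1)} (h : IsCad ch s) :
    (MT.node a true ch).sh = shf s (ch s).sh := by
  simp only [MT.sh, shf, if_true]
  congr 1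
  ext x
  simp only [Finset.mem_biUnion, Finset.mem_univ, true_and]
  constructor
  · rintro ⟨c, hc⟩
    by_cases hcc : IsCad ch c
    · rw [if_pos hcc] at hc
      rwa [isCad_unique hcc h] at hc
    · simp [hcc] at hc
  · intro hx
    exact ⟨s, by rw [if_pos h]; exact hx⟩

lemma sh_node_false {a : ℕ} {ch : Fin (m + 1) → MT m} : (MT.node a false ch).sh = {0} := by
  simp [MT.sh]

lemma zero_mem_sh {t : MT m} (h : t ≠ .leaf) : 0 ∈ t.sh := by
  cases t with
  | leaf => exact absurd rfl h
  | node a mk ch => simp [MT.sh]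

lemma map_eq_leaf {f : ℕ → ℕ} {t : MT m} : t.map f = .leaf ↔ t = .leaf := by
  cases t <;> simp [MT.map]

lemma isCad_map {f : ℕ → ℕ} {ch : Fin (m + 1) → MT m} {c : Fin (m + 1)} :
    IsCad (fun c => (ch c).map f) c ↔ IsCad ch c := by
  simp [IsCad, map_eq_leaf]

lemma sh_map (f : ℕ → ℕ) (t : MT m) : (t.map f).sh = t.sh := by
  induction t with
  | leaf => rfl
  | node a mk ch ih => simp only [MT.map, MT.sh, isCad_map, ih]

lemma bl_map (f : ℕ → ℕ) (t : MT m) : (t.map f).bl = t.bl := by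
  induction t with
  | leaf => rfl
  | node a mk ch ih => simp only [MT.map, MT.bl, ih]

lemma rt_map (f : ℕ → ℕ) (t : MT m) (h : t ≠ .leaf) : (t.map f).rt = f t.rt := by
  cases t with
  | leaf => exact absurd rfl h
  | node a mk ch => rfl

lemma V_map (S : Set ℤ) {f : ℕ → ℕ} (hf : StrictMono f) (t : MT m) : ∀ E, (t.map f).V S E ↔ t.V S E := by
  induction t with
  | leaf => intro E; rfl
  | node a mk ch ih =>
    intro E
    have hr : ∀ c, IsCad ch c → (f a < ((ch c).map f).rt ↔ a < (ch c).rt) := by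
      intro c hc
      rw [rt_map f _ hc.1, hf.lt_iff_lt]
    simp only [MT.map, MT.V, isCad_map, ih, sh_map]
    refine and_congr (imp_congr_right fun _ => exists_congr fun c => and_congr_right fun hc => by rw [hr c hc])
      (and_congr_left fun _ => forall_congr' fun c => imp_congr_right fun hc => by rw [hr c hc])

/-! weights -/

noncomputable def wt (S : Set ℤ) (E D : Finset ℕ) (t : MT m) : RR :=
  if t.V S E ∧ t.sh = D then Polynomial.X ^ t.bl else 0

noncomputable def wY (S : Set ℤ) (t : MT m) : RR := if t.V S {0} then Polynomial.X ^ t.bl else 0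

noncomputable def nl (g : MT m → RR) (t : MT m) : RR := if t = .leaf then 0 else g t

noncomputable def dl (t : MT m) : RR := if t = .leaf then 1 else 0

lemma wt_inv (S : Set ℤ) (E D : Finset ℕ) : MInv (wt (m := m) S E D) := by
  intro f hf t
  simp only [wt, V_map S hf, sh_map, bl_map]

lemma wY_inv (S : Set ℤ) : MInv (wY (m := m) S) := by
  intro f hf t
  simp only [wY, V_map S hf, bl_map]

lemma nl_inv {g : MT m → RR} (hg : MInv g) : MInv (nl g) := by
  intro f hf t
  simp only [nl, map_eq_leaf, hg f hf]

lemma dl_inv : MInv (dl (m := m)) := by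
  intro f hf t
  simp only [dl, map_eq_leaf]

noncomputable def pw (S : Set ℤ) (s : ℕ) (g : MT m → RR) (c : Fin (m + 1)) : MT m → RR :=
  if (c : ℕ) < s then wY S else if (c : ℕ) = s then nl g else dl

lemma pw_inv (S : Set ℤ) (s : ℕ) {g : MT m → RR} (hg : MInv g) (c : Fin (m + 1)) : MInv (pw S s g c) := by
  unfold pw
  split_ifs
  · exact wY_inv S
  · exact nl_inv hg
  · exact dl_inv

lemma pw_prod_not (S : Set ℤ) (s : ℕ) (hs : s ≤ m) (g : MT m → RR) (ch : Fin (m + 1) → MT m)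
    (h : ¬ IsCad ch ⟨s, by omega⟩) : ∏ c, pw S s g c (ch c) = 0 := by
  unfold IsCad at h
  rw [Classical.not_and_iff_not_or_not] at h
  rcases h with h | h
  · push Not at h
    apply Finset.prod_eq_zero (Finset.mem_univ (⟨s, by omega⟩ : Fin (m + 1)))
    simp [pw, nl, h]
  · push Not at h
    obtain ⟨c', h1, h2⟩ := h
    apply Finset.prod_eq_zero (Finset.mem_univ c')
    have h1' : s < (c' : ℕ) := h1
    simp only [pw]
    rw [if_neg (by omega), if_neg (by omega), dl, if_neg h2]

lemma pw_prod_cad (S : Set ℤ) (g : MT m → RR) (ch : Fin (m + 1) → MT m) (s : Fin (m + 1))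
    (h : IsCad ch s) (v : Fin (m + 1) → RR) (h1 : ∀ c, c < s → v c = wY S (ch c)) (h2 : v s = g (ch s))
    (h3 : ∀ c, s < c → v c = 1) : ∏ c, pw S s g c (ch c) = ∏ c, v c := by
  apply Finset.prod_congr rfl
  intro c _
  unfold pw
  rcases lt_trichotomy c s with hc | hc | hc
  · rw [if_pos (show (c : ℕ) < s from hc), h1 c hc]
  · subst hc
    rw [if_neg (lt_irrefl _), if_pos rfl, h2, nl, if_neg h.1]
  · have hc' : (s : ℕ) < c := hc
    rw [if_neg (by omega), if_neg (by omega), h3 c hc, h.2 c hc]; simp [dl]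

noncomputable def gF (S : Set ℤ) (E : Finset ℕ) (s a : ℕ) (t : MT m) : RR :=
  if (s = 0 → a < t.rt) → lam S E s t.sh then wY S t else 0

noncomputable def gT (S : Set ℤ) (E D : Finset ℕ) (s a : ℕ) (t : MT m) : RR :=
  if (s = 0 → a < t.rt) ∧ lam S E s t.sh ∧ t.V S (shf s E) ∧ shf s t.sh = D then Polynomial.X ^ t.bl else 0

lemma sum_pw_leaf (S : Set ℤ) (g : ℕ → MT m → RR) (ch : Fin (m + 1) → MT m) (h : ∀ c, ch c = .leaf) :
    ∑ s ∈ Finset.range (m + 1), ∏ c, pw S s (g s) c (ch c) = 0 := by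
  apply Finset.sum_eq_zero
  intro s hs
  rw [Finset.mem_range] at hs
  apply pw_prod_not S s (by omega)
  intro hc
  exact hc.1 (h _)

lemma sum_pw_cad (S : Set ℤ) (g : ℕ → MT m → RR) (ch : Fin (m + 1) → MT m) (s : Fin (m + 1)) (h : IsCad ch s) :
    ∑ s ∈ Finset.range (m + 1), ∏ c, pw S s (g s) c (ch c) = ∏ c, pw S s (g s) c (ch c) := by
  apply Finset.sum_eq_single_of_mem _ (Finset.mem_range.2 s.2)
  intro s' hs' hne
  rw [Finset.mem_range] at hs'
  apply pw_prod_not S s' (by omega)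
  intro hc
  apply hne
  have := isCad_unique hc h
  exact congrArg Fin.val this

lemma wt_node_false (S : Set ℤ) (E D : Finset ℕ) (a : ℕ) (ch : Fin (m + 1) → MT m) :
    wt S E D (.node a false ch) = (if D = {0} then Polynomial.X else 0) *
      (∏ c, dl (ch c) + ∑ s ∈ Finset.range (m + 1), ∏ c, pw S s (gF S E s a) c (ch c)) := by
  unfold wt
  rw [sh_node_false]
  by_cases hD : D = {0}
  swap
  · rw [if_neg hD, zero_mul, if_neg]; rintro ⟨_, h⟩; exact hD h.symm
  rw [if_pos hD, hD]
  simp only [MT.V, MT.bl, and_true, Bool.false_eq_true, and_false, if_false, false_imp_iff, true_and]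
  rcases cad_cases ch with h | ⟨s, h⟩
  · rw [sum_pw_leaf S _ ch h, if_pos]
    · simp [h, dl, MT.bl]
    · refine ⟨fun c hc => absurd (h c) hc.1, fun c => ?_⟩
      rw [h c]; trivial
  · rw [sum_pw_cad S (fun s => gF S E s a) ch s h, Finset.prod_eq_zero (Finset.mem_univ s) (by simp [dl, h.1]), zero_add]
    have hV : ((∀ c, IsCad ch c → ((c : ℕ) = 0 → a < (ch c).rt) → lam S E c (ch c).sh) ∧
        ∀ c, (ch c).V S {0}) ↔ ((((s : ℕ) = 0 → a < (ch s).rt) → lam S E s (ch s).sh) ∧ ∀ c, (ch c).V S {0}) := by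
      apply and_congr_left
      intro _
      constructor
      · exact fun hh => hh s h
      · intro hh c hc
        rw [isCad_unique hc h]; exact hh
    rw [pw_prod_cad S _ ch s h (fun c => if c = s then gF S E s a (ch s) else wY S (ch c))]
    · simp only [hV]
      by_cases hl : ((s : ℕ) = 0 → a < (ch s).rt) → lam S E s (ch s).sh
      · have : ∀ c, (if c = s then gF S E s a (ch s) else wY S (ch c)) = wY S (ch c) := by
          intro c
          split_ifs with hc
          · subst hc; rw [gF, if_pos hl]
          · rfl
        rw [Finset.prod_congr rfl (fun c _ => this c)]
        simp only [wY]
        rw [Finset.prod_ite_zero]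
        simp only [Finset.mem_univ, true_imp_iff]
        by_cases hall : ∀ c, (ch c).V S {0}
        · rw [if_pos ⟨hl, hall⟩, if_pos hall, Finset.prod_pow_eq_pow_sum, pow_add, pow_one]
        · rw [if_neg (fun hh => hall hh.2), if_neg hall, mul_zero]
      · rw [if_neg (fun hh => hl hh.1), Finset.prod_eq_zero (Finset.mem_univ s), mul_zero]
        rw [if_pos rfl, gF, if_neg hl]
    · intro c hc; rw [if_neg hc.ne]
    · rw [if_pos rfl]
    · intro c hc; rw [if_neg hc.ne', h.2 c hc]; simp [wY, MT.V, MT.bl]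

lemma wt_node_true (S : Set ℤ) (E D : Finset ℕ) (a : ℕ) (ch : Fin (m + 1) → MT m) :
    wt S E D (.node a true ch) = ∑ s ∈ Finset.range (m + 1), ∏ c, pw S s (gT S E D s a) c (ch c) := by
  unfold wt
  rcases cad_cases ch with h | ⟨s, h⟩
  · rw [sum_pw_leaf S _ ch h, if_neg]
    rintro ⟨hV, -⟩
    simp only [MT.V] at hV
    obtain ⟨c, hc, -⟩ := hV.1 trivial
    exact hc.1 (h c)
  · rw [sum_pw_cad S (fun s => gT S E D s a) ch s h, sh_node_true h]
    rw [pw_prod_cad S _ ch s h (fun c => if c = s then gT S E D s a (ch s) else wY S (ch c))]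
    · by_cases hl : ((s : ℕ) = 0 → a < (ch s).rt) ∧ lam S E s (ch s).sh ∧ shf s (ch s).sh = D
      · have e1 : ∀ c, (if c = s then gT S E D s a (ch s) else wY S (ch c)) =
            if (ch c).V S (if IsCad ch c ∧ true = true then shf c E else {0}) then Polynomial.X ^ (ch c).bl else 0 := by
          intro c
          by_cases hc : c = s
          · subst hc
            simp only [if_true, gT, h, and_true, hl, true_and]
            congr 1
            apply propext
            constructor
            · exact fun hh => hh.2
            · exact fun hh => ⟨hl.1, hh⟩
          · have : ¬ IsCad ch c := fun hh => hc (isCad_unique hh h)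
            simp only [hc, if_false, wY, this, false_and]
        rw [Finset.prod_congr rfl (fun c _ => e1 c)]
        rw [Finset.prod_ite_zero, Finset.prod_pow_eq_pow_sum]
        have e2 : (MT.node a true ch).V S E ∧ shf s (ch s).sh = D ↔
            ∀ c ∈ Finset.univ, (ch c).V S (if IsCad ch c ∧ true = true then shf c E else {0}) := by
          simp only [MT.V, Finset.mem_univ, true_imp_iff]
          constructor
          · exact fun hh => hh.1.2.2
          · intro hh
            refine ⟨⟨⟨s, h, hl.1⟩, ?_, hh⟩, hl.2.2⟩
            intro c hc _
            rw [isCad_unique hc h]; exact hl.2.1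
        have e3 : (MT.node a true ch).bl = ∑ c, (ch c).bl := by simp [MT.bl]
        rw [e3]
        by_cases hv : (MT.node a true ch).V S E ∧ shf s (ch s).sh = D
        · rw [if_pos hv, if_pos (e2.1 hv)]
        · rw [if_neg hv, if_neg (fun hh => hv (e2.2 hh))]
      · rw [if_neg, Finset.prod_eq_zero (Finset.mem_univ s)]
        · rw [if_pos rfl, gT, if_neg]
          exact fun hh => hl ⟨hh.1, hh.2.1, hh.2.2.2⟩
        · rintro ⟨hV, hD⟩
          simp only [MT.V] at hV
          obtain ⟨c, hc, hlt⟩ := hV.1 trivial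
          rw [isCad_unique hc h] at hlt
          exact hl ⟨hlt, hV.2.1 s h hlt, hD⟩
    · intro c hc; rw [if_neg hc.ne]
    · rw [if_pos rfl]
    · intro c hc; rw [if_neg hc.ne', h.2 c hc]; simp [wY, MT.V, MT.bl]

lemma cnt_dl (A : Finset ℕ) : cnt (dl (m := m)) A = if A = ∅ then 1 else 0 := by
  rw [cnt_eq_fr]
  simp [dl, fr]

lemma cv_delta (F : Finset ℕ → RR) (A : Finset ℕ) : cv F (fun A => if A = ∅ then 1 else 0) A = F A := by
  unfold cv
  rw [Finset.sum_eq_single_of_mem A (Finset.mem_powerset_self A)]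
  · simp
  · intro B hB hne
    simp only
    rw [if_neg, mul_zero]
    intro h
    rw [Finset.sdiff_eq_empty_iff_subset] at h
    exact hne (Finset.Subset.antisymm (Finset.mem_powerset.1 hB) h)

lemma cntP_dl (N : ℕ) : cntP (fun _ : Fin N => dl (m := m)) = fun A => if A = ∅ then 1 else 0 := by
  induction N with
  | zero => funext A; exact cntP_zero _ A
  | succ N ih =>
    funext A
    rw [cntP_succ, ih, cv_delta, cnt_dl]

lemma cntP_pw_zero (S : Set ℤ) (g : MT m → RR) : cntP (pw S 0 g) = cnt (nl g) := by
  funext A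
  rw [cntP_succ]
  have : (fun c : Fin m => pw S 0 g c.succ) = fun _ => dl := by
    funext c
    simp [pw]
  rw [this, cntP_dl, cv_delta]
  simp [pw]

lemma gf_cntP_pw (S : Set ℤ) (s : ℕ) (hs : s ≤ m) (g : MT m → RR) (hg : MInv g) :
    gf (cntP (pw S s g)) = gf (cnt (wY (m := m) S)) ^ s * gf (cnt (nl g)) := by
  rw [(cntP_inv_gf _ (pw_inv S s hg)).2]
  have e : ∀ c : Fin (m + 1), gf (cnt (pw S s g c)) =
      (if (c : ℕ) < s then gf (cnt (wY (m := m) S)) else 1) * (if c = ⟨s, by omega⟩ then gf (cnt (nl g)) else 1) := by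
    intro c
    unfold pw
    have hd : gf (cnt (dl (m := m))) = 1 := by
      rw [← gf_delta]; congr 1; funext A; exact cnt_dl A
    simp only [Fin.ext_iff]
    split_ifs <;> first | omega | simp [hd]
  rw [Finset.prod_congr rfl (fun c _ => e c), Finset.prod_mul_distrib, Finset.prod_ite_eq' ]
  simp only [Finset.mem_univ, if_true]
  congr 1
  rw [Finset.prod_ite, Finset.prod_const_one, mul_one, Finset.prod_const]
  congr 1
  have : Finset.univ.filter (fun c : Fin (m + 1) => (c : ℕ) < s) = Finset.univ.map (Fin.castLEEmb (by omega : s ≤ m + 1)) := by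
    ext c
    simp only [Finset.mem_filter, Finset.mem_univ, true_and, Finset.mem_map, Fin.castLEEmb_apply]
    constructor
    · intro h; exact ⟨⟨c, h⟩, rfl⟩
    · rintro ⟨d, rfl⟩; exact d.2
  rw [this, Finset.card_map, Finset.card_univ, Fintype.card_fin]

lemma fr_wt (S : Set ℤ) (E D A : Finset ℕ) (a : ℕ) :
    fr (wt (m := m) S E D) A a = (if D = {0} then Polynomial.X else 0) *
      ((if A.erase a = ∅ then 1 else 0) + ∑ s ∈ Finset.range (m + 1), cntP (pw (m := m) S s (gF S E s a)) (A.erase a)) +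
      ∑ s ∈ Finset.range (m + 1), cntP (pw (m := m) S s (gT S E D s a)) (A.erase a) := by
  have : cntP (fun _ : Fin (m + 1) => dl (m := m)) (A.erase a) = if A.erase a = ∅ then 1 else 0 := by
    rw [cntP_dl]
  rw [← this]
  unfold fr cntP
  simp only [wt_node_false, wt_node_true, Finset.sum_add_distrib, ← Finset.mul_sum]
  congr 1
  · congr 2
    rw [Finset.sum_comm]
  · rw [Finset.sum_comm]

lemma cnt_root (h : MT m → RR) (a : ℕ) (B : Finset ℕ) :
    cnt (fun t => if t ≠ .leaf ∧ a < t.rt then h t else 0) B = ∑ a' ∈ B.filter (a < ·), fr h B a' := by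
  rw [cnt_eq_fr, Finset.sum_filter]
  simp only [ne_eq, not_true_eq_false, false_and, if_false, ite_self, zero_add]
  apply Finset.sum_congr rfl
  intro a' _
  unfold fr
  split_ifs with h'
  · simp [MT.rt, h']
  · simp [MT.rt, h']

end weights


section recur
variable {m : ℕ} {S : Set ℤ}

/-- The generating function of all valid trees. -/
noncomputable def Yg (m : ℕ) (S : Set ℤ) : PowerSeries RR := gf (cnt (wY (m := m) S))

lemma shf_zero {D : Finset ℕ} (h : 0 ∈ D) : shf 0 D = D := by
  ext x; simp [shf]; intro hx; rw [hx]; exact h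

lemma zero_mem_shf (s : ℕ) (D : Finset ℕ) : 0 ∈ shf s D := by simp [shf]

lemma shf_ne {s : ℕ} (hs : 1 ≤ s) {D : Finset ℕ} (h : 0 ∈ D) : shf s D ≠ {0} := by
  intro e
  have : s ∈ shf s D := by simp only [shf, Finset.mem_insert, Finset.mem_image]; exact Or.inr ⟨0, h, by simp⟩
  rw [e] at this
  simp at this; omega

lemma shf_inj {s s' : ℕ} (hs : 1 ≤ s) (hs' : 1 ≤ s') {D D' : Finset ℕ} (h : 0 ∈ D) (h' : 0 ∈ D')
    (e : shf s D = shf s' D') : s = s' ∧ D = D' := by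
  have key : ∀ {s s' : ℕ}, 1 ≤ s → ∀ {D D' : Finset ℕ}, 0 ∈ D → shf s D = shf s' D' → s' ≤ s := by
    intro s s' hs D D' h e
    have : s ∈ shf s D := by simp only [shf, Finset.mem_insert, Finset.mem_image]; exact Or.inr ⟨0, h, by simp⟩
    rw [e] at this
    simp only [shf, Finset.mem_insert, Finset.mem_image] at this
    rcases this with h0 | ⟨d, _, hd⟩ <;> omega
  have hss : s = s' := le_antisymm (key hs' h' e.symm) (key hs h e)
  subst hss
  refine ⟨rfl, ?_⟩
  have key2 : ∀ {D D' : Finset ℕ}, shf s D = shf s D' → D ⊆ D' := by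
    intro D D' e d hd
    have : d + s ∈ shf s D := by simp only [shf, Finset.mem_insert, Finset.mem_image]; exact Or.inr ⟨d, hd, rfl⟩
    rw [e] at this
    simp only [shf, Finset.mem_insert, Finset.mem_image] at this
    rcases this with h0 | ⟨d', hd', he⟩
    · omega
    · have : d' = d := by omega
      rwa [← this]
  exact Finset.Subset.antisymm (key2 e) (key2 e.symm)

lemma lam_mono {E : Finset ℕ} {s : ℕ} {D : Finset ℕ} (h : lam S E s D) : lam S E 0 (shf s D) := by
  obtain ⟨e, he, d, hd, hS⟩ := h
  refine ⟨e, he, d + s, ?_, ?_⟩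
  · simp only [shf, Finset.mem_insert, Finset.mem_image]; exact Or.inr ⟨d, hd, rfl⟩
  · convert hS using 2; omega

lemma lam_le (hmax : ∀ s ∈ S, s ≤ (m : ℤ)) {E : Finset ℕ} {s : ℕ} {D : Finset ℕ} (h : lam S E s D) : s ≤ m := by
  obtain ⟨e, he, d, hd, hS⟩ := h
  have := hmax _ hS
  push_cast at this
  omega

lemma wt_leaf {E D : Finset ℕ} (h : 0 ∈ D) : wt S E D (MT.leaf (m := m)) = 0 := by
  unfold wt
  rw [if_neg]
  rintro ⟨_, h'⟩
  rw [← h'] at h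
  simp [MT.sh] at h

lemma nl_wt {E D : Finset ℕ} (h : 0 ∈ D) : nl (wt (m := m) S E D) = wt S E D := by
  funext t
  unfold nl
  split_ifs with ht
  · rw [ht, wt_leaf h]
  · rfl

lemma cnt_wt {E D : Finset ℕ} (h : 0 ∈ D) (A : Finset ℕ) :
    cnt (wt (m := m) S E D) A = ∑ a ∈ A, fr (wt (m := m) S E D) A a := by
  rw [cnt_eq_fr, wt_leaf h]; simp

/-- the `s = 0` marked term -/
lemma gT_zero {E D : Finset ℕ} (hE : 0 ∈ E) (hD : 0 ∈ D) (a : ℕ) (B : Finset ℕ) :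
    cntP (pw (m := m) S 0 (gT S E D 0 a)) B =
      (if lam S E 0 D then 1 else 0) * ∑ a' ∈ B.filter (a < ·), fr (wt (m := m) S E D) B a' := by
  rw [cntP_pw_zero, ← cnt_root]
  unfold cnt
  rw [Finset.mul_sum]
  apply Finset.sum_congr rfl
  intro t _
  by_cases ht : t = .leaf
  · simp [nl, ht]
  · simp only [nl, ht, if_false, gT, true_imp_iff, shf_zero hE, shf_zero (zero_mem_sh ht), ne_eq, not_false_eq_true, true_and, wt]
    by_cases hD' : t.sh = D
    · subst hD'
      by_cases h1 : a < t.rt <;> by_cases h2 : lam S E 0 t.sh <;> by_cases h3 : t.V S E <;> simp [h1, h2, h3]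
    · simp [hD']

lemma sum_range_succ_split (f : ℕ → RR) : ∑ s ∈ Finset.range (m + 1), f s = f 0 + ∑ s ∈ Finset.Icc 1 m, f s := by
  rw [Finset.sum_range_succ', add_comm]
  congr 1
  rw [← Finset.sum_image (s := Finset.range m) (g := fun s => s + 1) (f := f) (by intro a _ b _ h; simpa using h)]
  apply Finset.sum_congr _ (fun _ _ => rfl)
  ext x
  simp only [Finset.mem_image, Finset.mem_range, Finset.mem_Icc]
  constructor
  · rintro ⟨a, h, rfl⟩; omega
  · intro h; exact ⟨x - 1, by omega, by omega⟩

lemma cntP_congr_nl {s : ℕ} {g g' : MT m → RR} (h : ∀ t, t ≠ .leaf → g t = g' t) :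
    cntP (pw S s g) = cntP (pw S s g') := by
  have : pw S s g = pw S s g' := by
    funext c
    unfold pw
    have : nl g = nl g' := by
      funext t
      unfold nl
      split_ifs with ht
      · rfl
      · exact h t ht
    rw [this]
  rw [this]

lemma cntP_pw_null {s : ℕ} (hs : s ≤ m) {g : MT m → RR} (h : ∀ t, t ≠ .leaf → g t = 0) (B : Finset ℕ) :
    cntP (pw S s g) B = 0 := by
  unfold cntP
  apply Finset.sum_eq_zero
  intro ch _
  apply Finset.prod_eq_zero (Finset.mem_univ (⟨s, by omega⟩ : Fin (m + 1)))
  simp only [pw, lt_irrefl, if_false, if_true, nl]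
  split_ifs with ht
  · rfl
  · exact h _ ht

lemma gf_step (hmax : ∀ s ∈ S, s ≤ (m : ℤ)) {E D : Finset ℕ} (hE : 0 ∈ E) (hD : 0 ∈ D) {s : ℕ} (hs : 1 ≤ s) :
    gf (cnt (wt (m := m) S E (shf s D))) =
      if lam S E s D then (Eexp - 1) * Yg m S ^ s * gf (cnt (wt (m := m) S (shf s E) D)) else 0 := by
  have h0 := zero_mem_shf s D
  set κ : RR := if lam S E 0 (shf s D) then 1 else 0 with hκ
  set r : Finset ℕ → RR := fun B => if lam S E s D then cntP (pw S s (wt (m := m) S (shf s E) D)) B else 0 with hr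
  have hrec : ∀ A : Finset ℕ, ∀ a ∈ A, fr (wt (m := m) S E (shf s D)) A a = r (A.erase a) +
      κ * ∑ a' ∈ (A.erase a).filter (a < ·), fr (wt (m := m) S E (shf s D)) (A.erase a) a' := by
    intro A a ha
    rw [fr_wt, if_neg (shf_ne hs hD), zero_mul, zero_add, sum_range_succ_split, gT_zero hE h0, add_comm]
    congr 1
    have hother : ∀ s' ∈ Finset.Icc 1 m, s' ≠ s → cntP (pw (m := m) S s' (gT S E (shf s D) s' a)) (A.erase a) = 0 := by
      intro s' hs' hne
      rw [Finset.mem_Icc] at hs'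
      apply cntP_pw_null hs'.2
      intro t ht
      rw [gT, if_neg]
      rintro ⟨_, _, _, h⟩
      exact hne (shf_inj hs'.1 hs (zero_mem_sh ht) hD h).1
    by_cases hsm : s ≤ m
    · rw [Finset.sum_eq_single_of_mem s (Finset.mem_Icc.2 ⟨hs, hsm⟩) hother]
      simp only [hr]
      split_ifs with hl
      · apply congrFun
        apply cntP_congr_nl
        intro t ht
        unfold gT wt
        by_cases hD' : t.sh = D
        · have hs0 : s ≠ 0 := by omega
          simp [hD', hl, hs0]
        · rw [if_neg, if_neg]
          · exact fun h => hD' h.2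
          · rintro ⟨_, _, _, h⟩
            exact hD' (shf_inj hs hs (zero_mem_sh ht) hD h).2
      · apply cntP_pw_null hsm
        intro t ht
        rw [gT, if_neg]
        rintro ⟨_, h1, _, h⟩
        rw [(shf_inj hs hs (zero_mem_sh ht) hD h).2] at h1
        exact hl h1
    · rw [Finset.sum_eq_zero (fun s' hs' => hother s' hs' (by rw [Finset.mem_Icc] at hs'; omega))]
      simp only [hr]
      rw [if_neg (fun hl => hsm (lam_le hmax hl))]
  have hlev := level κ r _ hrec
  have hcnt : cnt (wt (m := m) S E (shf s D)) = cv (Kf κ) r := by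
    funext A
    rw [cnt_wt h0, hlev]
  rw [hcnt]
  split_ifs with hl
  · have hsm := lam_le hmax hl
    have hr' : r = cntP (pw S s (wt (m := m) S (shf s E) D)) := by
      funext B; simp only [hr]; rw [if_pos hl]
    have hκ' : κ = 1 := by rw [hκ, if_pos (lam_mono hl)]
    rw [hr', hκ', gf_cv (Kf_inv _) (cntP_inv_gf _ (pw_inv S s (wt_inv S _ _))).1, gf_Kf_one,
      gf_cntP_pw S s hsm _ (wt_inv S _ _), nl_wt hD, Yg, mul_assoc]
  · have hr' : r = fun _ => 0 := by
      funext B; simp only [hr]; rw [if_neg hl]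
    rw [hr']
    ext1 n
    simp [gf, cv]

noncomputable def gL (S : Set ℤ) (E : Finset ℕ) (s : ℕ) (t : MT m) : RR :=
  if s = 0 ∨ lam S E s t.sh then wY S t else 0

lemma gL_inv (S : Set ℤ) (E : Finset ℕ) (s : ℕ) : MInv (gL (m := m) S E s) := by
  intro f hf t
  simp only [gL, sh_map, wY_inv S f hf]

noncomputable def ell (m : ℕ) (S : Set ℤ) (E : Finset ℕ) (B : Finset ℕ) : RR :=
  (if B = ∅ then 1 else 0) + ∑ s ∈ Finset.range (m + 1), cntP (pw (m := m) S s (gL S E s)) B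

lemma Inv.add {F G : Finset ℕ → RR} (hF : Inv F) (hG : Inv G) : Inv (fun A => F A + G A) := by
  intro A; simp only; rw [hF A, hG A]

lemma Inv.sum {ι : Type*} (s : Finset ι) {F : ι → Finset ℕ → RR} (hF : ∀ i, Inv (F i)) : Inv (fun A => ∑ i ∈ s, F i A) := by
  intro A; exact Finset.sum_congr rfl (fun i _ => hF i A)

lemma Inv.smul (c : RR) {F : Finset ℕ → RR} (hF : Inv F) : Inv (fun A => c * F A) := by
  intro A; simp only; rw [hF A]

lemma ell_inv (E : Finset ℕ) : Inv (ell m S E) :=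
  Inv.add inv_delta (Inv.sum _ (fun s => (cntP_inv_gf _ (pw_inv S s (gL_inv S E s))).1))

lemma gf_ell (E : Finset ℕ) : gf (ell m S E) = 1 + ∑ s ∈ Finset.range (m + 1), Yg m S ^ s * gf (cnt (nl (gL (m := m) S E s))) := by
  have : ell m S E = fun B => (if B = ∅ then 1 else 0) + ∑ s ∈ Finset.range (m + 1), cntP (pw (m := m) S s (gL S E s)) B := rfl
  rw [this, gf_add, gf_delta, gf_sum]
  congr 1
  apply Finset.sum_congr rfl
  intro s hs
  rw [Finset.mem_range] at hs
  rw [gf_cntP_pw S s (by omega) _ (gL_inv S E s)]; rfl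

lemma gT_sum_base {E : Finset ℕ} (a : ℕ) (B : Finset ℕ) (hE : 0 ∈ E) :
    ∑ s ∈ Finset.range (m + 1), cntP (pw (m := m) S s (gT S E {0} s a)) B =
      (if lam S E 0 {0} then 1 else 0) * ∑ a' ∈ B.filter (a < ·), fr (wt (m := m) S E {0}) B a' := by
  rw [sum_range_succ_split, gT_zero hE (by simp)]
  have hz : ∑ s ∈ Finset.Icc 1 m, cntP (pw (m := m) S s (gT S E {0} s a)) B = 0 := by
    apply Finset.sum_eq_zero
    intro s hs
    rw [Finset.mem_Icc] at hs
    apply cntP_pw_null hs.2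
    intro t ht
    rw [gT, if_neg]
    rintro ⟨_, _, _, h⟩
    exact shf_ne hs.1 (zero_mem_sh ht) h
  rw [hz, add_zero]

lemma gF_pos {E : Finset ℕ} {s a : ℕ} (hs : 1 ≤ s) : gF (m := m) S E s a = gL S E s := by
  funext t
  unfold gF gL
  have h1 : ((s = 0 → a < t.rt) → lam S E s t.sh) ↔ (s = 0 ∨ lam S E s t.sh) := by
    have : s ≠ 0 := by omega
    simp [this]
  simp only [h1]

lemma gf_base1 {E : Finset ℕ} (hE : 0 ∈ E) (hl : lam S E 0 {0}) :
    gf (cnt (wt (m := m) S E {0})) = (Eexp - 1) * (Useries * gf (ell m S E)) := by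
  have hrec : ∀ A : Finset ℕ, ∀ a ∈ A, fr (wt (m := m) S E {0}) A a = (fun B => Polynomial.X * ell m S E B) (A.erase a) +
      1 * ∑ a' ∈ (A.erase a).filter (a < ·), fr (wt (m := m) S E {0}) (A.erase a) a' := by
    intro A a ha
    rw [fr_wt, if_pos rfl, gT_sum_base _ _ hE, if_pos hl]
    congr 1
    simp only [ell]
    congr 2
    rw [sum_range_succ_split, sum_range_succ_split]
    congr 1
    · apply congrFun
      apply cntP_congr_nl
      intro t ht
      unfold gF gL
      rw [if_pos, if_pos (Or.inl rfl)]
      intro _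
      obtain ⟨e, he, d, hd, hS⟩ := hl
      rw [Finset.mem_singleton] at hd
      subst hd
      exact ⟨e, he, 0, zero_mem_sh ht, hS⟩
    · apply Finset.sum_congr rfl
      intro s hs
      rw [Finset.mem_Icc] at hs
      rw [gF_pos hs.1]
  have hlev := level 1 (fun B => Polynomial.X * ell m S E B) (fr (wt (m := m) S E {0})) hrec
  have hcnt : cnt (wt (m := m) S E {0}) = cv (Kf 1) (fun B => Polynomial.X * ell m S E B) := by
    funext A
    rw [cnt_wt (by simp), hlev]
  rw [hcnt, gf_cv (Kf_inv _) (Inv.smul _ (ell_inv E)), gf_Kf_one, gf_smul]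
  rfl

lemma not_lam_sh (h0 : (0 : ℤ) ∉ S) {t : MT m} (hV : t.V S {0}) (ht : t ≠ .leaf) :
    ¬ lam S {0} 0 t.sh ↔ t.sh = {0} := by
  constructor
  · intro h
    cases t with
    | leaf => exact absurd rfl ht
    | node a mk ch =>
      cases mk with
      | false => exact sh_node_false
      | true =>
        exfalso
        simp only [MT.V] at hV
        obtain ⟨c, hc, hlt⟩ := hV.1 trivial
        have := hV.2.1 c hc hlt
        apply h
        rw [sh_node_true hc]
        exact lam_mono this
  · intro h
    rw [h]
    rintro ⟨e, he, d, hd, hS⟩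
    simp only [Finset.mem_singleton] at he hd
    subst he hd
    simp at hS
    exact h0 hS

lemma gf_base2 (h0 : (0 : ℤ) ∉ S) :
    gf (cnt (wt (m := m) S {0} {0})) = (1 - EexuNeg) * gf (ell m S {0}) := by
  have hnl : ¬ lam S {0} 0 {0} := by
    rintro ⟨e, he, d, hd, hS⟩
    simp only [Finset.mem_singleton] at he hd
    subst he hd
    simp at hS
    exact h0 hS
  have hrec : ∀ A : Finset ℕ, ∀ a ∈ A, fr (wt (m := m) S {0} {0}) A a = (fun B => Polynomial.X * ell m S {0} B) (A.erase a) +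
      (-Polynomial.X) * ∑ a' ∈ (A.erase a).filter (a < ·), fr (wt (m := m) S {0} {0}) (A.erase a) a' := by
    intro A a ha
    rw [fr_wt, if_pos rfl, gT_sum_base _ _ (by simp), if_neg hnl, zero_mul, add_zero]
    have e1 : ∑ s ∈ Finset.range (m + 1), cntP (pw (m := m) S s (gF S {0} s a)) (A.erase a) =
        ∑ s ∈ Finset.range (m + 1), cntP (pw (m := m) S s (gL S {0} s)) (A.erase a) -
          ∑ a' ∈ (A.erase a).filter (a < ·), fr (wt (m := m) S {0} {0}) (A.erase a) a' := by
      rw [sum_range_succ_split, sum_range_succ_split]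
      have e2 : ∑ s ∈ Finset.Icc 1 m, cntP (pw (m := m) S s (gF S {0} s a)) (A.erase a) =
          ∑ s ∈ Finset.Icc 1 m, cntP (pw (m := m) S s (gL S {0} s)) (A.erase a) := by
        apply Finset.sum_congr rfl
        intro s hs
        rw [Finset.mem_Icc] at hs
        rw [gF_pos hs.1]
      rw [e2, cntP_pw_zero, cntP_pw_zero, ← cnt_root]
      have e3 : cnt (nl (gF (m := m) S {0} 0 a)) (A.erase a) = cnt (nl (gL (m := m) S {0} 0)) (A.erase a) -
          cnt (fun t : MT m => if t ≠ .leaf ∧ a < t.rt then wt S {0} {0} t else 0) (A.erase a) := by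
        unfold cnt
        rw [← Finset.sum_sub_distrib]
        apply Finset.sum_congr rfl
        intro t _
        by_cases ht : t = .leaf
        · simp [nl, ht]
        · simp only [nl, ht, if_false, gF, gL, true_imp_iff, true_or, if_true, ne_eq, not_false_eq_true, true_and]
          by_cases h1 : a < t.rt
          · simp only [h1, true_imp_iff, if_true, wt, wY]
            by_cases hV : t.V S {0}
            · by_cases hl : lam S {0} 0 t.sh
              · have : t.sh ≠ {0} := fun h => (not_lam_sh h0 hV ht).2 h hl
                simp [hl, hV, this]
              · have : t.sh = {0} := (not_lam_sh h0 hV ht).1 hl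
                rw [this] at hl
                simp [hl, hV, this]
            · simp [hV]
          · simp [h1]
      rw [e3]; ring
    rw [e1]
    simp only [ell]
    ring
  have hlev := level (-Polynomial.X) (fun B => Polynomial.X * ell m S {0} B) (fr (wt (m := m) S {0} {0})) hrec
  have hcnt : cnt (wt (m := m) S {0} {0}) = cv (Kf (-Polynomial.X)) (fun B => Polynomial.X * ell m S {0} B) := by
    funext A
    rw [cnt_wt (by simp), hlev]
  rw [hcnt, gf_cv (Kf_inv _) (Inv.smul _ (ell_inv _)), gf_smul, ← gf_Kf_neg]
  unfold Useries
  ring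

end recur


section shadow
variable {m : ℕ} {S : Set ℤ}

lemma sup_shf (s : ℕ) {D : Finset ℕ} (h : 0 ∈ D) : (shf s D).sup id = s + D.sup id := by
  apply le_antisymm
  · apply Finset.sup_le
    intro x hx
    simp only [shf, Finset.mem_insert, Finset.mem_image] at hx
    rcases hx with rfl | ⟨d, hd, rfl⟩
    · simp
    · have : id d ≤ D.sup id := Finset.le_sup hd
      simp only [id] at *; omega
  · obtain ⟨d, hd, he⟩ := Finset.exists_mem_eq_sup D ⟨0, h⟩ id
    have : id (d + s) ≤ (shf s D).sup id := Finset.le_sup (by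
      simp only [shf, Finset.mem_insert, Finset.mem_image]; exact Or.inr ⟨d, hd, rfl⟩)
    simp only [id] at *; omega

lemma card_shf {s : ℕ} (hs : 1 ≤ s) (D : Finset ℕ) : (shf s D).card = D.card + 1 := by
  unfold shf
  rw [Finset.card_insert_of_notMem, Finset.card_image_of_injective _ (fun a b h => by simpa using h)]
  simp; omega

lemma mem_shf {s x : ℕ} {D : Finset ℕ} : x ∈ shf s D ↔ x = 0 ∨ ∃ d ∈ D, d + s = x := by
  simp [shf]

lemma shadow_cases {D : Finset ℕ} (h : 0 ∈ D) : D = {0} ∨ ∃ s D', 1 ≤ s ∧ 0 ∈ D' ∧ D = shf s D' := by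
  by_cases h0 : (D.erase 0).Nonempty
  · right
    set s := (D.erase 0).min' h0 with hs
    have hmem := (D.erase 0).min'_mem h0
    rw [← hs, Finset.mem_erase] at hmem
    have hle : ∀ x ∈ D, x ≠ 0 → s ≤ x := fun x hx hx0 => Finset.min'_le _ _ (Finset.mem_erase.2 ⟨hx0, hx⟩)
    refine ⟨s, (D.erase 0).image (· - s), by omega, ?_, ?_⟩
    · exact Finset.mem_image.2 ⟨s, Finset.mem_erase.2 hmem, by simp⟩
    · ext x
      rw [mem_shf]
      constructor
      · intro hx
        by_cases hx0 : x = 0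
        · exact Or.inl hx0
        · exact Or.inr ⟨x - s, Finset.mem_image.2 ⟨x, Finset.mem_erase.2 ⟨hx0, hx⟩, rfl⟩, by have := hle x hx hx0; omega⟩
      · rintro (rfl | ⟨d, hd, rfl⟩)
        · exact h
        · obtain ⟨y, hy, rfl⟩ := Finset.mem_image.1 hd
          rw [Finset.mem_erase] at hy
          have := hle y hy.2 hy.1
          rw [Nat.sub_add_cancel this]; exact hy.2
  · left
    rw [Finset.not_nonempty_iff_eq_empty, Finset.erase_eq_empty_iff] at h0
    rcases h0 with h0 | h0
    · rw [h0] at h; simp at h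
    · exact h0

lemma shadow_induction {P : Finset ℕ → Prop} (h0 : P {0}) (hs : ∀ s D, 1 ≤ s → 0 ∈ D → P D → P (shf s D)) :
    ∀ D, 0 ∈ D → P D := by
  intro D
  induction' hn : D.card using Nat.strong_induction_on with n ih generalizing D
  intro h
  rcases shadow_cases h with rfl | ⟨s, D', h1, h2, rfl⟩
  · exact h0
  · apply hs _ _ h1 h2
    rw [card_shf h1] at hn
    exact ih D'.card (by omega) D' rfl h2

def Link (S : Set ℤ) (E D : Finset ℕ) : Prop :=
  ∀ c, 0 < c → c ≤ D.sup id → ∃ b ∈ D, c ≤ b ∧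
    ((∃ a ∈ D, a < c ∧ ((b : ℤ) - a) ∈ S) ∨ ∃ e ∈ E, ((b + e : ℕ) : ℤ) ∈ S)

lemma link_zero (E : Finset ℕ) : Link S E {0} := by
  intro c h1 h2
  simp at h2; omega

lemma link_shf {s : ℕ} (hs : 1 ≤ s) {E D : Finset ℕ} (hE : 0 ∈ E) (hD : 0 ∈ D) :
    Link S E (shf s D) ↔ lam S E s D ∧ Link S (shf s E) D := by
  unfold Link
  rw [sup_shf s hD]
  constructor
  · intro h
    constructor
    · obtain ⟨b, hb, hcb, h'⟩ := h s (by omega) (by omega)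
      rw [mem_shf] at hb
      rcases hb with rfl | ⟨d, hd, rfl⟩
      · omega
      · rcases h' with ⟨a, ha, hac, hS⟩ | ⟨e, he, hS⟩
        · rw [mem_shf] at ha
          rcases ha with rfl | ⟨d', hd', rfl⟩
          · refine ⟨0, hE, d, hd, ?_⟩
            convert hS using 1; push_cast; ring
          · omega
        · refine ⟨e, he, d, hd, ?_⟩
          convert hS using 2; omega
    · intro c hc hcs
      obtain ⟨b, hb, hcb, h'⟩ := h (c + s) (by omega) (by omega)
      rw [mem_shf] at hb
      rcases hb with rfl | ⟨d, hd, rfl⟩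
      · omega
      · refine ⟨d, hd, by omega, ?_⟩
        rcases h' with ⟨a, ha, hac, hS⟩ | ⟨e, he, hS⟩
        · rw [mem_shf] at ha
          rcases ha with rfl | ⟨d', hd', rfl⟩
          · refine Or.inr ⟨s, mem_shf.2 (Or.inr ⟨0, hE, by simp⟩), ?_⟩
            convert hS using 1; push_cast; ring
          · refine Or.inl ⟨d', hd', by omega, ?_⟩
            convert hS using 1; push_cast; ring
        · refine Or.inr ⟨e + s, mem_shf.2 (Or.inr ⟨e, he, rfl⟩), ?_⟩
          convert hS using 2; omega
  · rintro ⟨⟨e, he, d, hd, hS⟩, h⟩ c hc hcs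
    by_cases hc' : c ≤ s
    · refine ⟨d + s, mem_shf.2 (Or.inr ⟨d, hd, rfl⟩), by omega, Or.inr ⟨e, he, ?_⟩⟩
      convert hS using 2; omega
    · obtain ⟨b, hb, hcb, h'⟩ := h (c - s) (by omega) (by omega)
      refine ⟨b + s, mem_shf.2 (Or.inr ⟨b, hb, rfl⟩), by omega, ?_⟩
      rcases h' with ⟨a, ha, hac, hS⟩ | ⟨e, he, hS⟩
      · refine Or.inl ⟨a + s, mem_shf.2 (Or.inr ⟨a, ha, rfl⟩), by omega, ?_⟩
        convert hS using 1; push_cast; ring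
      · rw [mem_shf] at he
        rcases he with rfl | ⟨e, he, rfl⟩
        · refine Or.inl ⟨s, mem_shf.2 (Or.inr ⟨0, hD, by simp⟩), by omega, ?_⟩
          convert hS using 1; push_cast; ring
        · refine Or.inr ⟨e, he, ?_⟩
          convert hS using 2; omega

lemma link_sup_le (hmax : ∀ s ∈ S, s ≤ (m : ℤ)) : ∀ D : Finset ℕ, 0 ∈ D → ∀ E, 0 ∈ E → Link S E D → D.sup id ≤ D.card * m := by
  refine shadow_induction ?_ ?_
  · intro E _ _; simp
  · intro s D hs hD ih E hE hL
    rw [link_shf hs hE hD] at hL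
    rw [sup_shf s hD, card_shf hs]
    have := ih _ (zero_mem_shf s E) hL.2
    have := lam_le hmax hL.1
    nlinarith

def Est (E D : Finset ℕ) : Finset ℕ := D.image (fun d => D.sup id - d) ∪ E.image (· + D.sup id)

lemma Est_zero {E : Finset ℕ} (hE : 0 ∈ E) : Est E {0} = E := by
  ext x
  simp only [Est, Finset.mem_union, Finset.mem_image, Finset.mem_singleton, Finset.sup_singleton, id]
  constructor
  · rintro (⟨a, rfl, rfl⟩ | ⟨a, h, rfl⟩)
    · simpa using hE
    · simpa using h
  · intro h; exact Or.inr ⟨x, h, by simp⟩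

lemma Est_shf {s : ℕ} {E D : Finset ℕ} (hE : 0 ∈ E) (hD : 0 ∈ D) : Est E (shf s D) = Est (shf s E) D := by
  ext x
  simp only [Est, Finset.mem_union, Finset.mem_image, sup_shf s hD, mem_shf]
  constructor
  · rintro (⟨a, (rfl | ⟨d, hd, rfl⟩), rfl⟩ | ⟨a, h, rfl⟩)
    · exact Or.inr ⟨s, Or.inr ⟨0, hE, by simp⟩, by omega⟩
    · exact Or.inl ⟨d, hd, by omega⟩
    · exact Or.inr ⟨a + s, Or.inr ⟨a, h, rfl⟩, by omega⟩
  · rintro (⟨d, hd, rfl⟩ | ⟨a, (rfl | ⟨e, he, rfl⟩), rfl⟩)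
    · exact Or.inl ⟨d + s, Or.inr ⟨d, hd, rfl⟩, by omega⟩
    · exact Or.inl ⟨s, Or.inr ⟨0, hD, by simp⟩, by omega⟩
    · exact Or.inr ⟨e, he, by omega⟩

lemma gf_link (hmax : ∀ s ∈ S, s ≤ (m : ℤ)) : ∀ D : Finset ℕ, 0 ∈ D → ∀ E, 0 ∈ E →
    gf (cnt (wt (m := m) S E D)) =
      if Link S E D then (Eexp - 1) ^ (D.card - 1) * Yg m S ^ (D.sup id) * gf (cnt (wt (m := m) S (Est E D) {0})) else 0 := by
  refine shadow_induction ?_ ?_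
  · intro E hE
    rw [if_pos (link_zero E), Est_zero hE]; simp
  · intro s D hs hD ih E hE
    rw [gf_step hmax hE hD hs, ih _ (zero_mem_shf s E), Est_shf hE hD, sup_shf s hD, card_shf hs]
    have hc : 1 ≤ D.card := Finset.card_pos.2 ⟨0, hD⟩
    by_cases h1 : lam S E s D
    · by_cases h2 : Link S (shf s E) D
      · rw [if_pos h1, if_pos h2, if_pos ((link_shf hs hE hD).2 ⟨h1, h2⟩)]
        obtain ⟨k, hk⟩ : ∃ k, D.card = k + 1 := ⟨D.card - 1, by omega⟩
        rw [hk]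
        simp only [Nat.add_sub_cancel]
        ring
      · rw [if_pos h1, if_neg h2, if_neg (fun h => h2 ((link_shf hs hE hD).1 h).2), mul_zero]
    · rw [if_neg h1, if_neg (fun h => h1 ((link_shf hs hE hD).1 h).1)]

lemma link_shadow (hsym : ∀ s : ℤ, s ∈ S ↔ -s ∈ S)
    (hclosed : ∀ s t : ℕ, (s : ℤ) ∉ S → (t : ℤ) ∉ S → ((s : ℤ) + (t : ℤ)) ∉ S) {D : Finset ℕ} (h0 : 0 ∈ D) :
    Link S {0} D ↔ IsShadowF S D := by
  constructor
  · intro h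
    refine ⟨h0, ?_⟩
    set R : ℕ → ℕ → Prop := fun a b => a ∈ D ∧ b ∈ D ∧ (((a : ℤ) - (b : ℤ)) ∈ S ∨ ((b : ℤ) - (a : ℤ)) ∈ S) with hR
    haveI hRs : Std.Symm R := ⟨fun a b ⟨h1, h2, h3⟩ => ⟨h2, h1, h3.symm⟩⟩
    have hsy : ∀ a b, Relation.ReflTransGen R a b → Relation.ReflTransGen R b a := fun a b h => Relation.ReflTransGen.stdSymm.symm a b h
    have key : ∀ d ∈ D, Relation.ReflTransGen R 0 d := by
      intro d
      induction' d using Nat.strong_induction_on with d ih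
      intro hd
      by_cases hd0 : d = 0
      · rw [hd0]
      have hds : id d ≤ D.sup id := Finset.le_sup hd
      obtain ⟨b, hb, hcb, h'⟩ := h d (by omega) hds
      have : ∃ a ∈ D, a < d ∧ ((b : ℤ) - a) ∈ S := by
        rcases h' with h' | ⟨e, he, hS⟩
        · exact h'
        · rw [Finset.mem_singleton] at he
          subst he
          exact ⟨0, h0, by omega, by simpa using hS⟩
      obtain ⟨a, ha, had, hS⟩ := this
      refine (ih a had ha).trans ?_
      by_cases hda : ((d : ℤ) - a) ∈ S
      · exact Relation.ReflTransGen.single ⟨ha, hd, Or.inr hda⟩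
      · have hbd : ((b : ℤ) - d) ∈ S := by
          by_contra hbd
          have := hclosed (b - d) (d - a) (by rwa [Nat.cast_sub hcb]) (by rwa [Nat.cast_sub had.le])
          rw [Nat.cast_sub hcb, Nat.cast_sub had.le] at this
          apply this
          convert hS using 1; ring
        have r1 : R a b := ⟨ha, hb, Or.inr hS⟩
        have r2 : R b d := ⟨hb, hd, Or.inl hbd⟩
        exact (Relation.ReflTransGen.single r1).tail r2
    intro i hi j hj
    exact (hsy _ _ (key i hi)).trans (key j hj)
  · rintro ⟨_, h⟩ c hc hcs
    obtain ⟨t, ht, hte⟩ := Finset.exists_mem_eq_sup D ⟨0, h0⟩ id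
    have hpath := h 0 h0 t ht
    have hct : c ≤ t := by rw [hte] at hcs; exact hcs
    clear hte hcs ht
    induction hpath with
    | refl => omega
    | @tail x y hxy hstep ih =>
      by_cases hx : c ≤ x
      · exact ih hx
      · obtain ⟨h1, h2, h3⟩ := hstep
        refine ⟨y, h2, hct, Or.inl ⟨x, h1, by omega, ?_⟩⟩
        rcases h3 with h3 | h3
        · have := (hsym _).1 h3
          rwa [neg_sub] at this
        · exact h3

def endE (D : Finset ℕ) : Finset ℕ := D.image (fun d => D.sup id - d)

lemma Est_single {D : Finset ℕ} (h : 0 ∈ D) : Est {0} D = endE D := by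
  unfold Est endE
  apply Finset.union_eq_left.2
  intro x hx
  simp only [Finset.mem_image, Finset.mem_singleton] at hx ⊢
  obtain ⟨a, rfl, rfl⟩ := hx
  exact ⟨0, h, by omega⟩

lemma zero_mem_endE {D : Finset ℕ} (h : 0 ∈ D) : 0 ∈ endE D := by
  obtain ⟨t, ht, hte⟩ := Finset.exists_mem_eq_sup D ⟨0, h⟩ id
  exact Finset.mem_image.2 ⟨t, ht, by simp only [id] at hte; rw [show D.sup id = t from hte]; omega⟩

lemma gf_shadow (hsym : ∀ s : ℤ, s ∈ S ↔ -s ∈ S)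
    (hclosed : ∀ s t : ℕ, (s : ℤ) ∉ S → (t : ℤ) ∉ S → ((s : ℤ) + (t : ℤ)) ∉ S)
    (hmax : ∀ s ∈ S, s ≤ (m : ℤ)) {D : Finset ℕ} (hD : 0 ∈ D) (h : (0 : ℤ) ∈ S ∨ D ≠ {0}) :
    gf (cnt (wt (m := m) S {0} D)) =
      if IsShadowF S D then (Eexp - 1) ^ D.card * Yg m S ^ (D.sup id) * (Useries * gf (ell m S (endE D))) else 0 := by
  rw [gf_link hmax D hD {0} (by simp), Est_single hD]
  by_cases hL : Link S {0} D
  · rw [if_pos hL, if_pos ((link_shadow hsym hclosed hD).1 hL)]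
    have hl : lam S (endE D) 0 {0} := by
      by_cases hD0 : D = {0}
      · have h0 : (0 : ℤ) ∈ S := by tauto
        exact ⟨0, zero_mem_endE hD, 0, by simp, by simpa using h0⟩
      · have hpos : 0 < D.sup id := by
          rcases shadow_cases hD with h | ⟨s, D', h1, h2, rfl⟩
          · exact absurd h hD0
          · rw [sup_shf s h2]; omega
        obtain ⟨b, hb, hcb, h'⟩ := hL (D.sup id) hpos le_rfl
        have hbs : id b ≤ D.sup id := Finset.le_sup hb
        have hbe : b = D.sup id := le_antisymm hbs hcb
        have : ∃ a ∈ D, a < D.sup id ∧ ((b : ℤ) - a) ∈ S := by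
          rcases h' with h' | ⟨e, he, hS⟩
          · exact h'
          · rw [Finset.mem_singleton] at he
            subst he
            exact ⟨0, hD, hpos, by simpa using hS⟩
        obtain ⟨a, ha, hac, hS⟩ := this
        refine ⟨D.sup id - a, Finset.mem_image.2 ⟨a, ha, rfl⟩, 0, by simp, ?_⟩
        rw [← hbe]
        rw [hbe.symm] at hac
        simpa [Nat.cast_sub hac.le] using hS
    rw [gf_base1 (zero_mem_endE hD) hl]
    have hc : 1 ≤ D.card := Finset.card_pos.2 ⟨0, hD⟩
    obtain ⟨k, hk⟩ : ∃ k, D.card = k + 1 := ⟨D.card - 1, by omega⟩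
    rw [hk]
    simp only [Nat.add_sub_cancel]
    ring
  · rw [if_neg hL, if_neg (fun h => hL ((link_shadow hsym hclosed hD).2 h))]

/-- weight of valid nonleaf trees whose root shadow starts with `W` -/
noncomputable def wS (S : Set ℤ) (W : Finset ℕ) (t : MT m) : RR :=
  if t ≠ .leaf ∧ startF m t.sh = W then wY S t else 0

noncomputable def FUm (m : ℕ) (S : Set ℤ) (W : Finset ℕ) : PowerSeries RR := gf (cnt (wS (m := m) S W))

lemma lam_connF (hmax : ∀ s ∈ S, s ≤ (m : ℤ)) {E D : Finset ℕ} (hE : 0 ∈ E) (hD : 0 ∈ D) {s : ℕ} (hsm : s ≤ m) :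
    (s = 0 ∨ lam S E s D) ↔ s ∈ connF S m (E ∩ Finset.Icc 1 (m - 1)) (startF m D) := by
  simp only [connF, Finset.mem_filter, Finset.mem_range]
  rw [and_iff_right (by omega : s < m + 1)]
  by_cases hs : s = 0
  · simp [hs]
  · simp only [hs, false_or]
    have hmem : ∀ E : Finset ℕ, 0 ∈ E → ∀ e, e ≤ m - 1 → (e ∈ E ↔ e ∈ insert 0 (E ∩ Finset.Icc 1 (m - 1))) := by
      intro E hE e he
      simp only [Finset.mem_insert, Finset.mem_inter, Finset.mem_Icc]
      by_cases h0 : e = 0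
      · simp [h0, hE]
      · simp only [h0, false_or]
        constructor
        · intro h; exact ⟨h, by omega, he⟩
        · exact fun h => h.1
    have hmem2 : ∀ E : Finset ℕ, 0 ∈ E → ∀ e, e ∈ insert 0 (E ∩ Finset.Icc 1 (m - 1)) → e ∈ E := by
      intro E hE e he
      simp only [Finset.mem_insert, Finset.mem_inter] at he
      rcases he with rfl | he
      · exact hE
      · exact he.1
    constructor
    · rintro ⟨e, he, d, hd, hS⟩
      have := hmax _ hS
      push_cast at this
      refine ⟨by omega, e, (hmem E hE e (by omega)).1 he, d, (hmem D hD d (by omega)).1 hd, ?_⟩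
      convert hS using 1; push_cast; ring
    · rintro ⟨_, e, he, d, hd, hS⟩
      refine ⟨e, hmem2 E hE e he, d, hmem2 D hD d hd, ?_⟩
      convert hS using 1; push_cast; ring

lemma gf_ell' (hmax : ∀ s ∈ S, s ≤ (m : ℤ)) {E : Finset ℕ} (hE : 0 ∈ E) :
    gf (ell m S E) = 1 + ∑ W ∈ (Finset.Icc 1 (m - 1)).powerset,
      Cval S m (E ∩ Finset.Icc 1 (m - 1)) W (Yg m S) * FUm m S W := by
  rw [gf_ell]
  congr 1
  have h1 : ∀ s ∈ Finset.range (m + 1), Yg m S ^ s * gf (cnt (nl (gL (m := m) S E s))) =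
      ∑ W ∈ (Finset.Icc 1 (m - 1)).powerset, (if s ∈ connF S m (E ∩ Finset.Icc 1 (m - 1)) W then Yg m S ^ s * FUm m S W else 0) := by
    intro s hs
    rw [Finset.mem_range] at hs
    have h2 : cnt (nl (gL (m := m) S E s)) = fun A => ∑ W ∈ (Finset.Icc 1 (m - 1)).powerset,
        (if s ∈ connF S m (E ∩ Finset.Icc 1 (m - 1)) W then 1 else 0) * cnt (wS (m := m) S W) A := by
      funext A
      unfold cnt
      simp only [Finset.mul_sum]
      rw [Finset.sum_comm]
      apply Finset.sum_congr rfl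
      intro t _
      by_cases ht : t = .leaf
      · rw [Finset.sum_eq_zero]
        · simp [nl, ht]
        · intro W _
          simp [wS, ht]
      · rw [Finset.sum_eq_single_of_mem (startF m t.sh) (Finset.mem_powerset.2 Finset.inter_subset_right)]
        · have := lam_connF hmax hE (zero_mem_sh ht) (by omega : s ≤ m) (S := S)
          by_cases hl : s = 0 ∨ lam S E s t.sh
          · rw [if_pos (this.1 hl)]; simp [nl, ht, gL, hl, wS]
          · rw [if_neg (fun h => hl (this.2 h))]; simp [nl, ht, gL, hl]
        · intro W _ hW
          have : wS S W t = 0 := if_neg (fun h => hW h.2.symm)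
          rw [this, mul_zero]
    rw [h2, gf_sum, Finset.mul_sum]
    apply Finset.sum_congr rfl
    intro W _
    by_cases hc : s ∈ connF S m (E ∩ Finset.Icc 1 (m - 1)) W
    · rw [if_pos hc, if_pos hc]; simp [FUm]
    · rw [if_neg hc, if_neg hc]
      rw [gf_smul]; simp
  rw [Finset.sum_congr rfl h1, Finset.sum_comm]
  apply Finset.sum_congr rfl
  intro W _
  rw [Cval, Finset.sum_mul, ← Finset.sum_filter]
  apply Finset.sum_congr _ (fun _ _ => rfl)
  ext s
  simp only [connF, Finset.mem_filter]
  tauto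

end shadow


section final
variable {m : ℕ} {S : Set ℤ}

lemma Yg_eq : Yg m S = 1 + ∑ U ∈ (Finset.Icc 1 (m - 1)).powerset, FUm m S U := by
  have h1 : cnt (wY (m := m) S) = fun A => cnt (dl (m := m)) A + ∑ U ∈ (Finset.Icc 1 (m - 1)).powerset, cnt (wS (m := m) S U) A := by
    funext A
    unfold cnt
    rw [Finset.sum_comm, ← Finset.sum_add_distrib]
    apply Finset.sum_congr rfl
    intro t _
    by_cases ht : t = .leaf
    · rw [Finset.sum_eq_zero]
      · simp [ht, dl, wY, MT.V, MT.bl]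
      · intro W _
        simp [wS, ht]
    · rw [Finset.sum_eq_single_of_mem (startF m t.sh) (Finset.mem_powerset.2 Finset.inter_subset_right)]
      · simp [dl, ht, wS]
      · intro W _ hW
        exact if_neg (fun h => hW h.2.symm)
  rw [Yg, h1, gf_add, gf_sum]
  congr 1
  have : cnt (dl (m := m)) = fun A => if A = ∅ then 1 else 0 := by
    funext A
    exact cnt_dl A
  rw [this, gf_delta]

noncomputable def Qn (m n : ℕ) : Finset (Finset ℕ) :=
  (Finset.range (n * m + 1)).powerset ∪ (TS m (Finset.range n)).image MT.sh

lemma FUm_coeff (U : Finset ℕ) (n : ℕ) : PowerSeries.coeff n (FUm m S U) =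
    ∑ D ∈ (Qn m n).filter (fun D => 0 ∈ D ∧ startF m D = U), PowerSeries.coeff n (gf (cnt (wt (m := m) S {0} D))) := by
  simp only [FUm, gf, PowerSeries.coeff_mk]
  rw [← Finset.mul_sum]
  congr 1
  unfold cnt
  rw [Finset.sum_comm]
  apply Finset.sum_congr rfl
  intro t ht
  by_cases hl : t = .leaf
  · rw [Finset.sum_eq_zero]
    · simp [wS, hl]
    · intro D hD
      rw [hl, wt_leaf (Finset.mem_filter.1 hD).2.1]
  · have hq : t.sh ∈ Qn m n := Finset.mem_union_right _ (Finset.mem_image_of_mem _ ht)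
    by_cases hs : startF m t.sh = U
    · rw [Finset.sum_eq_single_of_mem t.sh (Finset.mem_filter.2 ⟨hq, zero_mem_sh hl, hs⟩)]
      · simp [wS, hl, hs, wt, wY]
      · intro D _ hD
        exact if_neg (fun h => hD h.2.symm)
    · rw [Finset.sum_eq_zero]
      · exact if_neg (fun h => hs h.2)
      · intro D hD
        rw [Finset.mem_filter] at hD
        refine if_neg (fun h => hs ?_)
        rw [h.2]; exact hD.2.2

noncomputable def DQ (m n : ℕ) (S : Set ℤ) (U V : Finset ℕ) : PowerSeries RR :=
  ∑ D ∈ (Qn m n).filter (fun D => D ∈ shadowUV S m U V), (Eexp - 1) ^ D.card * Yg m S ^ (D.sup id)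

lemma coeff_small {k p : ℕ} (h : p < k) (G : PowerSeries RR) : PowerSeries.coeff p ((Eexp - 1) ^ k * G) = 0 := by
  have : (PowerSeries.X : PowerSeries RR) ∣ Eexp - 1 := by
    rw [PowerSeries.X_dvd_iff]
    simp [Eexp]
  obtain ⟨H, hH⟩ := this
  rw [hH, mul_pow, mul_assoc, PowerSeries.coeff_X_pow_mul', if_neg (by omega)]

lemma coeff_Dval (hY : Yg m S = FGF S) (hsym : ∀ s : ℤ, s ∈ S ↔ -s ∈ S)
    (hclosed : ∀ s t : ℕ, (s : ℤ) ∉ S → (t : ℤ) ∉ S → ((s : ℤ) + (t : ℤ)) ∉ S)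
    (hmax : ∀ s ∈ S, s ≤ (m : ℤ)) {n p : ℕ} (hp : p ≤ n) (U V : Finset ℕ) :
    PowerSeries.coeff p (Dval S m U V) = PowerSeries.coeff p (DQ m n S U V) := by
  simp only [Dval, DQ, PowerSeries.coeff_mk, map_sum, ← hY]
  rw [finsum_mem_eq_sum_of_inter_support_eq]
  ext D
  simp only [Set.mem_inter_iff, Finset.coe_filter, Function.mem_support, Set.mem_ofPred_eq]
  constructor
  · rintro ⟨h1, h2⟩
    refine ⟨⟨?_, h1⟩, h2⟩
    have hc : D.card ≤ n := by
      by_contra hc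
      exact h2 (coeff_small (by omega) _)
    have hs := h1.1
    have := link_sup_le hmax D hs.1 {0} (by simp) ((link_shadow hsym hclosed hs.1).2 hs)
    apply Finset.mem_union_left
    rw [Finset.mem_powerset]
    intro d hd
    have h3 : id d ≤ D.sup id := Finset.le_sup hd
    have h4 : D.card * m ≤ n * m := Nat.mul_le_mul_right _ hc
    rw [Finset.mem_range]
    simp only [id] at h3
    omega
  · rintro ⟨⟨_, h1⟩, h2⟩
    exact ⟨h1, h2⟩

lemma coeff_mul_congr {A B : PowerSeries RR} {n : ℕ} (h : ∀ p ≤ n, PowerSeries.coeff p A = PowerSeries.coeff p B)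
    (G : PowerSeries RR) : PowerSeries.coeff n (A * G) = PowerSeries.coeff n (B * G) := by
  rw [PowerSeries.coeff_mul, PowerSeries.coeff_mul]
  apply Finset.sum_congr rfl
  rintro ⟨i, j⟩ hij
  rw [Finset.HasAntidiagonal.mem_antidiagonal] at hij
  simp only at hij ⊢
  rw [h i (by omega)]

/-- the bracket -/
noncomputable def GV (m : ℕ) (S : Set ℤ) (V : Finset ℕ) : PowerSeries RR :=
  1 + ∑ W ∈ (Finset.Icc 1 (m - 1)).powerset, Cval S m V W (Yg m S) * FUm m S W

/-- regrouping by end -/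
lemma regroup (U : Finset ℕ) (Q : Finset (Finset ℕ)) :
    ∑ D ∈ Q.filter (fun D => IsShadowF S D ∧ startF m D = U),
      (Eexp - 1) ^ D.card * Yg m S ^ (D.sup id) * (Useries * GV m S (endF m D)) =
    ∑ V ∈ (Finset.Icc 1 (m - 1)).powerset,
      Useries * (∑ D ∈ Q.filter (fun D => D ∈ shadowUV S m U V), (Eexp - 1) ^ D.card * Yg m S ^ (D.sup id)) * GV m S V := by
  rw [← Finset.sum_fiberwise_of_maps_to (s := Q.filter (fun D => IsShadowF S D ∧ startF m D = U))
    (t := (Finset.Icc 1 (m - 1)).powerset) (g := endF m)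
    (fun D _ => Finset.mem_powerset.2 Finset.inter_subset_right)]
  apply Finset.sum_congr rfl
  intro V _
  rw [Finset.mul_sum, Finset.sum_mul, Finset.filter_filter]
  apply Finset.sum_congr
  · ext D
    rw [Finset.mem_filter, Finset.mem_filter]
    simp only [shadowUV, Set.mem_ofPred_eq]
    tauto
  · intro D hD
    have : endF m D = V := by
      have := (Finset.mem_filter.1 hD).2
      exact this.2.2
    rw [this]; ring

lemma shadow_sum (hsym : ∀ s : ℤ, s ∈ S ↔ -s ∈ S)
    (hclosed : ∀ s t : ℕ, (s : ℤ) ∉ S → (t : ℤ) ∉ S → ((s : ℤ) + (t : ℤ)) ∉ S)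
    (hmax : ∀ s ∈ S, s ≤ (m : ℤ)) (U : Finset ℕ) (Q : Finset (Finset ℕ)) (hQ : (0 : ℤ) ∈ S ∨ ∀ D ∈ Q, startF m D = U → D ≠ {0}) :
    ∑ D ∈ Q.filter (fun D => 0 ∈ D ∧ startF m D = U), gf (cnt (wt (m := m) S {0} D)) =
    ∑ V ∈ (Finset.Icc 1 (m - 1)).powerset,
      Useries * (∑ D ∈ Q.filter (fun D => D ∈ shadowUV S m U V), (Eexp - 1) ^ D.card * Yg m S ^ (D.sup id)) * GV m S V := by
  rw [← regroup]
  have h1 : ∀ D ∈ Q.filter (fun D => 0 ∈ D ∧ startF m D = U), gf (cnt (wt (m := m) S {0} D)) =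
      if IsShadowF S D then (Eexp - 1) ^ D.card * Yg m S ^ (D.sup id) * (Useries * GV m S (endF m D)) else 0 := by
    intro D hD
    rw [Finset.mem_filter] at hD
    rw [gf_shadow hsym hclosed hmax hD.2.1 (hQ.imp id (fun h => h D hD.1 hD.2.2)), gf_ell' hmax (zero_mem_endE hD.2.1)]
    rfl
  rw [Finset.sum_congr rfl h1, ← Finset.sum_filter, Finset.filter_filter]
  apply Finset.sum_congr _ (fun _ _ => rfl)
  ext D
  simp only [Finset.mem_filter]
  constructor
  · rintro ⟨a, b, c⟩; exact ⟨a, c, b.2⟩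
  · rintro ⟨a, b, c⟩; exact ⟨a, ⟨b.1, c⟩, b⟩

lemma final_a (hY : Yg m S = FGF S) (hsym : ∀ s : ℤ, s ∈ S ↔ -s ∈ S)
    (hclosed : ∀ s t : ℕ, (s : ℤ) ∉ S → (t : ℤ) ∉ S → ((s : ℤ) + (t : ℤ)) ∉ S)
    (hmax : ∀ s ∈ S, s ≤ (m : ℤ)) (U : Finset ℕ) (hU : (0 : ℤ) ∈ S ∨ U ≠ ∅) :
    FUm m S U = ∑ V ∈ (Finset.Icc 1 (m - 1)).powerset, Useries * Dval S m U V * GV m S V := by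
  ext1 n
  rw [FUm_coeff, ← map_sum, shadow_sum hsym hclosed hmax, map_sum, map_sum]
  · apply Finset.sum_congr rfl
    intro V _
    rw [mul_comm Useries, mul_comm Useries, mul_assoc, mul_assoc]
    exact (coeff_mul_congr (fun p hp => coeff_Dval hY hsym hclosed hmax hp U V) _).symm
  · refine hU.imp id (fun h D _ hs hD => h ?_)
    rw [← hs, hD]
    ext x; simp [startF]

lemma isShadow_zero : IsShadowF S {0} := by
  refine ⟨by simp, ?_⟩
  intro i hi j hj
  rw [Finset.mem_singleton] at hi hj
  rw [hi, hj]

lemma final_b (hY : Yg m S = FGF S) (hsym : ∀ s : ℤ, s ∈ S ↔ -s ∈ S)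
    (hclosed : ∀ s t : ℕ, (s : ℤ) ∉ S → (t : ℤ) ∉ S → ((s : ℤ) + (t : ℤ)) ∉ S)
    (hmax : ∀ s ∈ S, s ≤ (m : ℤ)) (h0 : (0 : ℤ) ∉ S) :
    FUm m S ∅ = (1 - EexuNeg) * GV m S ∅ + ∑ V ∈ (Finset.Icc 1 (m - 1)).powerset,
      Useries * (Dval S m ∅ V - (if V = ∅ then Eexp - 1 else 0)) * GV m S V := by
  have hst : startF m {0} = ∅ := by
    ext x; simp [startF]
  have hen : endF m {0} = ∅ := by
    ext x; simp [endF]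
  have hbase : gf (cnt (wt (m := m) S {0} {0})) = (1 - EexuNeg) * GV m S ∅ := by
    rw [gf_base2 h0, gf_ell' hmax (by simp)]
    have : ({0} : Finset ℕ) ∩ Finset.Icc 1 (m - 1) = ∅ := hst
    rw [this]; rfl
  ext1 n
  have hmem : ({0} : Finset ℕ) ∈ Qn m n := by
    apply Finset.mem_union_left
    simp
  have hfil : (Qn m n).filter (fun D => 0 ∈ D ∧ startF m D = ∅) =
      insert {0} (((Qn m n).erase {0}).filter (fun D => 0 ∈ D ∧ startF m D = ∅)) := by
    ext D
    simp only [Finset.mem_filter, Finset.mem_insert, Finset.mem_erase]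
    by_cases hD : D = {0}
    · subst hD; simp [hmem, hst]
    · simp [hD]
  rw [FUm_coeff, ← map_sum, hfil, Finset.sum_insert (by simp), hbase,
    shadow_sum hsym hclosed hmax ∅ ((Qn m n).erase {0}) (Or.inr (fun D hD _ => (Finset.mem_erase.1 hD).1)),
    map_add, map_add, map_sum, map_sum]
  refine congrArg₂ (· + ·) rfl ?_
  apply Finset.sum_congr rfl
  intro V _
  have hDQ : (∑ D ∈ ((Qn m n).erase {0}).filter (fun D => D ∈ shadowUV S m ∅ V), (Eexp - 1) ^ D.card * Yg m S ^ (D.sup id)) =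
      DQ m n S ∅ V - (if V = ∅ then Eexp - 1 else 0) := by
    unfold DQ
    by_cases hV : V = ∅
    · rw [if_pos hV]
      have : (Qn m n).filter (fun D => D ∈ shadowUV S m ∅ V) =
          insert {0} (((Qn m n).erase {0}).filter (fun D => D ∈ shadowUV S m ∅ V)) := by
        ext D
        simp only [Finset.mem_filter, Finset.mem_insert, Finset.mem_erase]
        by_cases hD : D = {0}
        · subst hD
          have : ({0} : Finset ℕ) ∈ shadowUV S m ∅ V := ⟨isShadow_zero, hst, by rw [hen, hV]⟩
          simp [hmem, this]
        · simp [hD]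
      rw [this, Finset.sum_insert (by simp)]
      simp
    · rw [if_neg hV, sub_zero]
      apply Finset.sum_congr _ (fun _ _ => rfl)
      ext D
      simp only [Finset.mem_filter, Finset.mem_erase]
      by_cases hD : D = {0}
      · subst hD
        have : ({0} : Finset ℕ) ∉ shadowUV S m ∅ V := fun h => hV (by rw [← h.2.2, hen])
        simp [this]
      · simp [hD]
  rw [hDQ]
  rw [mul_comm Useries, mul_comm Useries, mul_assoc, mul_assoc]
  refine (coeff_mul_congr (fun p hp => ?_) _).symm
  rw [map_sub, map_sub, coeff_Dval hY hsym hclosed hmax hp ∅ V]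

theorem final_all (hY : Yg m S = FGF S) (hF : ∀ U ∈ (Finset.Icc 1 (m - 1)).powerset, FUm m S U = FU S m U)
    (hsym : ∀ s : ℤ, s ∈ S ↔ -s ∈ S)
    (hclosed : ∀ s t : ℕ, (s : ℤ) ∉ S → (t : ℤ) ∉ S → ((s : ℤ) + (t : ℤ)) ∉ S)
    (hmax : ∀ s ∈ S, s ≤ (m : ℤ)) :
    FGF S = 1 + ∑ U ∈ (Finset.Icc 1 (m - 1)).powerset, FU S m U ∧
    (∀ U ∈ (Finset.Icc 1 (m - 1)).powerset, ((0 : ℤ) ∈ S ∨ U ≠ ∅) →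
      FU S m U = ∑ V ∈ (Finset.Icc 1 (m - 1)).powerset,
        Useries * Dval S m U V *
          (1 + ∑ W ∈ (Finset.Icc 1 (m - 1)).powerset, Cval S m V W (FGF S) * FU S m W)) ∧
    ((0 : ℤ) ∉ S →
      FU S m ∅ =
        (1 - EexuNeg) *
            (1 + ∑ V ∈ (Finset.Icc 1 (m - 1)).powerset, Cval S m ∅ V (FGF S) * FU S m V) +
          ∑ V ∈ (Finset.Icc 1 (m - 1)).powerset,
            Useries * (Dval S m ∅ V - (if V = ∅ then Eexp - 1 else 0)) *
              (1 + ∑ W ∈ (Finset.Icc 1 (m - 1)).powerset,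
                Cval S m V W (FGF S) * FU S m W)) := by
  have hG : ∀ V, GV m S V = 1 + ∑ W ∈ (Finset.Icc 1 (m - 1)).powerset, Cval S m V W (FGF S) * FU S m W := by
    intro V
    unfold GV
    rw [hY]
    exact congrArg₂ (· + ·) rfl (Finset.sum_congr rfl (fun W hW => by rw [hF W hW]))
  refine ⟨?_, ?_, ?_⟩
  · rw [← hY, Yg_eq]
    exact congrArg₂ (· + ·) rfl (Finset.sum_congr rfl hF)
  · intro U hU hU'
    rw [← hF U hU, final_a hY hsym hclosed hmax U hU']
    exact Finset.sum_congr rfl (fun V _ => by rw [hG])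
  · intro h0
    rw [← hF ∅ (by simp), final_b hY hsym hclosed hmax h0, hG]
    exact congrArg₂ (· + ·) rfl (Finset.sum_congr rfl (fun V _ => by rw [hG]))

end final


section bij
variable {m n : ℕ} {S : Set ℤ}

/-- `t` represents the subtree of `(T, μ)` at position `p`. -/
def RS (T : Tree m n) (μ : Set (Fin n)) : MT m → List ℕ → Prop
  | .leaf, p => ∀ v, T.path v ≠ p
  | .node a mk ch, p => ∃ v : Fin n, T.path v = p ∧ (v : ℕ) = a ∧
      (mk = true ↔ ∃ w, Edge T μ v w) ∧ ∀ c : Fin (m + 1), RS T μ (ch c) (p ++ [(c : ℕ)])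

variable {T : Tree m n} {μ : Set (Fin n)}

lemma RS_exists (T : Tree m n) (μ : Set (Fin n)) : ∀ k (p : List ℕ), (∀ v, (T.path v).length < p.length + k) → ∃ t, RS T μ t p := by
  intro k
  induction k with
  | zero =>
    intro p h
    refine ⟨.leaf, fun v hv => ?_⟩
    have := h v
    rw [hv] at this; omega
  | succ k ih =>
    intro p h
    by_cases hv : ∃ v, T.path v = p
    · obtain ⟨v, hv⟩ := hv
      choose f hf using fun c : Fin (m + 1) => ih (p ++ [(c : ℕ)]) (fun w => by
        have := h w
        simp only [List.length_append, List.length_singleton]; omega)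
      by_cases hm : ∃ w, Edge T μ v w
      · exact ⟨.node v true f, v, hv, rfl, by simp [hm], hf⟩
      · exact ⟨.node v false f, v, hv, rfl, by simp [hm], hf⟩
    · push Not at hv
      exact ⟨.leaf, hv⟩

lemma RS_exists_root (T : Tree m n) (μ : Set (Fin n)) : ∃ t, RS T μ t [] := by
  apply RS_exists T μ ((Finset.univ.sup fun v => (T.path v).length) + 1)
  intro v
  have : (T.path v).length ≤ Finset.univ.sup fun v => (T.path v).length :=
    Finset.le_sup (f := fun v => (T.path v).length) (Finset.mem_univ v)
  simp only [List.length_nil]; omega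

lemma RS_unique : ∀ (t t' : MT m) (p : List ℕ), RS T μ t p → RS T μ t' p → t = t' := by
  intro t
  induction t with
  | leaf =>
    intro t' p h h'
    cases t' with
    | leaf => rfl
    | node a mk ch =>
      obtain ⟨v, hv, _⟩ := h'
      exact absurd hv (h v)
  | node a mk ch ih =>
    intro t' p h h'
    cases t' with
    | leaf =>
      obtain ⟨v, hv, _⟩ := h
      exact absurd hv (h' v)
    | node a' mk' ch' =>
      obtain ⟨v, hv, ha, hm, hc⟩ := h
      obtain ⟨v', hv', ha', hm', hc'⟩ := h'
      have : v = v' := T.inj (hv.trans hv'.symm)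
      subst this
      have e1 : a = a' := by rw [← ha, ← ha']
      have e2 : mk = mk' := by rw [Bool.eq_iff_iff, hm, hm']
      have e3 : ch = ch' := by
        funext c
        exact ih c _ _ (hc c) (hc' c)
      rw [e1, e2, e3]

lemma prefix_child {p : List ℕ} {i : Fin n} (h : p <+: T.path i) :
    T.path i = p ∨ ∃ c : Fin (m + 1), p ++ [(c : ℕ)] <+: T.path i := by
  obtain ⟨q, hq⟩ := h
  cases q with
  | nil => left; simpa using hq.symm
  | cons c q =>
    right
    have hc : c ≤ m := T.entry_le i c (by rw [← hq]; simp)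
    exact ⟨⟨c, by omega⟩, q, by simpa using hq⟩

lemma prefix_of_child {p : List ℕ} {q : List ℕ} {c : ℕ} (h : p ++ [c] <+: q) : p <+: q :=
  (List.prefix_append p [c]).trans h

lemma prefix_child_ne {p q : List ℕ} {c : ℕ} (h : p ++ [c] <+: q) : q ≠ p := by
  intro e
  have := h.length_le
  rw [e] at this
  simp at this

lemma prefix_child_inj {p q : List ℕ} {c c' : ℕ} (h : p ++ [c] <+: q) (h' : p ++ [c'] <+: q) : c = c' := by
  have := List.prefix_of_prefix_length_le h h' (by simp)
  have := this.eq_of_length (by simp)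
  simpa using this

lemma RS_path {T' : Tree m n} {μ' : Set (Fin n)} : ∀ (t : MT m) (p : List ℕ), RS T μ t p → RS T' μ' t p →
    ∀ v, p <+: T.path v → T'.path v = T.path v := by
  intro t
  induction t with
  | leaf =>
    intro p h h' v hv
    obtain ⟨w, hw⟩ := prefix_node T _ v p rfl hv
    exact absurd hw (h w)
  | node a mk ch ih =>
    intro p h h' v hv
    obtain ⟨w, hw, ha, hm, hc⟩ := h
    obtain ⟨w', hw', ha', hm', hc'⟩ := h'
    have hww : w = w' := Fin.ext (ha.trans ha'.symm)
    subst hww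
    rcases prefix_child hv with e | ⟨c, hcv⟩
    · have : v = w := T.inj (e.trans hw.symm)
      rw [this, hw, hw']
    · exact ih c _ (hc c) (hc' c) v hcv

lemma RS_mark {μ' : Set (Fin n)} : ∀ (t : MT m) (p : List ℕ), RS T μ t p → RS T μ' t p →
    ∀ v, p <+: T.path v → ((∃ w, Edge T μ v w) ↔ (∃ w, Edge T μ' v w)) := by
  intro t
  induction t with
  | leaf =>
    intro p h h' v hv
    obtain ⟨w, hw⟩ := prefix_node T _ v p rfl hv
    exact absurd hw (h w)
  | node a mk ch ih =>
    intro p h h' v hv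
    obtain ⟨w, hw, ha, hm, hc⟩ := h
    obtain ⟨w', hw', ha', hm', hc'⟩ := h'
    have hww : w = w' := Fin.ext (ha.trans ha'.symm)
    subst hww
    rcases prefix_child hv with e | ⟨c, hcv⟩
    · have : v = w := T.inj (e.trans hw.symm)
      rw [this, ← hm, ← hm']
    · exact ih c _ (hc c) (hc' c) v hcv

/-- marked children are cadets -/
lemma edge_cadet (hμ : IsMarking T μ) {v w : Fin n} (h : Edge T μ v w) : ∃ s, T.IsCadet w v s ∧ (s = 0 → (v : ℕ) < w) := by
  obtain ⟨hw, s, hs⟩ := h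
  obtain ⟨j, s', hc, hl⟩ := hμ w hw
  obtain ⟨rfl, rfl⟩ := child_unique hc.1 hs
  exact ⟨s', hc, hl⟩

lemma edge_unique (hμ : IsMarking T μ) {v w w' : Fin n} (h : Edge T μ v w) (h' : Edge T μ v w') : w = w' := by
  obtain ⟨s, hs, _⟩ := edge_cadet hμ h
  obtain ⟨s', hs', _⟩ := edge_cadet hμ h'
  exact (cadet_unique hs hs').1

lemma RS_inj {T' : Tree m n} {μ' : Set (Fin n)} (hμ : IsMarking T μ) (hμ' : IsMarking T' μ') {t : MT m}
    (h : RS T μ t []) (h' : RS T' μ' t []) : (T, μ) = (T', μ') := by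
  have e : T = T' := by
    have : T.path = T'.path := by
      funext v
      exact (RS_path t [] h h' v (List.nil_prefix)).symm
    cases T; cases T'; cases this; rfl
  subst e
  have key : ∀ {μ μ' : Set (Fin n)}, IsMarking T μ → IsMarking T μ' → RS T μ t [] → RS T μ' t [] → μ ⊆ μ' := by
    intro μ μ' hμ hμ' h h' v hv
    obtain ⟨j, s, hc, _⟩ := hμ v hv
    obtain ⟨w, hw⟩ := (RS_mark t [] h h' j List.nil_prefix).1 ⟨v, hv, s, hc.1⟩
    obtain ⟨s', hs', _⟩ := edge_cadet hμ' hw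
    rw [(cadet_unique hc hs').1]
    exact hw.1
  rw [Set.Subset.antisymm (key hμ hμ' h h') (key hμ' hμ h' h)]

noncomputable def Fp (T : Tree m n) (p : List ℕ) : Finset (Fin n) := Finset.univ.filter (fun v => p <+: T.path v)

lemma mem_Fp {p : List ℕ} {v : Fin n} : v ∈ Fp T p ↔ p <+: T.path v := by simp [Fp]

lemma sum_Fp {M : Type*} [AddCommMonoid M] (f : Fin n → M) {v : Fin n} {p : List ℕ} (hv : T.path v = p) :
    ∑ i ∈ Fp T p, f i = f v + ∑ c : Fin (m + 1), ∑ i ∈ Fp T (p ++ [(c : ℕ)]), f i := by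
  have : Fp T p = insert v (Finset.univ.biUnion (fun c : Fin (m + 1) => Fp T (p ++ [(c : ℕ)]))) := by
    ext i
    simp only [Finset.mem_insert, Finset.mem_biUnion, Finset.mem_univ, true_and, mem_Fp]
    constructor
    · intro h
      rcases prefix_child h with e | h
      · exact Or.inl (T.inj (e.trans hv.symm))
      · exact Or.inr h
    · rintro (rfl | ⟨c, h⟩)
      · rw [hv]
      · exact prefix_of_child h
  rw [this, Finset.sum_insert, Finset.sum_biUnion]
  · intro c _ c' _ hcc
    rw [Function.onFun, Finset.disjoint_left]
    intro i h h'
    rw [mem_Fp] at h h'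
    exact hcc (Fin.ext (prefix_child_inj h h'))
  · simp only [Finset.mem_biUnion, Finset.mem_univ, true_and, mem_Fp, not_exists]
    intro c h
    exact prefix_child_ne h hv

lemma RS_lab : ∀ (t : MT m) (p : List ℕ), RS T μ t p → t.lab = ∑ i ∈ Fp T p, {(i : ℕ)} := by
  intro t
  induction t with
  | leaf =>
    intro p h
    have : Fp T p = ∅ := by
      ext i
      simp only [mem_Fp, Finset.notMem_empty, iff_false]
      intro hi
      obtain ⟨w, hw⟩ := prefix_node T _ i p rfl hi
      exact h w hw
    rw [this]; rfl
  | node a mk ch ih =>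
    rintro p ⟨v, hv, ha, hm, hc⟩
    rw [sum_Fp _ hv]
    simp only [MT.lab]
    rw [Finset.sum_congr rfl (fun c _ => ih c _ (hc c)), ha, Multiset.singleton_add]

lemma RS_bl : ∀ (t : MT m) (p : List ℕ), RS T μ t p → t.bl = ∑ i ∈ Fp T p, if (∃ w, Edge T μ i w) then 0 else 1 := by
  intro t
  induction t with
  | leaf =>
    intro p h
    have : Fp T p = ∅ := by
      ext i
      simp only [mem_Fp, Finset.notMem_empty, iff_false]
      intro hi
      obtain ⟨w, hw⟩ := prefix_node T _ i p rfl hi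
      exact h w hw
    rw [this]; rfl
  | node a mk ch ih =>
    rintro p ⟨v, hv, ha, hm, hc⟩
    rw [sum_Fp _ hv]
    simp only [MT.bl]
    rw [Finset.sum_congr rfl (fun c _ => ih c _ (hc c))]
    congr 1
    by_cases h : mk = true
    · rw [if_pos h, if_pos (hm.1 h)]
    · rw [if_neg h, if_neg (fun h' => h (hm.2 h'))]

lemma Fp_nil : Fp T [] = Finset.univ := by
  ext i; simp [mem_Fp]

lemma RS_lab_root {t : MT m} (h : RS T μ t []) : t ∈ TS m (Finset.range n) := by
  rw [mem_TS, RS_lab t [] h, Fp_nil, Fin.sum_univ_eq_sum_range (fun i => ({i} : Multiset ℕ)) n, Finset.sum_multiset_singleton]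

lemma RS_bl_root (hμ : IsMarking T μ) {t : MT m} (h : RS T μ t []) : t.bl = (blocksOf T μ).ncard := by
  rw [blocks_ncard hμ, RS_bl t [] h, Fp_nil]
  have h1 : ∑ i : Fin n, (if (∃ w, Edge T μ i w) then 0 else 1) = (Finset.univ.filter (fun i => ¬ ∃ w, Edge T μ i w)).card := by
    rw [Finset.card_filter]
    apply Finset.sum_congr rfl
    intro i _
    by_cases hi : ∃ w, Edge T μ i w
    · rw [if_pos hi, if_neg (not_not.2 hi)]
    · rw [if_neg hi, if_pos hi]
  rw [h1]
  have h2 := Finset.card_filter_add_card_filter_not (s := (Finset.univ : Finset (Fin n))) (fun i => ∃ w, Edge T μ i w)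
  have h3 : (Finset.univ.filter (fun i => ∃ w, Edge T μ i w)).card = μ.ncard := by
    rw [Set.ncard_eq_toFinset_card']
    symm
    refine Finset.card_bij (fun w hw => (hμ w (by simpa using hw)).choose) ?_ ?_ ?_
    · intro w hw
      obtain ⟨s, hs, _⟩ := (hμ w (by simpa using hw)).choose_spec
      simp only [Finset.mem_filter, Finset.mem_univ, true_and]
      exact ⟨w, by simpa using hw, s, hs.1⟩
    · intro w hw w' hw' e
      obtain ⟨s, hs, _⟩ := (hμ w (by simpa using hw)).choose_spec
      obtain ⟨s', hs', _⟩ := (hμ w' (by simpa using hw')).choose_spec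
      rw [e] at hs
      exact (cadet_unique hs hs').1
    · intro v hv
      simp only [Finset.mem_filter, Finset.mem_univ, true_and] at hv
      obtain ⟨w, hw, s, hs⟩ := hv
      refine ⟨w, by simpa using hw, ?_⟩
      obtain ⟨s', hs', _⟩ := (hμ w hw).choose_spec
      exact (child_unique hs'.1 hs).1
  rw [Finset.card_univ, Fintype.card_fin] at h2
  omega

lemma RS_nonleaf {t : MT m} {p : List ℕ} (h : RS T μ t p) : t ≠ .leaf ↔ ∃ v, T.path v = p := by
  cases t with
  | leaf =>
    simp only [ne_eq, not_true_eq_false, false_iff, not_exists]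
    exact h
  | node a mk ch =>
    obtain ⟨v, hv, _⟩ := h
    simp only [ne_eq, reduceCtorEq, not_false_eq_true, true_iff]
    exact ⟨v, hv⟩

lemma RS_rt {t : MT m} {p : List ℕ} (h : RS T μ t p) {v : Fin n} (hv : T.path v = p) : t.rt = v := by
  cases t with
  | leaf => exact absurd hv (h v)
  | node a mk ch =>
    obtain ⟨v', hv', ha, _⟩ := h
    have : v = v' := T.inj (hv.trans hv'.symm)
    rw [this, ha]; rfl

lemma RS_cad {ch : Fin (m + 1) → MT m} {p : List ℕ} (h : ∀ c : Fin (m + 1), RS T μ (ch c) (p ++ [(c : ℕ)])) {v w : Fin n}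
    (hv : T.path v = p) {c : Fin (m + 1)} (hw : T.path w = p ++ [(c : ℕ)]) : IsCad ch c ↔ T.IsCadet w v c := by
  unfold IsCad Tree.IsCadet Tree.IsChild Tree.SlotNode Tree.IsChild
  rw [RS_nonleaf (h c), hv]
  constructor
  · rintro ⟨_, h2⟩
    refine ⟨hw, ?_⟩
    rintro t ht htm ⟨i, hi⟩
    have h3 := h2 ⟨t, by omega⟩ (by rw [Fin.lt_def]; exact ht)
    have h4 := h ⟨t, by omega⟩
    rw [h3] at h4
    exact h4 i hi
  · rintro ⟨_, h2⟩
    refine ⟨⟨w, hw⟩, ?_⟩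
    intro c' hc'
    by_contra hne
    obtain ⟨i, hi⟩ := (RS_nonleaf (h c')).1 hne
    exact h2 c' hc' (by have := c'.2; omega) ⟨i, hi⟩

lemma RS_edge (hμ : IsMarking T μ) {ch : Fin (m + 1) → MT m} {p : List ℕ} (h : ∀ c : Fin (m + 1), RS T μ (ch c) (p ++ [(c : ℕ)])) {v w : Fin n}
    (hv : T.path v = p) {mk : Bool} (hm : mk = true ↔ ∃ w, Edge T μ v w) {c : Fin (m + 1)} (hw : T.path w = p ++ [(c : ℕ)]) :
    (IsCad ch c ∧ mk = true) ↔ w ∈ μ := by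
  have hch : T.IsChild w v c := by unfold Tree.IsChild; rw [hv, hw]
  rw [RS_cad h hv hw, hm]
  constructor
  · rintro ⟨h1, w', h2⟩
    obtain ⟨s, hs, _⟩ := edge_cadet hμ h2
    rw [(cadet_unique h1 hs).1]
    exact h2.1
  · intro hwμ
    have he : Edge T μ v w := ⟨hwμ, c, hch⟩
    obtain ⟨s, hs, _⟩ := edge_cadet hμ he
    have := (child_unique hs.1 hch).2
    rw [this] at hs
    exact ⟨hs, w, he⟩

lemma RS_sh (hμ : IsMarking T μ) : ∀ (t : MT m) (p : List ℕ), RS T μ t p → ∀ v, T.path v = p →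
    ∀ d, d ∈ t.sh ↔ ∃ i, Ch T μ v i ∧ T.drift i = T.drift v + d := by
  intro t
  induction t with
  | leaf => intro p h v hv; exact absurd hv (h v)
  | node a mk ch ih =>
    rintro p ⟨v', hv', ha, hm, hc⟩ v hv d
    have : v' = v := T.inj (hv'.trans hv.symm)
    subst this
    simp only [MT.sh, Finset.mem_insert]
    constructor
    · rintro (rfl | h)
      · exact ⟨v', Relation.ReflTransGen.refl, by simp⟩
      · by_cases hmk : mk = true
        · rw [if_pos hmk, Finset.mem_biUnion] at h
          obtain ⟨c, _, h⟩ := h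
          by_cases hcad : IsCad ch c
          · rw [if_pos hcad, Finset.mem_image] at h
            obtain ⟨d', hd', rfl⟩ := h
            obtain ⟨w, hw⟩ := (RS_nonleaf (hc c)).1 hcad.1
            obtain ⟨i, hi, hdr⟩ := (ih c _ (hc c) w hw d').1 hd'
            have hwμ := (RS_edge hμ hc hv hm hw).1 ⟨hcad, hmk⟩
            have hch : T.IsChild w v' c := by unfold Tree.IsChild; rw [hv, hw]
            refine ⟨i, Relation.ReflTransGen.head ⟨hwμ, c, hch⟩ hi, ?_⟩
            rw [hdr, child_drift hch]; ring
          · rw [if_neg hcad] at h; simp at h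
        · rw [if_neg hmk] at h; simp at h
    · rintro ⟨i, hi, hdr⟩
      rcases Relation.ReflTransGen.cases_head hi with rfl | ⟨w, hw, hwi⟩
      · left; omega
      · right
        obtain ⟨hwμ, s, hs⟩ := hw
        have hsm := child_le hs
        have hwp : T.path w = p ++ [((⟨s, by omega⟩ : Fin (m + 1)) : ℕ)] := by
          unfold Tree.IsChild at hs; rw [hs, hv]
        have h1 := (RS_edge hμ hc hv hm hwp).2 hwμ
        rw [if_pos h1.2, Finset.mem_biUnion]
        refine ⟨⟨s, by omega⟩, Finset.mem_univ _, ?_⟩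
        rw [if_pos h1.1, Finset.mem_image]
        have hle : T.drift w ≤ T.drift i := Ch.drift_le hwi
        have hd := child_drift hs
        exact ⟨T.drift i - T.drift w, (ih _ _ (hc _) w hwp _).2 ⟨i, hwi, by omega⟩, by simp only; omega⟩

lemma Ch_iff_tail {v w : Fin n} {s : ℕ} (hs : T.IsChild w v s) {j : Fin n} : Ch T μ j w ↔ j = w ∨ (w ∈ μ ∧ Ch T μ j v) := by
  constructor
  · intro h
    rcases Relation.ReflTransGen.cases_tail h with rfl | ⟨x, hx, hxw⟩
    · exact Or.inl rfl
    · obtain ⟨hw, s', hs'⟩ := hxw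
      obtain ⟨rfl, _⟩ := child_unique hs' hs
      exact Or.inr ⟨hw, hx⟩
  · rintro (rfl | ⟨hw, h⟩)
    · exact Relation.ReflTransGen.refl
    · exact Relation.ReflTransGen.tail h ⟨hw, s, hs⟩

lemma RS_V (hμ : IsMarking T μ) : ∀ (t : MT m) (p : List ℕ), RS T μ t p → ∀ E : Finset ℕ,
    (∀ v, T.path v = p → ∀ e, e ∈ E ↔ ∃ j, Ch T μ j v ∧ T.drift v = T.drift j + e) →
    (t.V S E ↔ ∀ i, p <+: T.path i → T.path i ≠ p → IsMkb T i → lnkP S T μ i) := by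
  intro t
  induction t with
  | leaf =>
    intro p h E hE
    simp only [MT.V, true_iff]
    intro i hi
    obtain ⟨w, hw⟩ := prefix_node T _ i p rfl hi
    exact absurd hw (h w)
  | node a mk ch ih =>
    rintro p ⟨v, hv, ha, hm, hc⟩ E hE
    have hEv := hE v hv
    have hkids : ∀ c w, T.path w = p ++ [((c : Fin (m + 1)) : ℕ)] → T.IsChild w v c := by
      intro c w hw; unfold Tree.IsChild; rw [hv, hw]
    -- the children
    have ihc : ∀ c, ((ch c).V S (if IsCad ch c ∧ mk = true then shf c E else {0}) ↔
        ∀ i, p ++ [(c : ℕ)] <+: T.path i → T.path i ≠ p ++ [(c : ℕ)] → IsMkb T i → lnkP S T μ i) := by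
      intro c
      apply ih c _ (hc c)
      intro w hw e
      have hch := hkids c w hw
      have hd := child_drift hch
      by_cases hwμ : w ∈ μ
      · rw [if_pos ((RS_edge hμ hc hv hm hw).2 hwμ), mem_shf]
        constructor
        · rintro (rfl | ⟨e', he', rfl⟩)
          · exact ⟨w, Relation.ReflTransGen.refl, by simp⟩
          · obtain ⟨j, hj, hjd⟩ := (hEv e').1 he'
            exact ⟨j, (Ch_iff_tail hch).2 (Or.inr ⟨hwμ, hj⟩), by omega⟩
        · rintro ⟨j, hj, hjd⟩
          rcases (Ch_iff_tail hch).1 hj with rfl | ⟨_, hj⟩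
          · left; omega
          · right
            have hle : T.drift j ≤ T.drift v := Ch.drift_le hj
            exact ⟨T.drift v - T.drift j, (hEv _).2 ⟨j, hj, by omega⟩, by omega⟩
      · rw [if_neg (fun h => hwμ ((RS_edge hμ hc hv hm hw).1 h)), Finset.mem_singleton]
        constructor
        · rintro rfl
          exact ⟨w, Relation.ReflTransGen.refl, by simp⟩
        · rintro ⟨j, hj, hjd⟩
          rcases (Ch_iff_tail hch).1 hj with rfl | ⟨h, _⟩
          · omega
          · exact absurd h hwμ
    -- the mark clause
    have hmk : mk = true → ∃ c, IsCad ch c ∧ ((c : ℕ) = 0 → a < (ch c).rt) := by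
      intro h
      obtain ⟨w, hw⟩ := hm.1 h
      obtain ⟨s, hs, hlt⟩ := edge_cadet hμ hw
      have hsm := child_le hs.1
      have hwp : T.path w = p ++ [((⟨s, by omega⟩ : Fin (m + 1)) : ℕ)] := by
        have := hs.1
        unfold Tree.IsChild at this; rw [this, hv]
      refine ⟨⟨s, by omega⟩, (RS_cad hc hv hwp).2 hs, ?_⟩
      rw [RS_rt (hc _) hwp, ← ha]
      exact hlt
    -- the cadet clause
    have hcad : ∀ c w, T.path w = p ++ [((c : Fin (m + 1)) : ℕ)] →
        ((IsCad ch c → ((c : ℕ) = 0 → a < (ch c).rt) → lam S E c (ch c).sh) ↔ (IsMkb T w → lnkP S T μ w)) := by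
      intro c w hw
      have hch := hkids c w hw
      have hd := child_drift hch
      have e1 : IsMkb T w ↔ (IsCad ch c ∧ ((c : ℕ) = 0 → a < (ch c).rt)) := by
        rw [RS_cad hc hv hw, RS_rt (hc _) hw, ← ha]
        constructor
        · rintro ⟨j, s, h1, h2⟩
          obtain ⟨rfl, rfl⟩ := child_unique h1.1 hch
          exact ⟨h1, h2⟩
        · rintro ⟨h1, h2⟩
          exact ⟨v, c, h1, h2⟩
      have e2 : lnkP S T μ w ↔ lam S E c (ch c).sh := by
        have hsh := RS_sh hμ _ _ (hc c) w hw
        constructor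
        · rintro ⟨j, s, h1, j', i', hj, hi, hS⟩
          obtain ⟨rfl, rfl⟩ := child_unique h1 hch
          have hle1 : T.drift j' ≤ T.drift j := Ch.drift_le hj
          have hle2 : T.drift w ≤ T.drift i' := Ch.drift_le hi
          refine ⟨T.drift j - T.drift j', (hEv _).2 ⟨j', hj, by omega⟩, T.drift i' - T.drift w, (hsh _).2 ⟨i', hi, by omega⟩, ?_⟩
          convert hS using 1
          omega
        · rintro ⟨e, he, d, hdd, hS⟩
          obtain ⟨j', hj, hjd⟩ := (hEv e).1 he
          obtain ⟨i', hi, hid⟩ := (hsh d).1 hdd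
          refine ⟨v, c, hch, j', i', hj, hi, ?_⟩
          convert hS using 1
          omega
      rw [e1, e2]; tauto
    simp only [MT.V]
    constructor
    · rintro ⟨_, h2, h3⟩ i hi hne
      rcases prefix_child hi with e | ⟨c, hci⟩
      · exact absurd e hne
      · by_cases hw : T.path i = p ++ [(c : ℕ)]
        · exact (hcad c i hw).1 (h2 c)
        · exact (ihc c).1 (h3 c) i hci hw
    · intro h
      refine ⟨hmk, ?_, ?_⟩
      · intro c hc1
        obtain ⟨w, hw⟩ := (RS_nonleaf (hc c)).1 hc1.1
        refine (hcad c w hw).2 (h w ?_ ?_) hc1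
        · rw [hw]; exact List.prefix_append _ _
        · rw [hw]; simp
      · intro c
        refine (ihc c).2 (fun i hi hne => h i (prefix_of_child hi) (prefix_child_ne hi))

lemma RS_V_root (hμ : IsMarking T μ) {t : MT m} (h : RS T μ t []) :
    t.V S {0} ↔ ∀ i, IsMkb T i → lnkP S T μ i := by
  rw [RS_V hμ t [] h {0}]
  · constructor
    · intro h i hi
      refine h i List.nil_prefix ?_ hi
      obtain ⟨j, s, hc, _⟩ := hi
      have := hc.1
      unfold Tree.IsChild at this
      rw [this]; simp
    · intro h i _ _ hi
      exact h i hi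
  · intro v hv e
    rw [Finset.mem_singleton]
    constructor
    · rintro rfl
      exact ⟨v, Relation.ReflTransGen.refl, by simp⟩
    · rintro ⟨j, hj, hd⟩
      have := hj.pathPre
      rw [hv, List.prefix_nil] at this
      have : j = v := T.inj (this.trans hv.symm)
      rw [this] at hd; omega

lemma RS_start (hμ : IsMarking T μ) {t : MT m} (h : RS T μ t []) (U : Finset ℕ) :
    (t ≠ .leaf ∧ startF m t.sh = U) ↔ ∃ r : Fin n, T.path r = [] ∧ rootStart T μ r = ↑U := by
  rw [RS_nonleaf h, ← exists_and_right]
  apply exists_congr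
  intro r
  apply and_congr_right
  intro hr
  have hd0 : T.drift r = 0 := by simp [Tree.drift, hr]
  have : rootStart T μ r = ↑(startF m t.sh) := by
    ext d
    simp only [rootStart, startF, Finset.coe_inter, Set.mem_inter_iff, Finset.mem_coe, Finset.mem_Icc, Set.mem_ofPred_eq]
    apply and_congr_left
    intro _
    rw [RS_sh hμ t [] h r hr]
    apply exists_congr
    intro j
    rw [simMu_iff hμ, hd0, zero_add]
    apply and_congr_left
    intro _
    constructor
    · rintro (h | h)
      · exact h
      · have := h.pathPre
        rw [hr, List.prefix_nil] at this
        have : j = r := T.inj (this.trans hr.symm)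
        rw [this]; exact Relation.ReflTransGen.refl
    · exact Or.inl
  rw [this, Finset.coe_inj]

end bij


section build
variable {m n : ℕ} {S : Set ℤ}

/-- the subtree at a position -/
def MT.sub : MT m → List ℕ → MT m
  | t, [] => t
  | .leaf, _ :: _ => .leaf
  | .node _ _ ch, c :: q => if h : c < m + 1 then (ch ⟨c, h⟩).sub q else .leaf

lemma sub_nil (t : MT m) : t.sub [] = t := by cases t <;> rfl

lemma sub_leaf (q : List ℕ) : (MT.leaf : MT m).sub q = .leaf := by cases q <;> rfl

lemma sub_append (q : List ℕ) : ∀ (t : MT m) (q' : List ℕ), t.sub (q ++ q') = (t.sub q).sub q' := by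
  induction q with
  | nil => intro t q'; rw [sub_nil]; rfl
  | cons c q ih =>
    intro t q'
    cases t with
    | leaf => rw [sub_leaf, sub_leaf, sub_leaf]
    | node a mk ch =>
      simp only [List.cons_append, MT.sub]
      by_cases h : c < m + 1
      · rw [dif_pos h, dif_pos h, ih]
      · rw [dif_neg h, dif_neg h, sub_leaf]

lemma sub_child {t : MT m} {q : List ℕ} {a : ℕ} {mk : Bool} {ch : Fin (m + 1) → MT m} (h : t.sub q = .node a mk ch) (c : Fin (m + 1)) :
    t.sub (q ++ [(c : ℕ)]) = ch c := by
  rw [sub_append, h]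
  simp only [MT.sub]
  rw [dif_pos c.2]

lemma sub_entry (q : List ℕ) : ∀ t : MT m, t.sub q ≠ .leaf → ∀ c ∈ q, c ≤ m := by
  induction q with
  | nil => intro t _ c hc; simp at hc
  | cons c q ih =>
    intro t h
    cases t with
    | leaf => exact absurd (sub_leaf _) h
    | node a mk ch =>
      simp only [MT.sub] at h
      by_cases hc : c < m + 1
      · rw [dif_pos hc] at h
        intro d hd
        rcases List.mem_cons.1 hd with rfl | hd
        · omega
        · exact ih _ h d hd
      · rw [dif_neg hc] at h; exact absurd rfl h

lemma sub_mem (q : List ℕ) : ∀ (t : MT m) {a : ℕ} {mk : Bool} {ch : Fin (m + 1) → MT m}, t.sub q = .node a mk ch → a ∈ t.lab := by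
  induction q with
  | nil => intro t a mk ch h; rw [sub_nil] at h; rw [h]; simp [MT.lab]
  | cons c q ih =>
    intro t a mk ch h
    cases t with
    | leaf => rw [sub_leaf] at h; cases h
    | node a' mk' ch' =>
      simp only [MT.sub] at h
      by_cases hc : c < m + 1
      · rw [dif_pos hc] at h
        simp only [MT.lab, Multiset.mem_cons, Multiset.mem_sum, Finset.mem_univ, true_and]
        exact Or.inr ⟨_, ih _ h⟩
      · rw [dif_neg hc] at h; cases h

lemma sub_exists : ∀ (t : MT m) {a : ℕ}, a ∈ t.lab → ∃ q mk ch, t.sub q = .node a mk ch := by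
  intro t
  induction t with
  | leaf => intro a h; simp [MT.lab] at h
  | node b mk ch ih =>
    intro a h
    simp only [MT.lab, Multiset.mem_cons, Multiset.mem_sum, Finset.mem_univ, true_and] at h
    rcases h with rfl | ⟨c, h⟩
    · exact ⟨[], mk, ch, rfl⟩
    · obtain ⟨q, mk', ch', hq⟩ := ih c h
      refine ⟨(c : ℕ) :: q, mk', ch', ?_⟩
      simp only [MT.sub]
      rw [dif_pos c.2]; exact hq

lemma sub_uniq : ∀ (t : MT m), t.lab.Nodup → ∀ (q q' : List ℕ) {a : ℕ} {mk mk' : Bool} {ch ch' : Fin (m + 1) → MT m},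
    t.sub q = .node a mk ch → t.sub q' = .node a mk' ch' → q = q' := by
  intro t
  induction t with
  | leaf => intro _ q q' a mk mk' ch ch' h; rw [sub_leaf] at h; cases h
  | node b mk0 ch0 ih =>
    intro hnd q q' a mk mk' ch ch' h h'
    simp only [MT.lab, Multiset.nodup_cons] at hnd
    obtain ⟨hb, hnd⟩ := hnd
    have hmem : ∀ {c : ℕ} {q : List ℕ} {a : ℕ} {mk : Bool} {ch : Fin (m + 1) → MT m}, (MT.node b mk0 ch0).sub (c :: q) = .node a mk ch →
        ∃ hc : c < m + 1, (ch0 ⟨c, hc⟩).sub q = .node a mk ch ∧ a ∈ (ch0 ⟨c, hc⟩).lab := by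
      intro c q a mk ch h
      simp only [MT.sub] at h
      by_cases hc : c < m + 1
      · rw [dif_pos hc] at h
        exact ⟨hc, h, sub_mem _ _ h⟩
      · rw [dif_neg hc] at h; cases h
    have hsum : ∀ {c : Fin (m + 1)} {a : ℕ}, a ∈ (ch0 c).lab → a ∈ ∑ c, (ch0 c).lab := by
      intro c a h
      rw [Multiset.mem_sum]
      exact ⟨c, Finset.mem_univ _, h⟩
    cases q with
    | nil =>
      cases q' with
      | nil => rfl
      | cons c' q' =>
        obtain ⟨hc, _, h2⟩ := hmem h'
        rw [sub_nil] at h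
        cases h
        exact absurd (hsum h2) hb
    | cons c q =>
      cases q' with
      | nil =>
        obtain ⟨hc, _, h2⟩ := hmem h
        rw [sub_nil] at h'
        cases h'
        exact absurd (hsum h2) hb
      | cons c' q' =>
        obtain ⟨hc, h1, h2⟩ := hmem h
        obtain ⟨hc', h1', h2'⟩ := hmem h'
        have hcc : (⟨c, hc⟩ : Fin (m + 1)) = ⟨c', hc'⟩ := by
          by_contra hne
          have h3 : (ch0 ⟨c, hc⟩).lab + (ch0 ⟨c', hc'⟩).lab ≤ ∑ c, (ch0 c).lab := by
            rw [← Finset.sum_pair hne (f := fun c => (ch0 c).lab)]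
            exact Finset.sum_le_sum_of_subset (Finset.subset_univ _)
          have h4 := Multiset.nodup_of_le h3 hnd
          rw [Multiset.nodup_add] at h4
          exact Multiset.disjoint_left.1 h4.2.2 h2 h2'
        have hcc' : c = c' := by simpa using hcc
        subst hcc'
        have hle : (ch0 ⟨c, hc⟩).lab ≤ ∑ c, (ch0 c).lab :=
          Finset.single_le_sum (f := fun c => (ch0 c).lab) (fun _ _ => Multiset.zero_le _) (Finset.mem_univ _)
        rw [ih _ (Multiset.nodup_of_le hle hnd) q q' h1 h1']

lemma sub_V (q : List ℕ) : ∀ (t : MT m) (E : Finset ℕ), t.V S E → ∃ E', (t.sub q).V S E' := by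
  induction q with
  | nil => intro t E h; rw [sub_nil]; exact ⟨E, h⟩
  | cons c q ih =>
    intro t E h
    cases t with
    | leaf => rw [sub_leaf]; exact ⟨∅, trivial⟩
    | node a mk ch =>
      simp only [MT.sub]
      by_cases hc : c < m + 1
      · rw [dif_pos hc]
        simp only [MT.V] at h
        exact ih _ _ (h.2.2 ⟨c, hc⟩)
      · rw [dif_neg hc]; exact ⟨∅, trivial⟩

lemma build {t : MT m} (ht : t ∈ TS m (Finset.range n)) (hV : t.V S {0}) :
    ∃ (T : Tree m n) (μ : Set (Fin n)), IsMarking T μ ∧ RS T μ t [] := by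
  rw [mem_TS] at ht
  have hnd : t.lab.Nodup := by rw [ht]; exact (Finset.range n).nodup
  have hmem : ∀ a, a ∈ t.lab ↔ a < n := by intro a; rw [ht]; simp
  choose f mkf chf hf using fun v : Fin n => sub_exists t ((hmem v).2 v.2)
  have huniq : ∀ {v : Fin n} {q mk ch}, t.sub q = .node v mk ch → f v = q ∧ mkf v = mk ∧ chf v = ch := by
    intro v q mk ch h
    have := sub_uniq t hnd (f v) q (hf v) h
    have h2 := hf v
    rw [this, h] at h2
    cases h2
    exact ⟨this, rfl, rfl⟩
  have hex : ∀ q, t.sub q ≠ .leaf → ∃ v, f v = q := by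
    intro q hq
    cases h : t.sub q with
    | leaf => exact absurd h hq
    | node a mk ch =>
      have ha := (hmem a).1 (sub_mem q t h)
      exact ⟨⟨a, ha⟩, (huniq (v := ⟨a, ha⟩) h).1⟩
  have hnl : ∀ v, t.sub (f v) ≠ .leaf := by
    intro v h
    rw [hf v] at h; cases h
  let T : Tree m n :=
    { path := f
      entry_le := fun v => sub_entry _ t (hnl v)
      inj := by
        intro v w h
        have h1 := hf v
        rw [h, hf w] at h1
        simp only [MT.node.injEq] at h1
        exact (Fin.ext h1.1).symm
      parent_closed := by
        intro v hv
        apply hex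
        intro h
        have h1 := List.dropLast_append_getLast hv
        have h2 := hnl v
        rw [← h1, sub_append, h, sub_leaf] at h2
        exact h2 rfl }
  have hT : ∀ v, T.path v = f v := fun v => rfl
  let μ : Set (Fin n) := {w | ∃ (v : Fin n) (c : Fin (m + 1)), f w = f v ++ [(c : ℕ)] ∧ mkf v = true ∧ IsCad (chf v) c}
  have hmk : ∀ v, mkf v = true → ∃ c, IsCad (chf v) c ∧ ((c : ℕ) = 0 → (v : ℕ) < (chf v c).rt) := by
    intro v h
    obtain ⟨E', hE'⟩ := sub_V (S := S) (f v) t {0} hV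
    rw [hf v] at hE'
    simp only [MT.V] at hE'
    exact hE'.1 h
  have hrt : ∀ v w (c : Fin (m + 1)), f w = f v ++ [(c : ℕ)] → (chf v c).rt = w := by
    intro v w c h
    have h1 := sub_child (hf v) c
    rw [← h, hf w] at h1
    rw [← h1]; rfl
  refine ⟨T, μ, ?_, ?_⟩
  · rintro w ⟨v, c, h1, h2, h3⟩
    refine ⟨v, c, ⟨h1, ?_⟩, ?_⟩
    · rintro s hs hsm ⟨i, hi⟩
      have h4 : f i = f v ++ [s] := hi
      have h5 := sub_child (hf v) ⟨s, by omega⟩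
      simp only at h5
      rw [← h4, h3.2 ⟨s, by omega⟩ (by rw [Fin.lt_def]; exact hs)] at h5
      exact hnl i h5
    · intro hc0
      obtain ⟨c', hc', hlt⟩ := hmk v h2
      have := isCad_unique hc' h3
      subst this
      rw [← hrt v w c' h1]
      exact hlt hc0
  · have key : ∀ (t' : MT m) (q : List ℕ), t.sub q = t' → RS T μ t' q := by
      intro t'
      induction t' with
      | leaf =>
        intro q hq v hv
        apply hnl v
        rw [← hT, hv, hq]
      | node a mk ch ih =>
        intro q hq
        have ha := (hmem a).1 (sub_mem q t hq)
        obtain ⟨e1, e2, e3⟩ := huniq (v := ⟨a, ha⟩) hq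
        refine ⟨⟨a, ha⟩, e1, rfl, ?_, fun c => ih c _ (sub_child hq c)⟩
        constructor
        · intro h
          obtain ⟨c, hc, _⟩ := hmk ⟨a, ha⟩ (e2.trans h)
          have h1 := sub_child (hf ⟨a, ha⟩) c
          obtain ⟨w, hw⟩ := hex (f ⟨a, ha⟩ ++ [(c : ℕ)]) (by rw [h1]; exact hc.1)
          exact ⟨w, ⟨⟨a, ha⟩, c, hw, e2.trans h, hc⟩, c, hw⟩
        · rintro ⟨w, ⟨v, c, h1, h2, h3⟩, s, hs⟩
          have h4 : T.IsChild w v c := h1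
          have h5 := (child_unique h4 hs).1
          rw [h5, e2] at h2
          exact h2
    exact key t [] (sub_nil t)

noncomputable def toMT (p : Tree m n × Set (Fin n)) : MT m := (RS_exists_root p.1 p.2).choose

lemma toMT_spec (p : Tree m n × Set (Fin n)) : RS p.1 p.2 (toMT p) [] := (RS_exists_root p.1 p.2).choose_spec

lemma toMT_sum (hsym : ∀ s : ℤ, s ∈ S ↔ -s ∈ S)
    (hclosed : ∀ s t : ℕ, (s : ℤ) ∉ S → (t : ℤ) ∉ S → ((s : ℤ) + (t : ℤ)) ∉ S)
    (P : MT m → Prop) (Q : Tree m n × Set (Fin n) → Prop)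
    (hPQ : ∀ p ∈ OTset m n (arrS S n), Q p ↔ P (toMT p)) :
    ∑ᶠ p ∈ {p : Tree m n × Set (Fin n) | p ∈ OTset m n (arrS S n) ∧ Q p},
      (Polynomial.X : Polynomial ℚ) ^ (blocksOf p.1 p.2).ncard =
    cnt (fun t : MT m => if P t then wY S t else 0) (Finset.range n) := by
  have h1 : cnt (fun t : MT m => if P t then wY S t else 0) (Finset.range n) =
      ∑ t ∈ (TS m (Finset.range n)).filter (fun t => P t ∧ t.V S {0}), (Polynomial.X : Polynomial ℚ) ^ t.bl := by
    unfold cnt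
    rw [Finset.sum_filter]
    apply Finset.sum_congr rfl
    intro t _
    by_cases h1 : P t <;> by_cases h2 : t.V S {0} <;> simp [h1, h2, wY]
  rw [h1, ← finsum_mem_coe_finset]
  apply finsum_mem_eq_of_bijOn toMT
  · refine ⟨?_, ?_, ?_⟩
    · rintro p ⟨hp, hQ⟩
      simp only [Finset.coe_filter, Set.mem_ofPred_eq]
      exact ⟨RS_lab_root (toMT_spec p), (hPQ p hp).1 hQ, (RS_V_root hp.1 (toMT_spec p)).2 ((otset_iff hsym hclosed hp.1).1 hp.2)⟩
    · rintro p ⟨hp, _⟩ p' ⟨hp', _⟩ e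
      have h1 := toMT_spec p
      rw [e] at h1
      exact RS_inj hp.1 hp'.1 h1 (toMT_spec p')
    · intro t ht
      simp only [Finset.coe_filter, Set.mem_ofPred_eq] at ht
      obtain ⟨hT, hP, hV⟩ := ht
      obtain ⟨T, μ, hμ, hRS⟩ := build hT hV
      have he : toMT (T, μ) = t := RS_unique _ _ _ (toMT_spec (T, μ)) hRS
      have hO : (T, μ) ∈ OTset m n (arrS S n) := ⟨hμ, (otset_iff hsym hclosed hμ).2 ((RS_V_root hμ hRS).1 hV)⟩
      exact ⟨(T, μ), ⟨hO, (hPQ _ hO).2 (by rw [he]; exact hP)⟩, he⟩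
  · rintro p ⟨hp, _⟩
    rw [RS_bl_root hp.1 (toMT_spec p)]

lemma Yg_FGF (hfin : S.Finite) (hsym : ∀ s : ℤ, s ∈ S ↔ -s ∈ S)
    (hclosed : ∀ s t : ℕ, (s : ℤ) ∉ S → (t : ℤ) ∉ S → ((s : ℤ) + (t : ℤ)) ∉ S)
    (hmax : ∀ s ∈ S, s ≤ (m : ℤ)) : Yg m S = FGF S := by
  ext1 n
  simp only [Yg, gf, FGF, PowerSeries.coeff_mk]
  rw [face_sum_trees (m := m) hfin hsym hclosed hmax]
  congr 1
  have h := toMT_sum (m := m) (n := n) hsym hclosed (fun _ => True) (fun _ => True) (fun _ _ => Iff.rfl)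
  simp only [if_true, and_true] at h
  exact h.symm

lemma FUm_FU (hsym : ∀ s : ℤ, s ∈ S ↔ -s ∈ S)
    (hclosed : ∀ s t : ℕ, (s : ℤ) ∉ S → (t : ℤ) ∉ S → ((s : ℤ) + (t : ℤ)) ∉ S) (U : Finset ℕ) : FUm m S U = FU S m U := by
  ext1 n
  simp only [FUm, gf, FU, PowerSeries.coeff_mk]
  congr 1
  have h := toMT_sum (m := m) (n := n) hsym hclosed (fun t => t ≠ .leaf ∧ startF m t.sh = U)
    (fun p => ∃ r : Fin n, p.1.path r = [] ∧ rootStart p.1 p.2 r = ↑U)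
    (fun p hp => (RS_start hp.1 (toMT_spec p) U).symm)
  rw [h]
  unfold cnt
  apply Finset.sum_congr rfl
  intro t _
  unfold wS
  by_cases hc : t ≠ .leaf ∧ startF m t.sh = U
  · exact (if_pos hc).trans (if_pos hc).symm
  · exact (if_neg hc).trans (if_neg hc).symm

end build

/-- Corollary 5.12. With `S` finite nonempty, `S = -S`, `s+t ∉ S` for
`s,t ∈ ℕ∖S` and `m = max S`: `F_S = 1 + Σ_U F_S^U`; if `0 ∈ S` or `U ≠ ∅` then
`F_S^U = Σ_V u·D_S^{U,V}(e^x-1, F_S)·(1 + Σ_W C_S^{V,W}(F_S)·F_S^W)`; and if `0 ∉ S` then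
`F_S^∅ = (1 - e^{-xu})(1 + Σ_V C_S^{∅,V}(F_S)·F_S^V) +
Σ_V u·(D_S^{∅,V}(e^x-1,F_S) - 1_{V=∅}(e^x-1))·(1 + Σ_W C_S^{V,W}(F_S)·F_S^W)`. -/
theorem face_gf_system (S : Set ℤ) (hfin : S.Finite) (hne : S.Nonempty)
    (hsym : ∀ s : ℤ, s ∈ S ↔ -s ∈ S)
    (hclosed : ∀ s t : ℕ, (s : ℤ) ∉ S → (t : ℤ) ∉ S → ((s : ℤ) + (t : ℤ)) ∉ S)
    (m : ℕ) (hmS : (m : ℤ) ∈ S) (hmax : ∀ s ∈ S, s ≤ (m : ℤ)) :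
    FGF S = 1 + ∑ U ∈ (Finset.Icc 1 (m - 1)).powerset, FU S m U ∧
    (∀ U ∈ (Finset.Icc 1 (m - 1)).powerset, ((0 : ℤ) ∈ S ∨ U ≠ ∅) →
      FU S m U = ∑ V ∈ (Finset.Icc 1 (m - 1)).powerset,
        Useries * Dval S m U V *
          (1 + ∑ W ∈ (Finset.Icc 1 (m - 1)).powerset, Cval S m V W (FGF S) * FU S m W)) ∧
    ((0 : ℤ) ∉ S →
      FU S m ∅ =
        (1 - EexuNeg) *
            (1 + ∑ V ∈ (Finset.Icc 1 (m - 1)).powerset, Cval S m ∅ V (FGF S) * FU S m V) +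
          ∑ V ∈ (Finset.Icc 1 (m - 1)).powerset,
            Useries * (Dval S m ∅ V - (if V = ∅ then Eexp - 1 else 0)) *
              (1 + ∑ W ∈ (Finset.Icc 1 (m - 1)).powerset,
                Cval S m V W (FGF S) * FU S m W)) := by
  exact final_all (Yg_FGF hfin hsym hclosed hmax) (fun U _ => FUm_FU hsym hclosed U) hsym hclosed hmax

end Braid
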